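/- Let Z ⊂ ℂ^{n+1} be an irreducible hypersurface defined by an irreducible polynomial p ∈ ℂ[X, Y₁,…,Yₙ] satisfying ∂p/∂X ≠ 0 and ∂p/∂Yₙ ≠ 0. Then MSCD implies: for every finitely generated field K over which Z can be defined, there is z ∈ ℍₙ such that (z, j(z), j₂(z),…,jₙ(z)) ∈ Z and this point is generic in Z over K, i.e. tr.deg_K K(z, j(z),…,jₙ(z)) = n = dim Z. -/

import Mathlib

noncomputable section

namespace ModularJPaper

/-! ### Basic objects: the upper half-plane, Möbius actions, the modular `j`-function -/

/-- The complex upper half-plane, as a subset of `ℂ`. -/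
def HH : Set ℂ := {z : ℂ | 0 < z.im}

/-- The Möbius action of a complex 2×2 matrix on `ℂ`. -/
def moeb (g : Matrix (Fin 2) (Fin 2) ℂ) (z : ℂ) : ℂ :=
  (g 0 0 * z + g 0 1) / (g 1 0 * z + g 1 1)

/-- A rational 2×2 matrix viewed as a complex one. -/
def qmat (g : Matrix (Fin 2) (Fin 2) ℚ) : Matrix (Fin 2) (Fin 2) ℂ :=
  g.map (fun a => (a : ℂ))

/-- An integer 2×2 matrix viewed as a complex one. -/
def zmat (g : Matrix (Fin 2) (Fin 2) ℤ) : Matrix (Fin 2) (Fin 2) ℂ :=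
  g.map (fun a => (a : ℂ))

/-- `IsModularJ j` says that `j : ℂ → ℂ` restricts on the upper half-plane to *the*
modular `j`-function: it is holomorphic on `ℍ`, invariant under `SL₂(ℤ)`, and has a
Fourier expansion `j(z) = q⁻¹ + 744 + ∑_{k ≥ 1} a_k q^k` with `q = exp(2πiz)`.
(These properties determine `j` uniquely on `ℍ`.) -/
structure IsModularJ (j : ℂ → ℂ) : Prop where
  holo : DifferentiableOn ℂ j HH
  invariant : ∀ g : Matrix (Fin 2) (Fin 2) ℤ, g.det = 1 → ∀ z ∈ HH, j (moeb (zmat g) z) = j z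
  fourier : ∃ a : ℕ → ℂ, ∀ z ∈ HH,
    HasSum (fun k : ℕ => a k * Complex.exp (2 * (Real.pi : ℂ) * Complex.I * z) ^ (k + 1))
      (j z - (Complex.exp (2 * (Real.pi : ℂ) * Complex.I * z))⁻¹ - 744)

/-! ### Algebraic sets, Zariski closure, irreducibility, dimension -/

/-- `V` is an algebraic subset of `ℂ^ι` (the common zero set of a family of polynomials). -/
def IsAlgSet {ι : Type*} (V : Set (ι → ℂ)) : Prop :=
  ∃ P : Set (MvPolynomial ι ℂ), V = {x | ∀ p ∈ P, MvPolynomial.eval x p = 0}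

/-- `V` is an algebraic subset of `ℂ^ι` defined by polynomials with coefficients in `L`. -/
def IsAlgSetOver {ι : Type*} (L : Set ℂ) (V : Set (ι → ℂ)) : Prop :=
  ∃ P : Set (MvPolynomial ι ℂ),
    (∀ p ∈ P, ∀ m : ι →₀ ℕ, MvPolynomial.coeff m p ∈ L) ∧
    V = {x | ∀ p ∈ P, MvPolynomial.eval x p = 0}

/-- The Zariski closure of a subset of `ℂ^ι`. -/
def zcl {ι : Type*} (S : Set (ι → ℂ)) : Set (ι → ℂ) :=
  ⋂₀ {T | IsAlgSet T ∧ S ⊆ T}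

/-- Irreducibility (in the Zariski topology) of a subset of `ℂ^ι`. -/
def IsIrr {ι : Type*} (S : Set (ι → ℂ)) : Prop :=
  S.Nonempty ∧ ∀ V W : Set (ι → ℂ), IsAlgSet V → IsAlgSet W → S ⊆ V ∪ W → S ⊆ V ∨ S ⊆ W

/-- The dimension of (the Zariski closure of) a subset of `ℂ^ι`: the supremum of the
lengths of strictly increasing chains of irreducible algebraic subsets of its closure. -/
def adim {ι : Type*} (S : Set (ι → ℂ)) : ℕ :=
  sSup {k : ℕ | ∃ c : Fin (k + 1) → Set (ι → ℂ), StrictMono c ∧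
    ∀ i, IsAlgSet (c i) ∧ IsIrr (c i) ∧ c i ⊆ zcl S}

/-- `X` is an irreducible component of (the Zariski closure of) the set `A`. -/
def IsIrrCompOf {ι : Type*} (X A : Set (ι → ℂ)) : Prop :=
  IsAlgSet X ∧ IsIrr X ∧ X ⊆ zcl A ∧
    ∀ Y : Set (ι → ℂ), IsAlgSet Y → IsIrr Y → Y ⊆ zcl A → X ⊆ Y → X = Y

/-- Constructible subsets of `ℂ^ι`: finite unions of differences of algebraic sets. -/
def IsConstr {ι : Type*} (S : Set (ι → ℂ)) : Prop :=
  ∃ (k : ℕ) (A B : Fin k → Set (ι → ℂ)),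
    (∀ i, IsAlgSet (A i) ∧ IsAlgSet (B i)) ∧ S = ⋃ i, A i \ B i

/-- No coordinate is constant on `V`. -/
def NoConstCoord {ι : Type*} (V : Set (ι → ℂ)) : Prop :=
  ∀ (i : ι) (c : ℂ), ∃ v ∈ V, v i ≠ c

/-- The fibre of a parametric family `F ⊆ ℂ^ι × ℂ^κ` over the parameter `q`. -/
def fib {ι κ : Type*} (F : Set ((ι ⊕ κ) → ℂ)) (q : κ → ℂ) : Set (ι → ℂ) :=
  {s | Sum.elim s q ∈ F}

/-! ### Transcendence degree and finitely generated subfields of `ℂ` -/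

/-- The transcendence degree `tr.deg_K K(v)` of the field generated over `K` by the
coordinates of the tuple `v`: the maximal size of a subfamily of `v` that is
algebraically independent over `K`. -/
def trdegF (K : Subfield ℂ) {ι : Type*} (v : ι → ℂ) : ℕ :=
  sSup {k : ℕ | ∃ t : Finset ι, t.card = k ∧ AlgebraicIndependent K (fun i : t => v i.1)}

/-- `K` is a finitely generated subfield of `ℂ`. -/
def FGField (K : Subfield ℂ) : Prop :=
  ∃ s : Finset ℂ, K = Subfield.closure ↑s

/-! ### The set Σ of quadratic points, `GL₂⁺(ℚ)`-orbits, special points -/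

/-- `Σ`: the quadratic points of the upper half-plane. -/
def SigmaSet : Set ℂ := {z | z ∈ HH ∧ (minpoly ℚ z).natDegree = 2}

/-- `x` and `y` are related by the Möbius action of an element of `G = GL₂⁺(ℚ)`. -/
def GRel (x y : ℂ) : Prop :=
  ∃ g : Matrix (Fin 2) (Fin 2) ℚ, 0 < g.det ∧ moeb (qmat g) x = y

/-- The `GL₂⁺(ℚ)`-orbit of `x`. -/
def Gorb (x : ℂ) : Set ℂ := {y | GRel x y}

/-- `dim_G(z | C)`: the number of distinct `G`-orbits of coordinates of the tuple `z`
which contain no element of `C`. -/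
def dimG {ι : Type*} (z : ι → ℂ) (C : Set ℂ) : ℕ :=
  Set.ncard {S : Set ℂ | ∃ i : ι, S = Gorb (z i) ∧ ∀ c ∈ C, ¬ GRel (z i) c}

/-- `w` is a special point (singular modulus): `w = j(τ)` for a quadratic `τ ∈ ℍ`. -/
def IsSpecialPt (j : ℂ → ℂ) (w : ℂ) : Prop := ∃ τ ∈ SigmaSet, w = j τ

/-- The zero set of the modular polynomial `Φ_N`, described via the modular
correspondence: `Φ_N(x,y) = 0` iff `x = j(z)` and `y = j(gz)` for some `z ∈ ℍ` and
some primitive integer matrix `g` of determinant `N`. -/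
def PhiRel (j : ℂ → ℂ) (N : ℕ) (x y : ℂ) : Prop :=
  ∃ z ∈ HH, ∃ g : Matrix (Fin 2) (Fin 2) ℤ, g.det = (N : ℤ) ∧
    Nat.gcd (Int.gcd (g 0 0) (g 0 1)) (Int.gcd (g 1 0) (g 1 1)) = 1 ∧
    x = j z ∧ y = j (moeb (zmat g) z)

/-! ### Special, weakly special and Möbius subvarieties -/

/-- An algebraic set cut out by modular relations `Φ_N(Y_i, Y_k) = 0` and by equations
`Y_i = τ` with `τ` a special point. -/
def IsSpecialBase {ι : Type*} (j : ℂ → ℂ) (B : Set (ι → ℂ)) : Prop :=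
  ∃ (R : Set (ι × ι × ℕ)) (E : Set (ι × ℂ)),
    (∀ r ∈ R, 1 ≤ r.2.2) ∧ (∀ e ∈ E, IsSpecialPt j e.2) ∧
    B = {y | (∀ r ∈ R, PhiRel j r.2.2 (y r.1) (y r.2.1)) ∧ ∀ e ∈ E, y e.1 = e.2}

/-- A special subvariety of `Y(1)^ι`: an irreducible component of an algebraic set cut
out by modular relations and special-point constant equations. -/
def IsSpecial {ι : Type*} (j : ℂ → ℂ) (T : Set (ι → ℂ)) : Prop :=
  ∃ B, IsSpecialBase j B ∧ IsIrrCompOf T B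

/-- A weakly special subvariety of `Y(1)^ι`: an irreducible component of an algebraic
set cut out by modular relations and arbitrary constant equations. -/
def IsWSpecial {ι : Type*} (j : ℂ → ℂ) (T : Set (ι → ℂ)) : Prop :=
  ∃ (R : Set (ι × ι × ℕ)) (E : Set (ι × ℂ)), (∀ r ∈ R, 1 ≤ r.2.2) ∧
    IsIrrCompOf T {y | (∀ r ∈ R, PhiRel j r.2.2 (y r.1) (y r.2.1)) ∧ ∀ e ∈ E, y e.1 = e.2}

/-- A weakly special subvariety of complexity at most `N`: only modular polynomials
`Φ_M` with `M ≤ N` are needed to define it. -/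
def IsWSpecialLE {ι : Type*} (j : ℂ → ℂ) (N : ℕ) (T : Set (ι → ℂ)) : Prop :=
  ∃ (R : Set (ι × ι × ℕ)) (E : Set (ι × ℂ)), (∀ r ∈ R, 1 ≤ r.2.2 ∧ r.2.2 ≤ N) ∧
    IsIrrCompOf T {y | (∀ r ∈ R, PhiRel j r.2.2 (y r.1) (y r.2.1)) ∧ ∀ e ∈ E, y e.1 = e.2}

/-- A basic special subvariety: a special subvariety with no constant coordinates. -/
def IsBasicSpecial {ι : Type*} (j : ℂ → ℂ) (T : Set (ι → ℂ)) : Prop :=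
  IsSpecial j T ∧ NoConstCoord T

/-- The special closure of `X`: the smallest special subvariety containing `X`. -/
def spcl {ι : Type*} (j : ℂ → ℂ) (X : Set (ι → ℂ)) : Set (ι → ℂ) :=
  ⋂₀ {T | IsSpecial j T ∧ X ⊆ T}

/-- The weakly special closure of `X`. -/
def wspcl {ι : Type*} (j : ℂ → ℂ) (X : Set (ι → ℂ)) : Set (ι → ℂ) :=
  ⋂₀ {T | IsWSpecial j T ∧ X ⊆ T}

/-- The Möbius relation `M_g(x,y) = y(cx+d) - (ax+b) = 0` attached to a 2×2 matrix. -/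
def MrelC (g : Matrix (Fin 2) (Fin 2) ℂ) (x y : ℂ) : Prop :=
  y * (g 1 0 * x + g 1 1) - (g 0 0 * x + g 0 1) = 0

/-- A 2×2 matrix is non-scalar. -/
def NonScalar (g : Matrix (Fin 2) (Fin 2) ℂ) : Prop :=
  ¬ (g 0 1 = 0 ∧ g 1 0 = 0 ∧ g 0 0 = g 1 1)

/-- A Möbius subvariety of `ℂ^ι`: cut out by finitely many relations `M_g(X_i, X_k) = 0`
with `g` non-scalar in `GL₂(ℂ)`. -/
def IsMoebius {ι : Type*} (M : Set (ι → ℂ)) : Prop :=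
  ∃ (D : Finset (ι × ι)) (f : ι × ι → Matrix (Fin 2) (Fin 2) ℂ),
    (∀ p ∈ D, (f p).det ≠ 0 ∧ NonScalar (f p)) ∧
    M = {x | ∀ p ∈ D, MrelC (f p) (x p.1) (x p.2)}

/-- A Möbius subvariety of `ℂ^ι` defined by matrices in `G = GL₂⁺(ℚ)`. -/
def IsMoebiusQpos {ι : Type*} (M : Set (ι → ℂ)) : Prop :=
  ∃ (D : Finset (ι × ι)) (f : ι × ι → Matrix (Fin 2) (Fin 2) ℚ),
    (∀ p ∈ D, 0 < (f p).det ∧ NonScalar (qmat (f p))) ∧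
    M = {x | ∀ p ∈ D, MrelC (qmat (f p)) (x p.1) (x p.2)}

/-- A Möbius subvariety of `ℂ^ι` defined over `ℚ` (rational invertible non-scalar
matrices). -/
def IsMoebiusRat {ι : Type*} (M : Set (ι → ℂ)) : Prop :=
  ∃ (D : Finset (ι × ι)) (f : ι × ι → Matrix (Fin 2) (Fin 2) ℚ),
    (∀ p ∈ D, (f p).det ≠ 0 ∧ NonScalar (qmat (f p))) ∧
    M = {x | ∀ p ∈ D, MrelC (qmat (f p)) (x p.1) (x p.2)}

/-! ### The two-sorted space `ℂⁿ × Y(1)ⁿ`, broadness, freeness, (EC) -/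

/-- The coordinate projection `Pr_i : ℂⁿ × Y(1)ⁿ → ℂ^ℓ × Y(1)^ℓ` attached to a tuple
`i₁ < ⋯ < i_ℓ`. -/
def prSum {n ℓ : ℕ} (i : Fin ℓ → Fin n) (v : (Fin n ⊕ Fin n) → ℂ) : (Fin ℓ ⊕ Fin ℓ) → ℂ :=
  Sum.elim (fun k => v (Sum.inl (i k))) (fun k => v (Sum.inr (i k)))

/-- `V ⊆ ℂⁿ × Y(1)ⁿ` is broad: `dim Pr_i(V) ≥ ℓ` for every tuple `i₁ < ⋯ < i_ℓ`. -/
def Broad {n : ℕ} (V : Set ((Fin n ⊕ Fin n) → ℂ)) : Prop :=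
  ∀ (ℓ : ℕ) (i : Fin ℓ → Fin n), 1 ≤ ℓ → StrictMono i → ℓ ≤ adim (prSum i '' V)

/-- `V ⊆ ℂⁿ × Y(1)ⁿ` is modularly free: `V` is not contained in `ℂⁿ × T` for any proper
special subvariety `T` of `Y(1)ⁿ`. -/
def ModularlyFree {n : ℕ} (j : ℂ → ℂ) (V : Set ((Fin n ⊕ Fin n) → ℂ)) : Prop :=
  ∀ T : Set (Fin n → ℂ), IsSpecial j T → T ≠ Set.univ →
    ¬ V ⊆ {v | (fun k => v (Sum.inr k)) ∈ T}

/-- `V ⊆ ℂⁿ × Y(1)ⁿ` is free. -/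
def Free {n : ℕ} (j : ℂ → ℂ) (V : Set ((Fin n ⊕ Fin n) → ℂ)) : Prop :=
  NoConstCoord V ∧
  (∀ M : Set (Fin n → ℂ), IsMoebiusQpos M → M ≠ Set.univ →
    ¬ V ⊆ {v | (fun k => v (Sum.inl k)) ∈ M}) ∧
  ModularlyFree j V

/-- The graph `E_jⁿ ⊆ ℂⁿ × Y(1)ⁿ` of the `j`-function. -/
def Ej (j : ℂ → ℂ) (n : ℕ) : Set ((Fin n ⊕ Fin n) → ℂ) :=
  {v | (∀ k, v (Sum.inl k) ∈ HH) ∧ ∀ k, v (Sum.inr k) = j (v (Sum.inl k))}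

/-- `V` satisfies (EC): `V ∩ E_jⁿ` is Zariski dense in `V`. -/
def SatisfiesEC {n : ℕ} (j : ℂ → ℂ) (V : Set ((Fin n ⊕ Fin n) → ℂ)) : Prop :=
  V ⊆ zcl (V ∩ Ej j n)

/-! ### MSCD and MZP -/

/-- The modular Schanuel conjecture with derivatives. -/
def MSCD (j : ℂ → ℂ) : Prop :=
  ∀ (n : ℕ) (z : Fin n → ℂ), (∀ i, z i ∈ HH) →
    3 * dimG z SigmaSet ≤
      trdegF ⊥ (fun p : Fin 4 × Fin n =>
        ![z, j ∘ z, deriv j ∘ z, deriv (deriv j) ∘ z] p.1 p.2)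

/-- `X` is an atypical component of `W ⊆ Y(1)ⁿ`: an irreducible component of `W ∩ T`,
for some special subvariety `T`, with `dim X > dim W + dim T − n`. -/
def IsAtypComp {n : ℕ} (j : ℂ → ℂ) (W X : Set (Fin n → ℂ)) : Prop :=
  ∃ T, IsSpecial j T ∧ IsIrrCompOf X (W ∩ T) ∧
    (adim W : ℤ) + (adim T : ℤ) - (n : ℤ) < (adim X : ℤ)

/-- The modular Zilber–Pink conjecture: every subvariety of `Y(1)ⁿ` has finitely many
maximal atypical components. -/
def MZP (j : ℂ → ℂ) : Prop :=
  ∀ (n : ℕ) (W : Set (Fin n → ℂ)), IsAlgSet W →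
    {X | IsAtypComp j W X ∧ ∀ X', IsAtypComp j W X' → X ⊆ X' → X = X'}.Finite

/-! ### `j`-derivations, `jcl`, `C_j`, `dim^j` -/

/-- A `j`-derivation on `ℂ`. -/
def IsJDeriv (j : ℂ → ℂ) (D : ℂ → ℂ) : Prop :=
  (∀ a b : ℂ, D (a + b) = D a + D b) ∧
  (∀ a b : ℂ, D (a * b) = a * D b + b * D a) ∧
  (∀ z ∈ HH, ∀ k : ℕ, D (deriv^[k] j z) = deriv^[k + 1] j z * D z)

/-- The `j`-closure of a subset of `ℂ`. -/
def jcl (j : ℂ → ℂ) (A : Set ℂ) : Set ℂ :=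
  {x | ∀ D : ℂ → ℂ, IsJDeriv j D → (∀ a ∈ A, D a = 0) → D x = 0}

/-- `C_j = jcl(∅)`. -/
def Cj (j : ℂ → ℂ) : Set ℂ := jcl j ∅

/-- `dim^j(A|B) ≥ n`. -/
def dimjGE (j : ℂ → ℂ) (A B : Set ℂ) (n : ℕ) : Prop :=
  ∃ (a : Fin n → ℂ) (D : Fin n → ℂ → ℂ),
    (∀ i, a i ∈ jcl j A) ∧
    (∀ i, IsJDeriv j (D i) ∧ ∀ b ∈ B, D i b = 0) ∧
    (∀ i k, D i (a k) = if i = k then 1 else 0)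

/-- `dim^j(A|B)`, the relative dimension in the pregeometry `jcl`. -/
def dimj (j : ℂ → ℂ) (A B : Set ℂ) : ℕ := sSup {n | dimjGE j A B n}

/-- `V ⊆ ℂⁿ × Y(1)ⁿ` (broad) has no `C_j`-factors. -/
def NoCjFactors {n : ℕ} (j : ℂ → ℂ) (V : Set ((Fin n ⊕ Fin n) → ℂ)) : Prop :=
  ∀ (ℓ : ℕ) (i : Fin ℓ → Fin n), 1 ≤ ℓ → StrictMono i →
    ℓ < adim (prSum i '' V) ∨
    (adim (prSum i '' V) = ℓ ∧ ¬ IsAlgSetOver (Cj j) (zcl (prSum i '' V)))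

/-- A tuple `t ∈ ℍ^m` is convenient for `j`:
`tr.deg_ℚ ℚ(t, J(t)) = 3 dim_G(t|Σ) + dim^j(t)`. -/
def ConvenientTuple (j : ℂ → ℂ) {m : ℕ} (t : Fin m → ℂ) : Prop :=
  (∀ i, t i ∈ HH) ∧
  trdegF ⊥ (fun p : Fin 4 × Fin m =>
      ![t, j ∘ t, deriv j ∘ t, deriv (deriv j) ∘ t] p.1 p.2)
    = 3 * dimG t SigmaSet + dimj j (Set.range t) ∅

/-! ### Iterates of `j` -/

/-- The iterates of `j`: `jIt j 0 = id`, `jIt j (n+1) = j ∘ jIt j n`; so `j_n = jIt j n`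
for `n ≥ 1`. -/
def jIt (j : ℂ → ℂ) : ℕ → ℂ → ℂ
  | 0 => id
  | n + 1 => j ∘ jIt j n

/-- The domain `ℍ_n` of `j_n`: `ℍ₁ = ℍ`, `ℍ_{n+1} = {z ∈ ℍ_n : j_n(z) ∈ ℍ}`. -/
def HHn (j : ℂ → ℂ) : ℕ → Set ℂ
  | 0 => Set.univ
  | n + 1 => {z ∈ HHn j n | jIt j n z ∈ HH}

/-! ### The space `ℂⁿ × Y₂(1)ⁿ` with derivatives -/

/-- The projection `PR_i : ℂⁿ × Y₂(1)ⁿ → ℂ^ℓ × Y₂(1)^ℓ`. -/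
def prJ {n ℓ : ℕ} (i : Fin ℓ → Fin n) (v : (Fin n ⊕ Fin n × Fin 3) → ℂ) :
    (Fin ℓ ⊕ Fin ℓ × Fin 3) → ℂ :=
  Sum.elim (fun k => v (Sum.inl (i k))) (fun p => v (Sum.inr (i p.1, p.2)))

/-- `V ⊆ ℂⁿ × Y₂(1)ⁿ` is `J`-broad: `dim PR_i(V) ≥ 3ℓ` for all `i`. -/
def JBroad {n : ℕ} (V : Set ((Fin n ⊕ Fin n × Fin 3) → ℂ)) : Prop :=
  ∀ (ℓ : ℕ) (i : Fin ℓ → Fin n), 1 ≤ ℓ → StrictMono i → 3 * ℓ ≤ adim (prJ i '' V)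

/-- `V ⊆ ℂⁿ × Y₂(1)ⁿ` is `J`-free. -/
def JFree {n : ℕ} (j : ℂ → ℂ) (V : Set ((Fin n ⊕ Fin n × Fin 3) → ℂ)) : Prop :=
  NoConstCoord V ∧
  (∀ M : Set (Fin n → ℂ), IsMoebiusRat M → M ≠ Set.univ →
    ¬ V ⊆ {v | (fun k => v (Sum.inl k)) ∈ M}) ∧
  (∀ T : Set (Fin n → ℂ), IsSpecial j T → T ≠ Set.univ →
    ¬ V ⊆ {v | (fun k => v (Sum.inr (k, 0))) ∈ T})

/-- The graph `E_Jⁿ ⊆ ℂⁿ × Y₂(1)ⁿ` of `J = (j, j′, j″)`. -/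
def EJ (j : ℂ → ℂ) (n : ℕ) : Set ((Fin n ⊕ Fin n × Fin 3) → ℂ) :=
  {v | (∀ k, v (Sum.inl k) ∈ HH) ∧ ∀ k : Fin n,
      v (Sum.inr (k, 0)) = j (v (Sum.inl k)) ∧
      v (Sum.inr (k, 1)) = deriv j (v (Sum.inl k)) ∧
      v (Sum.inr (k, 2)) = deriv (deriv j) (v (Sum.inl k))}

/-- `V ⊆ ℂⁿ × Y₂(1)ⁿ` (J-broad) has no `C_j`-factors. -/
def NoCjFactorsJ {n : ℕ} (j : ℂ → ℂ) (V : Set ((Fin n ⊕ Fin n × Fin 3) → ℂ)) : Prop :=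
  ∀ (ℓ : ℕ) (i : Fin ℓ → Fin n), 1 ≤ ℓ → StrictMono i →
    3 * ℓ < adim (prJ i '' V) ∨
    (adim (prJ i '' V) = 3 * ℓ ∧ ¬ IsAlgSetOver (Cj j) (zcl (prJ i '' V)))

section

open Complex Filter Topology

/-- The local parameter of level `N` at the cusp. -/
def sexp (N : ℕ) (z : ℂ) : ℂ := cexp (2 * (Real.pi : ℂ) * I * z / N)

/-- The filter of points whose imaginary part tends to infinity. -/
def cusp : Filter ℂ := comap Complex.im atTop

lemma sexp_ne_zero (N : ℕ) (z : ℂ) : sexp N z ≠ 0 := Complex.exp_ne_zero _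

lemma norm_sexp (N : ℕ) (z : ℂ) : ‖sexp N z‖ = Real.exp (-(2 * Real.pi * z.im / N)) := by
  rw [sexp, Complex.norm_exp]
  congr 1
  have : (2 * (Real.pi : ℂ) * I * z / N) = ((2 * Real.pi / N : ℝ) : ℂ) * (I * z) := by
    push_cast; ring
  rw [this, Complex.re_ofReal_mul]
  simp
  ring

instance cusp_neBot : cusp.NeBot := by
  refine comap_neBot fun t ht => ?_
  obtain ⟨a, ha⟩ := (mem_atTop_sets.1 ht)
  exact ⟨⟨0, a⟩, ha a le_rfl⟩

lemma tendsto_im_cusp : Tendsto Complex.im cusp atTop := tendsto_comap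

lemma eventually_cusp_mem_HH : ∀ᶠ z in cusp, z ∈ HH :=
  tendsto_im_cusp.eventually (eventually_gt_atTop 0)

lemma tendsto_sexp_cusp {N : ℕ} (hN : 0 < N) : Tendsto (sexp N) cusp (𝓝 0) := by
  rw [tendsto_zero_iff_norm_tendsto_zero]
  simp only [norm_sexp]
  refine Real.tendsto_exp_atBot.comp (tendsto_neg_atTop_atBot.comp ?_)
  have h : (fun z : ℂ => 2 * Real.pi * z.im / N) = fun z => (2 * Real.pi / N) * z.im := by
    ext; ring
  rw [h]
  have : (0 : ℝ) < N := by exact_mod_cast hN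
  exact tendsto_im_cusp.const_mul_atTop (by positivity)

/-- `g` is the sum of the power series `F` in the parameter `sexp N` on the upper half-plane. -/
def PS (N : ℕ) (F : PowerSeries ℂ) (g : ℂ → ℂ) : Prop :=
  ∀ z ∈ HH, HasSum (fun n => PowerSeries.coeff n F * sexp N z ^ n) (g z)

namespace PS

variable {N : ℕ} {F G : PowerSeries ℂ} {f g : ℂ → ℂ}

lemma congr (h : PS N F f) (hfg : ∀ z ∈ HH, f z = g z) : PS N F g :=
  fun z hz => hfg z hz ▸ h z hz

lemma add (h : PS N F f) (h' : PS N G g) : PS N (F + G) (fun z => f z + g z) := by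
  intro z hz
  simpa [add_mul] using (h z hz).add (h' z hz)

lemma mul (h : PS N F f) (h' : PS N G g) : PS N (F * G) (fun z => f z * g z) := by
  intro z hz
  have h1 := (h z hz).summable.norm
  have h2 := (h' z hz).summable.norm
  have h3 := summable_norm_sum_mul_antidiagonal_of_summable_norm h1 h2
  have h4 := tsum_mul_tsum_eq_tsum_sum_antidiagonal_of_summable_norm h1 h2
  rw [(h z hz).tsum_eq, (h' z hz).tsum_eq] at h4
  have key : ∀ n, PowerSeries.coeff n (F * G) * sexp N z ^ n =
      ∑ kl ∈ Finset.HasAntidiagonal.antidiagonal n, PowerSeries.coeff kl.1 F * sexp N z ^ kl.1 *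
        (PowerSeries.coeff kl.2 G * sexp N z ^ kl.2) := by
    intro n
    rw [PowerSeries.coeff_mul, Finset.sum_mul]
    refine Finset.sum_congr rfl fun kl hkl => ?_
    rw [← Finset.HasAntidiagonal.mem_antidiagonal.1 hkl, pow_add]; ring
  simp only [key]
  rw [h4]
  exact h3.of_norm.hasSum

lemma const (a : ℂ) : PS N (PowerSeries.C a) (fun _ => a) := by
  intro z _
  have := hasSum_single (f := fun n => PowerSeries.coeff n (PowerSeries.C a) * sexp N z ^ n) 0
    (fun n hn => by simp [PowerSeries.coeff_C, hn])
  simpa using this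

lemma X : PS N PowerSeries.X (sexp N) := by
  intro z _
  have := hasSum_single
    (f := fun n => PowerSeries.coeff n (PowerSeries.X : PowerSeries ℂ) * sexp N z ^ n) 1
    (fun n hn => by simp [PowerSeries.coeff_X, hn])
  simpa using this

lemma pow (h : PS N F f) (k : ℕ) : PS N (F ^ k) (fun z => f z ^ k) := by
  induction k with
  | zero => simpa using const (N := N) 1
  | succ k ih => simpa [pow_succ] using ih.mul h

lemma sub (h : PS N F f) (h' : PS N G g) : PS N (F - G) (fun z => f z - g z) := by
  intro z hz
  simpa [sub_mul] using (h z hz).sub (h' z hz)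

lemma of_X_mul (h : PS N (PowerSeries.X * F) (fun z => sexp N z * f z)) : PS N F f := by
  intro z hz
  have h1 := h z hz
  rw [← hasSum_nat_add_iff' 1] at h1
  simp only [PowerSeries.coeff_succ_X_mul, Finset.range_one, Finset.sum_singleton,
    PowerSeries.coeff_zero_X_mul, zero_mul, sub_zero] at h1
  have h2 := h1.mul_left (sexp N z)⁻¹
  have h0 := sexp_ne_zero N z
  have h3 : (fun n => PowerSeries.coeff n F * sexp N z ^ n) =
      fun n => (sexp N z)⁻¹ * (PowerSeries.coeff n F * sexp N z ^ (n + 1)) := by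
    ext n; rw [pow_succ]; field_simp
  rw [h3]
  rwa [inv_mul_cancel_left₀ h0] at h2

lemma of_X_pow_mul (k : ℕ) (h : PS N (PowerSeries.X ^ k * F) (fun z => sexp N z ^ k * f z)) :
    PS N F f := by
  induction k generalizing F f with
  | zero => simpa using h
  | succ k ih =>
    refine of_X_mul (ih ?_)
    simpa [pow_succ, mul_assoc] using h

lemma tendsto (hN : 0 < N) (h : PS N F f) :
    Tendsto f cusp (𝓝 (PowerSeries.coeff 0 F)) := by
  have hI : I ∈ HH := by simp [HH]
  have hs := (h I hI).summable.norm
  have h1 : Tendsto (fun z => ∑' n, PowerSeries.coeff n F * sexp N z ^ n) cusp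
      (𝓝 (∑' n, PowerSeries.coeff n F * (0 : ℂ) ^ n)) := by
    refine tendsto_tsum_of_dominated_convergence hs (fun n => ?_) ?_
    · exact ((tendsto_sexp_cusp hN).pow n).const_mul _
    · filter_upwards [tendsto_im_cusp.eventually (eventually_ge_atTop 1)] with z hz n
      simp only [norm_mul, norm_pow]
      gcongr
      rw [norm_sexp, norm_sexp, Real.exp_le_exp]
      have : (0 : ℝ) < N := by exact_mod_cast hN
      simp only [I_im]
      gcongr
  have h2 : ∑' n, PowerSeries.coeff n F * (0 : ℂ) ^ n = PowerSeries.coeff 0 F := by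
    rw [tsum_eq_single 0]
    · simp
    · intro n hn; simp [hn]
  rw [h2] at h1
  refine h1.congr' ?_
  filter_upwards [eventually_cusp_mem_HH] with z hz
  exact (h z hz).tsum_eq

lemma eq_zero (hN : 0 < N) (h : PS N F (fun _ => 0)) : F = 0 := by
  by_contra hF
  obtain ⟨m, E, hE, hFE⟩ : ∃ (m : ℕ) (E : PowerSeries ℂ), PowerSeries.coeff 0 E ≠ 0 ∧
      F = PowerSeries.X ^ m * E := by
    obtain ⟨E, hE⟩ := PowerSeries.X_pow_order_dvd (φ := F)
    refine ⟨F.order.toNat, E, ?_, hE⟩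
    have h1 := PowerSeries.coeff_order hF
    rw [hE] at h1
    have h2 : (PowerSeries.X ^ F.order.toNat * E).order.toNat = F.order.toNat := by rw [← hE]
    rw [h2] at h1
    simpa [PowerSeries.coeff_X_pow_mul'] using h1
  rw [hFE] at h
  have h1 : PS N E (fun _ => 0) := of_X_pow_mul m (by simpa using h)
  exact hE (tendsto_nhds_unique (h1.tendsto hN) tendsto_const_nhds)

lemma unique (hN : 0 < N) (h : PS N F f) (h' : PS N G f) : F = G := by
  have := (h.sub h')
  simp only [sub_self] at this
  exact sub_eq_zero.1 (this.eq_zero hN)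

end PS

end

section

open Complex Filter Topology UpperHalfPlane ModularForm MatrixGroups

/-- Invariance under `SL₂(ℤ)` on the upper half-plane. -/
def Inv (f : ℂ → ℂ) : Prop :=
  ∀ g : Matrix (Fin 2) (Fin 2) ℤ, g.det = 1 → ∀ z ∈ HH, f (moeb (zmat g) z) = f z

lemma isOpen_HH : IsOpen HH := isOpen_lt continuous_const Complex.continuous_im

lemma moeb_zmat_eq_smul (g : SL(2, ℤ)) (z : ℍ) :
    moeb (zmat (g : Matrix (Fin 2) (Fin 2) ℤ)) (z : ℂ) = ((g • z : ℍ) : ℂ) := by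
  rw [UpperHalfPlane.coe_specialLinearGroup_apply]
  simp [moeb, zmat]

lemma Inv.smul {f : ℂ → ℂ} (hf : Inv f) (g : SL(2, ℤ)) (z : ℍ) :
    f ((g • z : ℍ) : ℂ) = f z := by
  rw [← moeb_zmat_eq_smul]
  exact hf _ g.2 _ z.2

/-- A holomorphic `SL₂(ℤ)`-invariant function with a finite limit at the cusp is constant. -/
lemma Inv.eq_const {f : ℂ → ℂ} (hf : Inv f) (hd : DifferentiableOn ℂ f HH) {l : ℂ}
    (hl : Tendsto f cusp (𝓝 l)) : ∀ z ∈ HH, f z = l := by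
  have hslash : ∀ g : SL(2, ℤ), (fun z : ℍ => f z) ∣[(0 : ℤ)] g = fun z : ℍ => f z := by
    intro g
    ext z
    rw [ModularForm.SL_slash_apply]
    simpa using! hf.smul g z
  have hb : IsBoundedAtImInfty (fun z : ℍ => f z) := by
    have h1 : Tendsto (fun z : ℍ => (z : ℂ)) atImInfty cusp := by
      rw [cusp, tendsto_comap_iff]
      exact tendsto_comap
    exact (hl.comp h1).isBigO_one ℝ
  let F : ModularForm 𝒮ℒ 0 :=
    { toFun := fun z : ℍ => f z
      slash_action_eq' := by
        rintro A ⟨A, rfl⟩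
        exact hslash A
      holo' := by
        rw [UpperHalfPlane.mdifferentiable_iff]
        refine hd.congr fun z hz => ?_
        simp [ofComplex_apply_of_im_pos hz]
      bdd_at_cusps' := by
        intro c hc
        rw [Subgroup.IsArithmetic.isCusp_iff_isCusp_SL2Z] at hc
        rw [OnePoint.isBoundedAt_iff_forall_SL2Z hc]
        intro γ _
        rw [hslash]
        exact hb }
  obtain ⟨c, hc⟩ := ModularFormClass.levelOne_weight_zero_const F
  have h2 : ∀ z ∈ HH, f z = c := fun z hz => congrFun hc ⟨z, hz⟩
  have h3 : Tendsto f cusp (𝓝 c) := by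
    refine tendsto_const_nhds.congr' ?_
    filter_upwards [eventually_cusp_mem_HH] with z hz using (h2 z hz).symm
  intro z hz
  rw [h2 z hz, tendsto_nhds_unique h3 hl]

lemma ps_modularForm {k : ℤ} {F : Type*} [FunLike F ℍ ℂ] [ModularFormClass F 𝒮ℒ k] (f : F) :
    PS 1 (qExpansion 1 f) (fun z => f (ofComplex z)) := by
  intro z hz
  have := ModularForm.hasSum_qExpansion f one_pos one_mem_strictPeriods_SL (⟨z, hz⟩ : ℍ)
  have h2 : ofComplex z = ⟨z, hz⟩ := ofComplex_apply_of_im_pos hz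
  beta_reduce
  rw [h2]
  simpa [Function.Periodic.qParam, sexp] using! this

end

section

open Complex Filter Topology UpperHalfPlane ModularForm MatrixGroups

/-- The divisor power sum series. -/
def sigSer (k : ℕ) : PowerSeries ℤ :=
  PowerSeries.mk fun m => if m = 0 then 0 else (ArithmeticFunction.sigma k m : ℤ)

/-- The integer series underlying `E₄`. -/
def e4Ser : PowerSeries ℤ := 1 + (240 : ℤ) • sigSer 3

/-- The integer series underlying `E₆`. -/
def e6Ser : PowerSeries ℤ := 1 - (504 : ℤ) • sigSer 5

lemma e4Ser_eq : qExpansion 1 E₄ = PowerSeries.map (Int.castRingHom ℂ) e4Ser := by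
  ext m
  rw [EisensteinSeries.E_qExpansion_coeff _ (by decide), PowerSeries.coeff_map]
  have hb : bernoulli 4 = -1 / 30 := by
    rw [bernoulli_eq_bernoulli'_of_ne_one (by norm_num), bernoulli'_four]
  by_cases hm : m = 0
  · subst hm; simp [e4Ser, sigSer, -zsmul_eq_mul]
  · simp [e4Ser, sigSer, hm, PowerSeries.coeff_one, hb, -zsmul_eq_mul]
    norm_num

lemma e6Ser_eq : qExpansion 1 E₆ = PowerSeries.map (Int.castRingHom ℂ) e6Ser := by
  ext m
  rw [EisensteinSeries.E_qExpansion_coeff _ (by decide), PowerSeries.coeff_map]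
  have hb : bernoulli 6 = 1 / 42 := by
    have h5 : bernoulli' 5 = 0 := bernoulli'_eq_zero_of_odd (by decide) (by norm_num)
    rw [bernoulli_eq_bernoulli'_of_ne_one (by decide), bernoulli'_def]
    norm_num [Finset.sum_range_succ, h5, Nat.choose]
  by_cases hm : m = 0
  · subst hm; simp [e6Ser, sigSer, -zsmul_eq_mul]
  · simp [e6Ser, sigSer, hm, PowerSeries.coeff_one, hb, -zsmul_eq_mul]
    norm_num

lemma twelve_dvd_sigma (m : ℕ) :
    (12 : ℤ) ∣ 5 * (ArithmeticFunction.sigma 3 m : ℤ) + 7 * (ArithmeticFunction.sigma 5 m : ℤ) := by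
  simp only [ArithmeticFunction.sigma_apply]
  push_cast
  rw [Finset.mul_sum, Finset.mul_sum, ← Finset.sum_add_distrib]
  refine Finset.dvd_sum fun d _ => ?_
  have h : ∀ x : ZMod 12, 5 * x ^ 3 + 7 * x ^ 5 = 0 := by decide
  have := h (d : ZMod 12)
  refine (ZMod.intCast_zmod_eq_zero_iff_dvd _ 12).1 ?_
  push_cast
  exact this

/-- The integer series underlying `Δ`. -/
def dSer : PowerSeries ℤ :=
  PowerSeries.mk (fun m => if m = 0 then 0 else
    (5 * (ArithmeticFunction.sigma 3 m : ℤ) + 7 * (ArithmeticFunction.sigma 5 m : ℤ)) / 12)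
  + ((100 : ℤ) • sigSer 3 ^ 2 + (8000 : ℤ) • sigSer 3 ^ 3
    - (147 : ℤ) • sigSer 5 ^ 2)

lemma dSer_mul : (1728 : ℤ) • dSer = e4Ser ^ 3 - e6Ser ^ 2 := by
  have h : (12 : ℤ) • PowerSeries.mk (fun m => if m = 0 then 0 else
      (5 * (ArithmeticFunction.sigma 3 m : ℤ) + 7 * (ArithmeticFunction.sigma 5 m : ℤ)) / 12)
      = (5 : ℤ) • sigSer 3 + (7 : ℤ) • sigSer 5 := by
    ext m
    simp only [map_zsmul, smul_eq_mul, PowerSeries.coeff_mk, map_add, sigSer]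
    split_ifs
    · simp
    · exact Int.mul_ediv_cancel' (twelve_dvd_sigma m)
  rw [dSer, e4Ser, e6Ser]
  simp only [zsmul_eq_mul] at h ⊢
  push_cast at h ⊢
  linear_combination 144 * h

lemma exists_dSer_eq : ∃ U : PowerSeries ℤ, dSer = PowerSeries.X * U ∧
    PowerSeries.constantCoeff U = 1 := by
  have h0 : PowerSeries.constantCoeff dSer = 0 := by
    simp [dSer, sigSer]
  obtain ⟨U, hU⟩ := PowerSeries.X_dvd_iff.2 h0
  refine ⟨U, hU, ?_⟩
  have h1 : PowerSeries.coeff 1 dSer = PowerSeries.constantCoeff U := by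
    rw [hU, show (1 : ℕ) = 0 + 1 from rfl, PowerSeries.coeff_succ_X_mul]; simp
  rw [← h1]
  have h2 : ∀ k, PowerSeries.coeff 1 (sigSer k ^ 2) = 0 := by
    intro k
    have : (PowerSeries.X : PowerSeries ℤ) ^ 2 ∣ sigSer k ^ 2 :=
      pow_dvd_pow_of_dvd (PowerSeries.X_dvd_iff.2 (by simp [sigSer])) 2
    exact PowerSeries.X_pow_dvd_iff.1 this 1 (by norm_num)
  have h3 : ∀ k, PowerSeries.coeff 1 (sigSer k ^ 3) = 0 := by
    intro k
    have : (PowerSeries.X : PowerSeries ℤ) ^ 3 ∣ sigSer k ^ 3 :=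
      pow_dvd_pow_of_dvd (PowerSeries.X_dvd_iff.2 (by simp [sigSer])) 3
    exact PowerSeries.X_pow_dvd_iff.1 this 1 (by norm_num)
  rw [dSer]
  simp [h2, h3, -zsmul_eq_mul]

lemma ps_discriminant :
    PS 1 (PowerSeries.map (Int.castRingHom ℂ) dSer) (fun z => discriminant (ofComplex z)) := by
  have h4 := (ps_modularForm E₄).pow 3
  have h6 := (ps_modularForm E₆).pow 2
  have := (PS.const (1 / 1728 : ℂ)).mul (h4.sub h6)
  rw [e4Ser_eq, e6Ser_eq, ← map_pow, ← map_pow, ← map_sub, ← dSer_mul] at this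
  have h : PowerSeries.C (1 / 1728 : ℂ) *
      PowerSeries.map (Int.castRingHom ℂ) ((1728 : ℤ) • dSer) =
      PowerSeries.map (Int.castRingHom ℂ) dSer := by
    ext m
    rw [PowerSeries.coeff_C_mul, PowerSeries.coeff_map, map_zsmul, PowerSeries.coeff_map]
    simp
  rw [h] at this
  refine this.congr fun z _ => ?_
  rw [discriminant_eq_E₄_cube_sub_E₆_sq]
  ring

end

section

open Complex Filter Topology UpperHalfPlane ModularForm MatrixGroups

variable {j : ℂ → ℂ}

lemma IsModularJ.exists_series (hj : IsModularJ j) : ∃ A : PowerSeries ℂ,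
    PS 1 A (fun z => sexp 1 z * j z) ∧ PowerSeries.coeff 0 A = 1 ∧
      PowerSeries.coeff 1 A = 744 := by
  obtain ⟨a, ha⟩ := hj.fourier
  have h1 : PS 1 (PowerSeries.mk a) (fun z => (sexp 1 z)⁻¹ * (j z - (sexp 1 z)⁻¹ - 744)) := by
    intro z hz
    have h0 := sexp_ne_zero 1 z
    have := (ha z hz).mul_left (sexp 1 z)⁻¹
    have e : cexp (2 * (Real.pi : ℂ) * Complex.I * z) = sexp 1 z := by simp [sexp]
    rw [e] at this
    have h3 : (fun n => PowerSeries.coeff n (PowerSeries.mk a) * sexp 1 z ^ n) =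
        fun n => (sexp 1 z)⁻¹ * (a n * sexp 1 z ^ (n + 1)) := by
      ext n
      rw [PowerSeries.coeff_mk, pow_succ]; field_simp
    rw [h3]
    exact this
  refine ⟨1 + PowerSeries.X * PowerSeries.C 744 + PowerSeries.X * (PowerSeries.X * PowerSeries.mk a),
    ?_, by simp, ?_⟩
  · have := ((PS.const (N := 1) 1).add (PS.X.mul (PS.const 744))).add (PS.X.mul (PS.X.mul h1))
    rw [map_one] at this
    refine this.congr fun z _ => ?_
    have h0 := sexp_ne_zero 1 z
    field_simp
    ring
  · rw [show (1 : ℕ) = 0 + 1 from rfl]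
    simp [PowerSeries.coeff_succ_X_mul, -zero_add, PowerSeries.coeff_one]

lemma discriminant_smul (g : SL(2, ℤ)) (z : ℍ) :
    discriminant (g • z) = denom g z ^ (12 : ℤ) * discriminant z := by
  have h := congrFun (SlashInvariantForm.slash_action_generators_SL2Z discriminant_S_invariant
    discriminant_T_invariant g) z
  rw [ModularForm.SL_slash_apply] at h
  have h2 := denom_ne_zero g z
  rw [← h, mul_comm, mul_assoc, ← zpow_add₀ h2]
  simp

lemma E₄_smul (g : SL(2, ℤ)) (z : ℍ) : E₄ (g • z) = denom g z ^ (4 : ℤ) * E₄ z := by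
  have h := congrFun (SlashInvariantFormClass.slash_action_eq E₄
    (Matrix.SpecialLinearGroup.mapGL ℝ g) ⟨g, rfl⟩) z
  change ((E₄ : ℍ → ℂ) ∣[(4 : ℤ)] g) z = _ at h
  rw [ModularForm.SL_slash_apply] at h
  have h2 := denom_ne_zero g z
  rw [← h, mul_comm, mul_assoc, ← zpow_add₀ h2]
  simp

/-- The Laurent coefficients of `j` are integers. -/
lemma IsModularJ.exists_int_series (hj : IsModularJ j) : ∃ A : PowerSeries ℤ,
    PS 1 (PowerSeries.map (Int.castRingHom ℂ) A) (fun z => sexp 1 z * j z) ∧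
      PowerSeries.coeff 0 A = 1 := by
  obtain ⟨A, hA, hA0, hA1⟩ := hj.exists_series
  obtain ⟨U, hU, hUu⟩ := exists_dSer_eq
  set φ := PowerSeries.map (Int.castRingHom ℂ) with hφ
  have hD := ps_discriminant
  have hE := (ps_modularForm E₄).pow 3
  rw [e4Ser_eq, ← map_pow] at hE
  rw [hU] at hD
  have hjD : PS 1 (A * φ U) (fun z => j z * discriminant (ofComplex z)) := by
    refine PS.of_X_mul ?_
    have := hA.mul hD
    rw [map_mul, PowerSeries.map_X] at this
    rw [show PowerSeries.X * (A * φ U) = A * (PowerSeries.X * φ U) by ring]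
    exact this.congr fun z _ => by ring
  have hUz : PS 1 (φ U) (fun z => (sexp 1 z)⁻¹ * discriminant (ofComplex z)) := by
    refine PS.of_X_mul ?_
    rw [map_mul, PowerSeries.map_X] at hD
    refine hD.congr fun z _ => ?_
    have := sexp_ne_zero 1 z
    field_simp
  have hG := hjD.sub hE
  have hcc : ∀ F, PowerSeries.constantCoeff (φ F) = ((PowerSeries.constantCoeff F : ℤ) : ℂ) :=
      fun F => by
    rw [← PowerSeries.coeff_zero_eq_constantCoeff_apply, PowerSeries.coeff_map]
    simp
  have hU0 : PowerSeries.constantCoeff (φ U) = 1 := by rw [hcc, hUu, Int.cast_one]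
  have hG0 : PowerSeries.constantCoeff (A * φ U - φ (e4Ser ^ 3)) = 0 := by
    have hA0' : PowerSeries.constantCoeff A = 1 := by simpa using hA0
    rw [map_sub, map_mul, hcc, hcc, hUu, hA0']
    simp [e4Ser, sigSer, -zsmul_eq_mul]
  obtain ⟨V, hV⟩ := PowerSeries.X_dvd_iff.2 hG0
  rw [hV] at hG
  have hVz : PS 1 V (fun z => (sexp 1 z)⁻¹ *
      (j z * discriminant (ofComplex z) - E₄ (ofComplex z) ^ 3)) := by
    refine PS.of_X_mul (hG.congr fun z _ => ?_)
    have := sexp_ne_zero 1 z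
    field_simp
  set f : ℂ → ℂ := fun z => j z - E₄ (ofComplex z) ^ 3 / discriminant (ofComplex z) with hf
  have hlim : Tendsto f cusp (𝓝 (PowerSeries.coeff 0 V / PowerSeries.coeff 0 (φ U))) := by
    refine ((hVz.tendsto one_pos).div (hUz.tendsto one_pos) (by simp [hU0])).congr fun z => ?_
    have h1 := sexp_ne_zero 1 z
    have h2 := discriminant_ne_zero (ofComplex z)
    simp only [hf, Pi.div_apply]
    field_simp
  have hinv : Inv f := by
    intro g hg z hz
    obtain ⟨g', rfl⟩ : ∃ g' : SL(2, ℤ), g = (g' : Matrix (Fin 2) (Fin 2) ℤ) := ⟨⟨g, hg⟩, rfl⟩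
    have h1 := moeb_zmat_eq_smul g' ⟨z, hz⟩
    change moeb (zmat _) z = _ at h1
    have h2 : ofComplex z = ⟨z, hz⟩ := ofComplex_apply_of_im_pos hz
    simp only [hf]
    rw [hj.invariant _ hg z hz, h1, ofComplex_apply, h2, discriminant_smul, E₄_smul]
    have h3 := denom_ne_zero (g' : GL (Fin 2) ℝ) ⟨z, hz⟩
    have h4 := discriminant_ne_zero ⟨z, hz⟩
    rw [mul_pow, ← zpow_natCast, ← zpow_mul]
    norm_num
    rw [mul_div_mul_left]
    exact zpow_ne_zero 12 h3
  have hdiff : DifferentiableOn ℂ f HH := by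
    refine hj.holo.sub (DifferentiableOn.div (DifferentiableOn.pow ?_ 3) ?_
      fun z _ => discriminant_ne_zero _)
    · exact UpperHalfPlane.mdifferentiable_iff.1 E₄.holo'
    · exact UpperHalfPlane.mdifferentiable_iff.1 CuspForm.discriminant.holo'
  have hconst := hinv.eq_const hdiff hlim
  set α := PowerSeries.coeff 0 V / PowerSeries.coeff 0 (φ U)
  have key : PowerSeries.X * V = PowerSeries.C α * (PowerSeries.X * φ U) := by
    rw [map_mul, PowerSeries.map_X] at hD
    refine hG.unique one_pos (((PS.const α).mul hD).congr fun z hz => ?_)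
    have h1 := hconst z hz
    have h2 := discriminant_ne_zero (ofComplex z)
    simp only [hf] at h1
    rw [← h1]
    field_simp
  rw [← hV] at key
  obtain ⟨W, hW⟩ : ∃ W, U * W = 1 :=
    isUnit_iff_exists_inv.1 (PowerSeries.isUnit_iff_constantCoeff.2 (by simp [hUu]))
  have hW' : φ U * φ W = 1 := by rw [← map_mul, hW, map_one]
  have key2 : A = φ (e4Ser ^ 3 * W) + PowerSeries.C α * PowerSeries.X := by
    rw [map_mul]
    linear_combination φ W * key - (A - PowerSeries.C α * PowerSeries.X) * hW'
  have hα : α = ((744 - PowerSeries.coeff 1 (e4Ser ^ 3 * W) : ℤ) : ℂ) := by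
    have := congrArg (PowerSeries.coeff 1) key2
    rw [hA1] at this
    simp only [hφ, map_add, PowerSeries.coeff_map, PowerSeries.coeff_C_mul, PowerSeries.coeff_X,
      if_true, mul_one, eq_intCast] at this
    push_cast
    linear_combination -this
  have hAφ : A = φ (e4Ser ^ 3 * W +
      PowerSeries.C (744 - PowerSeries.coeff 1 (e4Ser ^ 3 * W)) * PowerSeries.X) := by
    rw [map_add, map_mul φ (PowerSeries.C _), PowerSeries.map_C, PowerSeries.map_X, eq_intCast,
      ← hα]
    exact key2
  refine ⟨_, hAφ ▸ hA, ?_⟩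
  rw [hAφ, PowerSeries.coeff_map, eq_intCast] at hA0
  exact_mod_cast hA0

end

section

open Complex Filter Topology

variable {j : ℂ → ℂ}

lemma isPreconnected_HH : IsPreconnected HH :=
  (convex_halfSpace_im_gt 0).isPreconnected

lemma IsModularJ.inv (hj : IsModularJ j) : Inv j := hj.invariant

lemma IsModularJ.tendsto_sexp_mul (hj : IsModularJ j) :
    Tendsto (fun z => sexp 1 z * j z) cusp (𝓝 1) := by
  obtain ⟨A, hA, hA0, -⟩ := hj.exists_series
  simpa [hA0] using hA.tendsto one_pos

lemma IsModularJ.tendsto_inv (hj : IsModularJ j) (w : ℂ) :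
    Tendsto (fun z => (j z - w)⁻¹) cusp (𝓝 0) := by
  have h1 := (tendsto_sexp_cusp one_pos)
  have h2 : Tendsto (fun z => sexp 1 z * j z - sexp 1 z * w) cusp (𝓝 (1 - 0 * w)) :=
    hj.tendsto_sexp_mul.sub (h1.mul_const w)
  have h3 := h1.div h2 (by simp)
  simp only [zero_mul, sub_zero, div_one] at h3
  refine h3.congr fun z => ?_
  have := sexp_ne_zero 1 z
  simp only [Pi.div_apply]
  rw [← mul_sub, div_mul_eq_div_div, div_self this, one_div]

lemma IsModularJ.surj (hj : IsModularJ j) (w : ℂ) : ∃ z ∈ HH, j z = w := by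
  by_contra! h
  have h' : ∀ z ∈ HH, j z - w ≠ 0 := fun z hz => sub_ne_zero.2 (h z hz)
  have hinv : Inv (fun z => (j z - w)⁻¹) := fun g hg z hz => by
    simp only [hj.invariant g hg z hz]
  have := hinv.eq_const ((hj.holo.sub_const w).inv h') (hj.tendsto_inv w)
  have hI : I ∈ HH := by simp [HH]
  exact inv_ne_zero (h' I hI) (this I hI)

lemma IsModularJ.analyticOnNhd (hj : IsModularJ j) : AnalyticOnNhd ℂ j HH :=
  hj.holo.analyticOnNhd isOpen_HH

lemma countable_zeros {f : ℂ → ℂ} (hf : AnalyticOnNhd ℂ f HH) (hne : ∃ z ∈ HH, f z ≠ 0) :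
    {z ∈ HH | f z = 0}.Countable := by
  have hd : ∀ z ∈ {z ∈ HH | f z = 0}, {z} ∈ 𝓝[{z ∈ HH | f z = 0}] z := by
    rintro z ⟨hz, -⟩
    obtain ⟨w, hw, hfw⟩ := hne
    rcases (hf z hz).eventually_eq_zero_or_eventually_ne_zero with h | h
    · exact absurd (hf.eqOn_zero_of_preconnected_of_eventuallyEq_zero isPreconnected_HH hz h hw) hfw
    · rw [mem_nhdsWithin_iff_eventually]
      rw [eventually_nhdsWithin_iff] at h
      filter_upwards [h] with x hx hx'
      by_contra hne
      exact hx hne hx'.2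
  obtain ⟨t, hts, htc, hst⟩ := TopologicalSpace.countable_cover_nhdsWithin hd
  refine htc.mono fun x hx => ?_
  obtain ⟨y, hy, hxy⟩ := Set.mem_iUnion₂.1 (hst hx)
  rwa [Set.mem_singleton_iff.1 hxy]

lemma IsModularJ.deriv_ne_zero (hj : IsModularJ j) : ∃ z ∈ HH, deriv j z ≠ 0 := by
  by_contra! h
  obtain ⟨a, ha⟩ := isOpen_HH.exists_is_const_of_deriv_eq_zero isPreconnected_HH hj.holo
    (fun z hz => h z hz)
  obtain ⟨z, hz, hz'⟩ := hj.surj (a + 1)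
  rw [ha z hz] at hz'
  simp at hz'

/-- The critical values of `j` form a countable set. -/
lemma IsModularJ.countable_crit (hj : IsModularJ j) :
    (j '' {z ∈ HH | deriv j z = 0}).Countable :=
  (countable_zeros hj.analyticOnNhd.deriv hj.deriv_ne_zero).image j

end

section

open Complex Filter Topology Matrix

variable {g h : Matrix (Fin 2) (Fin 2) ℚ} {z : ℂ}

lemma zmat_eq_qmat (g : Matrix (Fin 2) (Fin 2) ℤ) : zmat g = qmat (g.map (Int.cast : ℤ → ℚ)) := by
  ext i k; simp [zmat, qmat]

lemma det_map_intCast (g : Matrix (Fin 2) (Fin 2) ℤ) :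
    (g.map (Int.cast : ℤ → ℚ)).det = (g.det : ℚ) := by
  simp [Matrix.det_fin_two]

lemma denom_ne (hg : 0 < g.det) (hz : z ∈ HH) : (g 1 0 : ℂ) * z + (g 1 1 : ℂ) ≠ 0 := by
  intro h
  have him := congrArg Complex.im h
  have hre := congrArg Complex.re h
  simp at him hre
  have hz' : z.im ≠ 0 := ne_of_gt hz
  have h10 : g 1 0 = 0 := by
    rcases him with h | h
    · exact h
    · exact absurd h hz'
  have h11 : g 1 1 = 0 := by
    rw [h10] at hre
    simpa using hre
  rw [Matrix.det_fin_two, h10, h11] at hg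
  simp at hg

lemma moeb_qmat (g : Matrix (Fin 2) (Fin 2) ℚ) (z : ℂ) :
    moeb (qmat g) z = ((g 0 0 : ℂ) * z + (g 0 1 : ℂ)) / ((g 1 0 : ℂ) * z + (g 1 1 : ℂ)) := rfl

lemma im_moeb (g : Matrix (Fin 2) (Fin 2) ℚ) (z : ℂ) :
    (moeb (qmat g) z).im = (g.det : ℝ) * z.im / Complex.normSq ((g 1 0 : ℂ) * z + (g 1 1 : ℂ)) := by
  rw [moeb_qmat, Complex.div_im, Matrix.det_fin_two]
  simp
  ring

lemma moeb_mem_HH (hg : 0 < g.det) (hz : z ∈ HH) : moeb (qmat g) z ∈ HH := by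
  change 0 < (moeb (qmat g) z).im
  rw [im_moeb]
  have h1 : (0 : ℝ) < g.det := by exact_mod_cast hg
  exact div_pos (mul_pos h1 hz) (Complex.normSq_pos.2 (denom_ne hg hz))

lemma moeb_mul (hg : 0 < g.det) (hh : 0 < h.det) (hz : z ∈ HH) :
    moeb (qmat (g * h)) z = moeb (qmat g) (moeb (qmat h) z) := by
  have h1 := denom_ne hh hz
  have h2 := denom_ne hg (moeb_mem_HH hh hz)
  have h3 := denom_ne (g := g * h) (by rw [Matrix.det_mul]; positivity) hz
  rw [moeb_qmat h] at h2
  rw [moeb_qmat, moeb_qmat g, moeb_qmat h]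
  simp only [Matrix.mul_apply, Fin.sum_univ_two] at h3 ⊢
  push_cast at h3 ⊢
  rw [div_eq_div_iff h3 h2]
  field_simp
  ring

lemma moeb_one (z : ℂ) : moeb (qmat 1) z = z := by
  simp [moeb_qmat]

lemma moeb_smul {c : ℚ} (hc : c ≠ 0) (g : Matrix (Fin 2) (Fin 2) ℚ) (z : ℂ) :
    moeb (qmat (c • g)) z = moeb (qmat g) z := by
  have hc' : (c : ℂ) ≠ 0 := by exact_mod_cast hc
  simp only [moeb_qmat, Matrix.smul_apply, smul_eq_mul]
  push_cast
  rw [mul_assoc, mul_assoc, ← mul_add, ← mul_add, mul_div_mul_left _ _ hc']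

lemma moeb_inv_moeb (hg : 0 < g.det) (hz : z ∈ HH) : moeb (qmat g⁻¹) (moeb (qmat g) z) = z := by
  have h1 : IsUnit g.det := isUnit_iff_ne_zero.2 hg.ne'
  rw [← moeb_mul (by rw [Matrix.det_nonsing_inv, Ring.inverse_eq_inv']; positivity) hg hz,
    Matrix.nonsing_inv_mul _ h1, moeb_one]

lemma det_inv_pos (hg : 0 < g.det) : 0 < (g⁻¹).det := by
  rw [Matrix.det_nonsing_inv, Ring.inverse_eq_inv']; positivity

lemma GRel.refl (x : ℂ) : GRel x x := ⟨1, by simp, moeb_one x⟩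

lemma GRel.mem {x y : ℂ} (h : GRel x y) (hx : x ∈ HH) : y ∈ HH := by
  obtain ⟨g, hg, rfl⟩ := h
  exact moeb_mem_HH hg hx

lemma GRel.symm {x y : ℂ} (h : GRel x y) (hx : x ∈ HH) : GRel y x := by
  obtain ⟨g, hg, rfl⟩ := h
  exact ⟨g⁻¹, det_inv_pos hg, moeb_inv_moeb hg hx⟩

lemma GRel.trans {x y w : ℂ} (h : GRel x y) (h' : GRel y w) (hx : x ∈ HH) : GRel x w := by
  obtain ⟨g, hg, rfl⟩ := h
  obtain ⟨g', hg', rfl⟩ := h'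
  exact ⟨g' * g, by rw [Matrix.det_mul]; positivity, moeb_mul hg' hg hx⟩

lemma differentiableOn_moeb (hg : 0 < g.det) : DifferentiableOn ℂ (moeb (qmat g)) HH := by
  have : moeb (qmat g) = fun z => ((g 0 0 : ℂ) * z + (g 0 1 : ℂ)) / ((g 1 0 : ℂ) * z + (g 1 1 : ℂ)) :=
    rfl
  rw [this]
  exact DifferentiableOn.div (by fun_prop) (by fun_prop) fun z hz => denom_ne hg hz

/-- A rational matrix acts like an integral one. -/
lemma exists_int_matrix (g : Matrix (Fin 2) (Fin 2) ℚ) (hg : 0 < g.det) :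
    ∃ m : Matrix (Fin 2) (Fin 2) ℤ, 0 < m.det ∧
      ∀ z, moeb (qmat g) z = moeb (qmat (m.map (Int.cast : ℤ → ℚ))) z := by
  obtain ⟨b, hb⟩ := IsLocalization.exist_integer_multiples_of_finite (nonZeroDivisors ℤ)
    (fun ik : Fin 2 × Fin 2 => g ik.1 ik.2)
  choose f hf using hb
  have hb0 : ((b : ℤ) : ℚ) ≠ 0 := by exact_mod_cast nonZeroDivisors.coe_ne_zero b
  have hm : (Matrix.of fun i k => f (i, k)).map (Int.cast : ℤ → ℚ) = ((b : ℤ) : ℚ) • g := by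
    ext i k
    have := hf (i, k)
    simpa using this
  refine ⟨Matrix.of fun i k => f (i, k), ?_, fun z => ?_⟩
  · have := det_map_intCast (Matrix.of fun i k => f (i, k))
    rw [hm, Matrix.det_smul] at this
    have h2 : (0 : ℚ) < ((Matrix.of fun i k => f (i, k)).det : ℚ) := by
      rw [← this]; simp only [Fintype.card_fin]; positivity
    exact_mod_cast h2
  · rw [hm, moeb_smul hb0]

end

section

open Complex Filter Topology Matrix

variable {j : ℂ → ℂ}

lemma sexp_pow_self {N : ℕ} (hN : 0 < N) (z : ℂ) : sexp N z ^ N = sexp 1 z := by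
  have : (N : ℂ) ≠ 0 := by exact_mod_cast hN.ne'
  rw [sexp, ← Complex.exp_nat_mul, sexp]
  congr 1
  field_simp
  simp

lemma sexp_add_one (N : ℕ) (z : ℂ) : sexp N (z + 1) = cexp (2 * Real.pi * I / N) * sexp N z := by
  rw [sexp, sexp, ← Complex.exp_add]
  congr 1
  ring

/-- Substitution of `ζ X ^ e` in a power series. -/
def expandSer (e : ℕ) (ζ : ℂ) (F : PowerSeries ℂ) : PowerSeries ℂ :=
  PowerSeries.mk fun n => if e ∣ n then PowerSeries.coeff (n / e) F * ζ ^ (n / e) else 0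

lemma PS.comp {M N e : ℕ} {F : PowerSeries ℂ} {g τ : ℂ → ℂ} {ζ : ℂ} (h : PS M F g) (he : 0 < e)
    (hτ : ∀ z ∈ HH, τ z ∈ HH) (hs : ∀ z ∈ HH, sexp M (τ z) = ζ * sexp N z ^ e) :
    PS N (expandSer e ζ F) (fun z => g (τ z)) := by
  intro z hz
  have h1 := h (τ z) (hτ z hz)
  have hinj : Function.Injective (fun n : ℕ => n * e) := fun a b hab =>
    Nat.eq_of_mul_eq_mul_right he hab
  rw [← hinj.hasSum_iff]
  · convert h1 using 2 with n
    simp only [Function.comp, expandSer, PowerSeries.coeff_mk, dvd_mul_right, if_true,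
      Nat.mul_div_cancel_left _ he, hs z hz, mul_pow, ← pow_mul, mul_comm n e]
    ring
  · intro n hn
    have : ¬ e ∣ n := fun ⟨c, hc⟩ => hn ⟨c, by simp [hc, mul_comm]⟩
    simp [expandSer, this]

lemma coeff_zero_expandSer (e : ℕ) (ζ : ℂ) (F : PowerSeries ℂ) :
    PowerSeries.coeff 0 (expandSer e ζ F) = PowerSeries.coeff 0 F := by
  simp [expandSer]

/-- Power series with coefficients in the subring `R`. -/
def serOver (R : Subring ℂ) : Subring (PowerSeries ℂ) := (PowerSeries.map R.subtype).range

lemma mem_serOver {R : Subring ℂ} {F : PowerSeries ℂ} :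
    F ∈ serOver R ↔ ∀ n, PowerSeries.coeff n F ∈ R := by
  constructor
  · rintro ⟨G, rfl⟩ n
    simp
  · intro h
    exact ⟨PowerSeries.mk fun n => ⟨_, h n⟩, by ext n; simp⟩

lemma expandSer_mem {R : Subring ℂ} {F : PowerSeries ℂ} {ζ : ℂ} (e : ℕ) (hF : F ∈ serOver R)
    (hζ : ζ ∈ R) : expandSer e ζ F ∈ serOver R := by
  rw [mem_serOver] at hF ⊢
  intro n
  rw [expandSer, PowerSeries.coeff_mk]
  split_ifs
  · exact R.mul_mem (hF _) (R.pow_mem hζ _)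
  · exact R.zero_mem

lemma C_mem_serOver {R : Subring ℂ} {c : ℂ} (hc : c ∈ R) : PowerSeries.C c ∈ serOver R :=
  ⟨PowerSeries.C ⟨c, hc⟩, by simp⟩

lemma X_mem_serOver {R : Subring ℂ} : (PowerSeries.X : PowerSeries ℂ) ∈ serOver R :=
  ⟨PowerSeries.X, by simp⟩

lemma IsModularJ.exists_serOver (hj : IsModularJ j) (R : Subring ℂ) :
    ∃ A ∈ serOver R, PS 1 A (fun z => sexp 1 z * j z) ∧ PowerSeries.coeff 0 A = 1 := by
  obtain ⟨A, hA, hA0⟩ := hj.exists_int_series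
  refine ⟨_, mem_serOver.2 fun n => ?_, hA, ?_⟩
  · simp
  · rw [PowerSeries.coeff_map, hA0]; simp

lemma Inv.add_one {f : ℂ → ℂ} (hf : Inv f) {z : ℂ} (hz : z ∈ HH) : f (z + 1) = f z := by
  have := hf !![1, 1; 0, 1] (by simp [Matrix.det_fin_two]) z hz
  simpa [moeb, zmat] using this

lemma tendsto_add_one_cusp : Tendsto (fun z : ℂ => z + 1) cusp cusp := by
  rw [cusp, tendsto_comap_iff]
  have : Complex.im ∘ (fun z : ℂ => z + 1) = Complex.im := by ext z; simp
  rw [this]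
  exact tendsto_comap

/-- A holomorphic modular function with a meromorphic expansion at the cusp over `R` is a
polynomial in `j` over `R`. -/
lemma IsModularJ.exists_poly (hj : IsModularJ j) (R : Subring ℂ) {N : ℕ} (hN : 0 < N) (k : ℕ) :
    ∀ (f : ℂ → ℂ) (F : PowerSeries ℂ), Inv f → DifferentiableOn ℂ f HH → F ∈ serOver R →
      PS N F (fun z => sexp N z ^ k * f z) →
      ∃ E : Polynomial R, ∀ z ∈ HH, f z = E.eval₂ R.subtype (j z) := by
  obtain ⟨A, hAR, hA, hA0⟩ := hj.exists_serOver R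
  induction k with
  | zero =>
    intro f F hf hd hF hPS
    have h1 : PS N F f := by simpa using hPS
    refine ⟨Polynomial.C ⟨_, mem_serOver.1 hF 0⟩, fun z hz => ?_⟩
    simpa using hf.eq_const hd (h1.tendsto hN) z hz
  | succ k ih =>
    have step : ∀ (f : ℂ → ℂ) (F : PowerSeries ℂ), Inv f → DifferentiableOn ℂ f HH →
        F ∈ serOver R → PS N F (fun z => sexp N z ^ (k + 1) * f z) → PowerSeries.coeff 0 F = 0 →
        ∃ E : Polynomial R, ∀ z ∈ HH, f z = E.eval₂ R.subtype (j z) := by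
      intro f F hf hd hF hPS h0
      obtain ⟨G, hG⟩ := PowerSeries.X_dvd_iff.2
        (by simpa [PowerSeries.coeff_zero_eq_constantCoeff] using h0 :
          PowerSeries.constantCoeff F = 0)
      subst hG
      refine ih f G hf hd (mem_serOver.2 fun n => ?_) (PS.of_X_mul ?_)
      · simpa using mem_serOver.1 hF (n + 1)
      · refine hPS.congr fun z _ => ?_
        rw [pow_succ]; ring
    intro f F hf hd hF hPS
    by_cases h0 : PowerSeries.coeff 0 F = 0
    · exact step f F hf hd hF hPS h0
    have hζ : cexp (2 * Real.pi * I / N) ^ (k + 1) = 1 := by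
      have h1 := hPS.tendsto hN
      have h2 := h1.comp tendsto_add_one_cusp
      have h3 : Tendsto (fun z => cexp (2 * Real.pi * I / N) ^ (k + 1) *
          (sexp N z ^ (k + 1) * f z)) cusp (𝓝 (PowerSeries.coeff 0 F)) := by
        refine h2.congr' ?_
        filter_upwards [eventually_cusp_mem_HH] with z hz
        simp only [Function.comp, sexp_add_one, hf.add_one hz]
        ring
      have h4 := tendsto_nhds_unique h3 (h1.const_mul _)
      exact mul_right_cancel₀ h0 (by rw [one_mul]; exact h4.symm)
    have hdvd : N ∣ k + 1 :=
      (Complex.isPrimitiveRoot_exp N hN.ne').dvd_of_pow_eq_one _ hζ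
    obtain ⟨m, hm⟩ := hdvd
    have hB := hA.comp (τ := id) (N := N) (ζ := 1) hN (fun z hz => hz)
      (fun z _ => by simp [sexp_pow_self hN])
    set c := PowerSeries.coeff 0 F with hc
    have hcR : c ∈ R := mem_serOver.1 hF 0
    have hPS' := hPS.sub ((PS.const c).mul (hB.pow m))
    obtain ⟨E, hE⟩ := step (fun z => f z - c * j z ^ m) _
      (fun g hg z hz => by simp only [hf g hg z hz, hj.invariant g hg z hz])
      (hd.sub ((hj.holo.pow m).const_mul c))
      ((serOver R).sub_mem hF ((serOver R).mul_mem (C_mem_serOver hcR)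
        ((serOver R).pow_mem (expandSer_mem N hAR R.one_mem) m)))
      (hPS'.congr fun z _ => by
        simp only [id, mul_pow, hm, pow_mul, sexp_pow_self hN]; ring)
      (by
        rw [map_sub, ← hc, PowerSeries.coeff_C_mul]
        have : PowerSeries.coeff 0 (expandSer N 1 A ^ m) = 1 := by
          rw [PowerSeries.coeff_zero_eq_constantCoeff, map_pow,
            ← PowerSeries.coeff_zero_eq_constantCoeff, coeff_zero_expandSer, hA0, one_pow]
        simp [this])
    refine ⟨E + Polynomial.C ⟨c, hcR⟩ * Polynomial.X ^ m, fun z hz => ?_⟩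
    simp [← hE z hz]

end

section

open Complex Filter Topology Matrix

variable {j : ℂ → ℂ}

/-- The ring of algebraic integers. -/
abbrev Zbar : Subring ℂ := (integralClosure ℤ ℂ).toSubring

lemma mem_Zbar {x : ℂ} : x ∈ Zbar ↔ IsIntegral ℤ x := Iff.rfl

/-- The branches of the modular correspondence of level `N`, as functions supported on `HH`. -/
def branches (j : ℂ → ℂ) (N : ℕ) : Set (ℂ → ℂ) :=
  {f | ∃ m : Matrix (Fin 2) (Fin 2) ℤ, m.det = N ∧ f = HH.indicator fun z => j (moeb (zmat m) z)}

lemma moeb_zmat_mem_HH {m : Matrix (Fin 2) (Fin 2) ℤ} (hm : 0 < m.det) {z : ℂ} (hz : z ∈ HH) :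
    moeb (zmat m) z ∈ HH := by
  rw [zmat_eq_qmat]
  exact moeb_mem_HH (by rw [det_map_intCast]; exact_mod_cast hm) hz

lemma moeb_zmat_mul {g h : Matrix (Fin 2) (Fin 2) ℤ} (hg : 0 < g.det) (hh : 0 < h.det)
    {z : ℂ} (hz : z ∈ HH) : moeb (zmat (g * h)) z = moeb (zmat g) (moeb (zmat h) z) := by
  rw [zmat_eq_qmat, zmat_eq_qmat, zmat_eq_qmat, ← moeb_mul _ _ hz]
  · congr 2
    exact Matrix.map_mul (f := Int.castRingHom ℚ)
  all_goals rw [det_map_intCast]; exact_mod_cast ‹_›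

lemma exists_smul_mem_reps {m : ℤ} (hm : m ≠ 0) (A : FixedDetMatrix (Fin 2) ℤ m) :
    ∃ g : SpecialLinearGroup (Fin 2) ℤ, g • A ∈ FixedDetMatrices.reps m := by
  have : ∃ g : SpecialLinearGroup (Fin 2) ℤ, g • A = FixedDetMatrices.reduce A := by
    induction A using FixedDetMatrices.reduce_rec with
    | step A h1 h2 =>
      obtain ⟨g, hg⟩ := h2
      rw [FixedDetMatrices.reduce_reduceStep h1] at hg
      rw [← hg, FixedDetMatrices.reduceStep]
      exact ⟨g * (ModularGroup.S * ModularGroup.T ^ (-(A.1 0 0 / A.1 1 0))), by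
        rw [mul_smul, mul_smul]⟩
    | base A h =>
      by_cases ha : 0 < A.1 0 0
      · exact ⟨_, (FixedDetMatrices.reduce_of_pos h ha).symm⟩
      · rw [FixedDetMatrices.reduce_of_not_pos h ha]
        exact ⟨ModularGroup.T ^ (-(-A.1 0 1 / -A.1 1 1)) * (ModularGroup.S * ModularGroup.S), by
          rw [mul_smul, mul_smul]⟩
  obtain ⟨g, hg⟩ := this
  exact ⟨g, hg ▸ FixedDetMatrices.reduce_mem_reps hm A⟩

lemma Inv.exists_reps {f : ℂ → ℂ} (hf : Inv f) {m : Matrix (Fin 2) (Fin 2) ℤ} {N : ℕ} (hN : 0 < N)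
    (hm : m.det = N) : ∃ A : FixedDetMatrix (Fin 2) ℤ (N : ℤ), A ∈ FixedDetMatrices.reps (N : ℤ) ∧
      ∀ z ∈ HH, f (moeb (zmat m) z) = f (moeb (zmat A.1) z) := by
  obtain ⟨B, rfl⟩ : ∃ B : FixedDetMatrix (Fin 2) ℤ (N : ℤ), B.1 = m := ⟨⟨m, hm⟩, rfl⟩
  obtain ⟨g, hg⟩ := exists_smul_mem_reps (m := N) (by exact_mod_cast hN.ne') B
  refine ⟨_, hg, fun z hz => ?_⟩
  rw [FixedDetMatrices.smul_coe, moeb_zmat_mul (by simp) (by simp [hm, hN]) hz]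
  exact (hf _ g.2 _ (moeb_zmat_mem_HH (by simp [hm, hN]) hz)).symm

/-- The branch attached to an upper triangular matrix. -/
def triBranch (j : ℂ → ℂ) (a d : ℕ) (b : ℤ) : ℂ → ℂ :=
  HH.indicator fun z => j ((a * z + b) / d)

lemma IsModularJ.branches_tri (hj : IsModularJ j) {N : ℕ} (hN : 0 < N) {f : ℂ → ℂ}
    (hf : f ∈ branches j N) :
    ∃ (a d : ℕ) (b : ℤ), 0 < a ∧ 0 < d ∧ a * d = N ∧ f = triBranch j a d b := by
  obtain ⟨m, hm, rfl⟩ := hf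
  obtain ⟨A, ⟨h10, h00, -, -⟩, hA⟩ := hj.inv.exists_reps hN hm
  have hdet : A.1 0 0 * A.1 1 1 = N := by
    have := A.2
    rw [Matrix.det_fin_two, h10] at this
    simpa using this
  have hN' : (0 : ℤ) < N := by exact_mod_cast hN
  have h11 : 0 < A.1 1 1 := by
    by_contra! h
    nlinarith
  obtain ⟨a, ha⟩ := Int.eq_ofNat_of_zero_le h00.le
  obtain ⟨d, hd⟩ := Int.eq_ofNat_of_zero_le h11.le
  rw [ha] at h00 hdet
  rw [hd] at h11 hdet
  refine ⟨a, d, A.1 0 1, by exact_mod_cast h00, by exact_mod_cast h11, by exact_mod_cast hdet, ?_⟩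
  refine Set.indicator_congr fun z hz => ?_
  rw [hA z hz]
  simp [moeb, zmat, ha, hd, h10]

lemma IsModularJ.finite_branches (hj : IsModularJ j) {N : ℕ} (hN : 0 < N) :
    (branches j N).Finite := by
  refine ((Set.toFinite (FixedDetMatrices.reps (N : ℤ))).image
    (fun A => HH.indicator fun z => j (moeb (zmat A.1) z))).subset ?_
  rintro f ⟨m, hm, rfl⟩
  obtain ⟨A, hA, h⟩ := hj.inv.exists_reps hN hm
  exact ⟨A, hA, Set.indicator_congr fun z hz => (h z hz).symm⟩

lemma triBranch_mem_HH {a d : ℕ} (b : ℤ) (ha : 0 < a) (hd : 0 < d) {z : ℂ} (hz : z ∈ HH) :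
    ((a * z + b) / d : ℂ) ∈ HH := by
  have : ((a * z + b) / d : ℂ).im = a * z.im / d := by
    simp [Complex.div_natCast_im]
  change 0 < ((a * z + b) / d : ℂ).im
  rw [this]
  have hz' : 0 < z.im := hz
  positivity

/-- The root of unity entering the expansion of a triangular branch. -/
def triRoot (d : ℕ) (b : ℤ) : ℂ := cexp (2 * Real.pi * I * b / d)

lemma triRoot_pow {d : ℕ} (hd : 0 < d) (b : ℤ) : triRoot d b ^ d = 1 := by
  have : (d : ℂ) ≠ 0 := by exact_mod_cast hd.ne'
  rw [triRoot, ← Complex.exp_nat_mul, Complex.exp_eq_one_iff]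
  exact ⟨b, by field_simp⟩

lemma triRoot_ne_zero (d : ℕ) (b : ℤ) : triRoot d b ≠ 0 := Complex.exp_ne_zero _

lemma triRoot_mem {d : ℕ} (hd : 0 < d) (b : ℤ) : triRoot d b ∈ Zbar :=
  mem_Zbar.2 (IsIntegral.of_pow hd (by rw [triRoot_pow hd]; exact isIntegral_one))

lemma triRoot_inv_mem {d : ℕ} (hd : 0 < d) (b : ℤ) : (triRoot d b)⁻¹ ∈ Zbar :=
  mem_Zbar.2 (IsIntegral.of_pow hd (by rw [inv_pow, triRoot_pow hd, inv_one]; exact isIntegral_one))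

lemma IsModularJ.triBranch_differentiableOn (hj : IsModularJ j) {a d : ℕ} (b : ℤ) (ha : 0 < a)
    (hd : 0 < d) : DifferentiableOn ℂ (triBranch j a d b) HH := by
  have : DifferentiableOn ℂ (fun z : ℂ => j ((a * z + b) / d)) HH :=
    hj.holo.comp (by fun_prop) fun z hz => triBranch_mem_HH b ha hd hz
  exact this.congr fun z hz => Set.indicator_of_mem hz _

lemma IsModularJ.triBranch_ps (hj : IsModularJ j) {a d N : ℕ} (b : ℤ) (ha : 0 < a) (hd : 0 < d)
    (had : a * d = N) : ∃ G ∈ serOver Zbar, PowerSeries.coeff 0 G = (triRoot d b)⁻¹ ∧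
      PS N G (fun z => sexp N z ^ (a ^ 2) * triBranch j a d b z) := by
  obtain ⟨A, hAR, hA, hA0⟩ := hj.exists_serOver Zbar
  have hs : ∀ z ∈ HH, sexp 1 ((a * z + b) / d) = triRoot d b * sexp N z ^ (a ^ 2) := by
    intro z _
    have h1 : (d : ℂ) ≠ 0 := by exact_mod_cast hd.ne'
    have h2 : (a : ℂ) ≠ 0 := by exact_mod_cast ha.ne'
    rw [sexp, sexp, triRoot, ← Complex.exp_nat_mul, ← Complex.exp_add, ← had]
    congr 1
    push_cast
    field_simp
    ring
  have h := hA.comp (N := N) (pow_pos ha 2) (fun z hz => triBranch_mem_HH b ha hd hz) hs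
  refine ⟨PowerSeries.C (triRoot d b)⁻¹ * expandSer (a ^ 2) (triRoot d b) A,
    (serOver Zbar).mul_mem (C_mem_serOver (triRoot_inv_mem hd b))
      (expandSer_mem _ hAR (triRoot_mem hd b)), ?_, ?_⟩
  · rw [PowerSeries.coeff_C_mul, coeff_zero_expandSer, hA0, mul_one]
  · refine ((PS.const _).mul h).congr fun z hz => ?_
    rw [hs z hz, triBranch, Set.indicator_of_mem hz, mul_assoc, inv_mul_cancel_left₀
      (triRoot_ne_zero d b)]

/-- Holomorphic functions with a meromorphic expansion at the cusp over `Zbar`. -/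
def cuspRing (N : ℕ) : Subring (ℂ → ℂ) where
  carrier := {f | DifferentiableOn ℂ f HH ∧ ∃ k : ℕ, ∃ F ∈ serOver Zbar,
    PS N F (fun z => sexp N z ^ k * f z)}
  mul_mem' := by
    rintro f g ⟨hf, k, F, hF, hPF⟩ ⟨hg, l, G, hG, hPG⟩
    refine ⟨hf.mul hg, k + l, F * G, mul_mem hF hG, (hPF.mul hPG).congr fun z _ => ?_⟩
    simp only [Pi.mul_apply, pow_add]; ring
  one_mem' := ⟨differentiableOn_const _, 0, 1, one_mem _,
    by simpa using PS.const (N := N) 1⟩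
  add_mem' := by
    rintro f g ⟨hf, k, F, hF, hPF⟩ ⟨hg, l, G, hG, hPG⟩
    refine ⟨hf.add hg, k + l, PowerSeries.X ^ l * F + PowerSeries.X ^ k * G,
      add_mem (mul_mem (pow_mem X_mem_serOver _) hF) (mul_mem (pow_mem X_mem_serOver _) hG),
      (((PS.X.pow l).mul hPF).add ((PS.X.pow k).mul hPG)).congr fun z _ => ?_⟩
    simp only [Pi.add_apply, pow_add]; ring
  zero_mem' := ⟨differentiableOn_const _, 0, 0, zero_mem _,
    by simpa using PS.const (N := N) 0⟩
  neg_mem' := by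
    rintro f ⟨hf, k, F, hF, hPF⟩
    refine ⟨hf.neg, k, PowerSeries.C (-1) * F, mul_mem (C_mem_serOver (neg_mem (one_mem _))) hF,
      ((PS.const (-1)).mul hPF).congr fun z _ => ?_⟩
    simp

lemma IsModularJ.branches_mem_cuspRing (hj : IsModularJ j) {N : ℕ} (hN : 0 < N) {f : ℂ → ℂ}
    (hf : f ∈ branches j N) : f ∈ cuspRing N := by
  obtain ⟨a, d, b, ha, hd, had, rfl⟩ := hj.branches_tri hN hf
  obtain ⟨G, hG, -, hP⟩ := hj.triBranch_ps b ha hd had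
  exact ⟨hj.triBranch_differentiableOn b ha hd, _, G, hG, hP⟩

/-- The finite set of branches. -/
def branchFin (hj : IsModularJ j) {N : ℕ} (hN : 0 < N) : Finset (ℂ → ℂ) :=
  (hj.finite_branches hN).toFinset

lemma mem_branchFin {hj : IsModularJ j} {N : ℕ} {hN : 0 < N} {f : ℂ → ℂ} :
    f ∈ branchFin hj hN ↔ f ∈ branches j N := Set.Finite.mem_toFinset _

lemma branches_comp {N : ℕ} (hN : 0 < N) {f : ℂ → ℂ} (hf : f ∈ branches j N)
    {g : Matrix (Fin 2) (Fin 2) ℤ} (hg : g.det = 1) :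
    HH.indicator (fun z => f (moeb (zmat g) z)) ∈ branches j N := by
  obtain ⟨m, hm, rfl⟩ := hf
  refine ⟨m * g, by rw [Matrix.det_mul, hm, hg, mul_one], Set.indicator_congr fun z hz => ?_⟩
  rw [Set.indicator_of_mem (moeb_zmat_mem_HH (by simp [hg]) hz),
    moeb_zmat_mul (by simp [hm, hN]) (by simp [hg]) hz]

lemma prod_branches_smul (hj : IsModularJ j) {N : ℕ} (hN : 0 < N)
    {g : Matrix (Fin 2) (Fin 2) ℤ} (hg : g.det = 1) {z : ℂ} (hz : z ∈ HH) :
    ∏ f ∈ branchFin hj hN, (Polynomial.X - Polynomial.C (f (moeb (zmat g) z))) =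
      ∏ f ∈ branchFin hj hN, (Polynomial.X - Polynomial.C (f z)) := by
  have hmem : ∀ f ∈ branchFin hj hN,
      HH.indicator (fun z => f (moeb (zmat g) z)) ∈ branchFin hj hN := fun f hf =>
    mem_branchFin.2 (branches_comp hN (mem_branchFin.1 hf) hg)
  have hinj : Set.InjOn (fun f : ℂ → ℂ => HH.indicator (fun z => f (moeb (zmat g) z)))
      (branchFin hj hN) := by
    intro f hf f' hf' hff
    have hg' : g⁻¹.det = 1 := by simp [Matrix.det_nonsing_inv, hg]
    have h1 : ∀ z ∈ HH, f z = f' z := fun z hz => by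
      have h2 := congrFun hff (moeb (zmat g⁻¹) z)
      have h3 : moeb (zmat g⁻¹) z ∈ HH := moeb_zmat_mem_HH (by simp [hg']) hz
      simp only [Set.indicator_of_mem h3] at h2
      rwa [← moeb_zmat_mul (by simp [hg]) (by simp [hg']) hz,
        Matrix.mul_nonsing_inv _ (by simp [hg]),
        show moeb (zmat 1) z = z by simp [moeb, zmat]] at h2
    obtain ⟨m, -, rfl⟩ := mem_branchFin.1 hf
    obtain ⟨m', -, rfl⟩ := mem_branchFin.1 hf'
    ext z
    by_cases hz : z ∈ HH
    · exact h1 z hz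
    · simp [hz]
  refine Finset.prod_bij (fun f _ => HH.indicator (fun z => f (moeb (zmat g) z))) hmem
    (fun f hf f' hf' h => hinj hf hf' h) (fun f hf => ?_) fun f hf => ?_
  · obtain ⟨f', hf', h⟩ := Finset.surj_on_of_inj_on_of_card_le
      (fun f (_ : f ∈ branchFin hj hN) => HH.indicator (fun z => f (moeb (zmat g) z))) hmem
      (fun f f' hf hf' h => hinj hf hf' h) le_rfl f hf
    exact ⟨f', hf', h.symm⟩
  · rw [Set.indicator_of_mem hz]

lemma exists_modPoly (hj : IsModularJ j) {N : ℕ} (hN : 0 < N) :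
    ∃ Φ : Polynomial (Polynomial Zbar), Φ.Monic ∧ ∀ z ∈ HH,
      Φ.map (Polynomial.eval₂RingHom Zbar.subtype (j z)) =
        ∏ f ∈ branchFin hj hN, (Polynomial.X - Polynomial.C (f z)) := by
  set P : Polynomial (ℂ → ℂ) :=
    ∏ f ∈ branchFin hj hN, (Polynomial.X - Polynomial.C f) with hP
  have hPz : ∀ z, P.map (Pi.evalRingHom (fun _ => ℂ) z) =
      ∏ f ∈ branchFin hj hN, (Polynomial.X - Polynomial.C (f z)) := fun z => by
    simp [hP, Polynomial.map_prod]
  have hco : ∀ n z, P.coeff n z =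
      (∏ f ∈ branchFin hj hN, (Polynomial.X - Polynomial.C (f z))).coeff n := fun n z => by
    rw [← hPz, Polynomial.coeff_map]; rfl
  have hlift : P ∈ Polynomial.lifts (cuspRing N).subtype := by
    refine Subsemiring.prod_mem _ fun f hf => ?_
    rw [Polynomial.mem_lifts]
    exact ⟨Polynomial.X - Polynomial.C ⟨f, hj.branches_mem_cuspRing hN (mem_branchFin.1 hf)⟩,
      by simp⟩
  have hE : ∀ n, ∃ E : Polynomial Zbar, ∀ z ∈ HH, P.coeff n z = E.eval₂ Zbar.subtype (j z) := by
    intro n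
    obtain ⟨⟨f, hd, k, F, hF, hPS⟩, hf⟩ := (Polynomial.lifts_iff_coeff_lifts P).1 hlift n
    simp only [Subring.subtype_apply] at hf
    rw [← hf]
    refine hj.exists_poly Zbar hN k f F (fun g hg z hz => ?_) hd hF hPS
    rw [hf, hco, hco, prod_branches_smul hj hN hg hz]
  choose E hE using hE
  set M := (branchFin hj hN).card with hM
  have hdeg : (∑ i ∈ Finset.range M, Polynomial.C (E i) * Polynomial.X ^ i).degree < (M : WithBot ℕ) := by
    refine Polynomial.mem_degreeLT.1 (Submodule.sum_mem _ fun i hi => Polynomial.mem_degreeLT.2 ?_)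
    exact (Polynomial.degree_C_mul_X_pow_le i _).trans_lt (by exact_mod_cast Finset.mem_range.1 hi)
  refine ⟨Polynomial.X ^ M + ∑ i ∈ Finset.range M, Polynomial.C (E i) * Polynomial.X ^ i,
    Polynomial.monic_X_pow_add hdeg, fun z hz => ?_⟩
  set Q := ∏ f ∈ branchFin hj hN, (Polynomial.X - Polynomial.C (f z)) with hQ
  have hQm : Q.Monic := Polynomial.monic_prod_of_monic _ _ fun f _ => Polynomial.monic_X_sub_C _
  have hQd : Q.natDegree = M := by
    rw [hQ, Polynomial.natDegree_prod_of_monic _ _ fun f _ => Polynomial.monic_X_sub_C _]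
    simp [hM]
  rw [hQm.as_sum, hQd]
  simp only [Polynomial.map_add, Polynomial.map_pow, Polynomial.map_X, Polynomial.map_sum,
    Polynomial.map_mul, Polynomial.map_C, Polynomial.coe_eval₂RingHom]
  congr 1
  refine Finset.sum_congr rfl fun i _ => ?_
  rw [← hE i z hz, hco]

/-- The modular polynomial of level `N`. -/
def modPoly (hj : IsModularJ j) {N : ℕ} (hN : 0 < N) : Polynomial (Polynomial Zbar) :=
  (exists_modPoly hj hN).choose

lemma modPoly_monic (hj : IsModularJ j) {N : ℕ} (hN : 0 < N) : (modPoly hj hN).Monic :=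
  (exists_modPoly hj hN).choose_spec.1

lemma modPoly_map (hj : IsModularJ j) {N : ℕ} (hN : 0 < N) {z : ℂ} (hz : z ∈ HH) :
    (modPoly hj hN).map (Polynomial.eval₂RingHom Zbar.subtype (j z)) =
        ∏ f ∈ branchFin hj hN, (Polynomial.X - Polynomial.C (f z)) :=
  (exists_modPoly hj hN).choose_spec.2 z hz

end

section

open Polynomial

/-- The relatively algebraically closed subfield generated by a set of complex numbers. -/
def acl (S : Set ℂ) : Subfield ℂ :=
  { (Subalgebra.algebraicClosure (Algebra.adjoin ℚ S) ℂ).toSubring with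
    inv_mem' := fun _ hx => IsAlgebraic.inv (R := Algebra.adjoin ℚ S) (K := ℂ) hx }

lemma mem_acl {S : Set ℂ} {x : ℂ} : x ∈ acl S ↔ IsAlgebraic (Algebra.adjoin ℚ S) x := Iff.rfl

lemma coe_acl (S : Set ℂ) : (acl S : Set ℂ) = (AlgebraicIndependent.matroid ℚ ℂ).closure S := by
  rw [AlgebraicIndependent.matroid_closure_eq]; rfl

lemma subset_acl (S : Set ℂ) : S ⊆ acl S := by
  rw [coe_acl]
  exact Matroid.subset_closure _ S (by simp)

lemma mem_acl_of_mem {S : Set ℂ} {x : ℂ} (h : x ∈ S) : x ∈ acl S := subset_acl S h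

lemma acl_mono {S T : Set ℂ} (h : S ⊆ T) : acl S ≤ acl T := by
  rw [← SetLike.coe_subset_coe, coe_acl, coe_acl]
  exact Matroid.closure_subset_closure _ h

lemma acl_le {S T : Set ℂ} (h : S ⊆ acl T) : acl S ≤ acl T := by
  rw [← SetLike.coe_subset_coe, coe_acl, coe_acl]
  rw [coe_acl] at h
  exact Matroid.closure_subset_closure_of_subset_closure h

lemma acl_acl (S : Set ℂ) : acl (acl S) = acl S :=
  le_antisymm (acl_le le_rfl) (subset_acl _)

lemma acl_exchange {S : Set ℂ} {x y : ℂ} (h : y ∈ acl (insert x S)) (h' : y ∉ acl S) :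
    x ∈ acl (insert y S) := by
  rw [← SetLike.mem_coe, coe_acl] at *
  exact (Matroid.closure_exchange (M := AlgebraicIndependent.matroid ℚ ℂ) ⟨h, h'⟩).1

/-- A root of a nonzero polynomial over `acl S` lies in `acl S`. -/
lemma acl_root {S : Set ℂ} {P : ℂ[X]} (hP : P ≠ 0) (hc : ∀ n, P.coeff n ∈ acl S) {y : ℂ}
    (hy : P.eval y = 0) : y ∈ acl S := by
  rw [← acl_acl S, mem_acl]
  have hl : P ∈ Polynomial.lifts (algebraMap (Algebra.adjoin ℚ (acl S : Set ℂ)) ℂ) := by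
    rw [Polynomial.lifts_iff_coeff_lifts]
    exact fun n => ⟨⟨_, Algebra.subset_adjoin (hc n)⟩, rfl⟩
  obtain ⟨Q, rfl⟩ := (Polynomial.mem_lifts _).1 hl
  refine ⟨Q, fun h => hP (by rw [h, Polynomial.map_zero]), ?_⟩
  rwa [Polynomial.eval_map, ← Polynomial.aeval_def] at hy

lemma Zbar_le_acl (S : Set ℂ) : Zbar ≤ (acl S).toSubring := by
  intro x hx
  obtain ⟨P, hP, h⟩ := mem_Zbar.1 hx
  refine acl_root (P := P.map (algebraMap ℤ ℂ)) (hP.map _).ne_zero (fun n => ?_) ?_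
  · rw [Polynomial.coeff_map]
    simp
  · rwa [Polynomial.eval_map]

/-- An element integral over a subring algebraic over `acl S`. -/
lemma poly_coeff_mem_acl {S : Set ℂ} {x : ℂ} (hx : x ∈ acl S) (E : Polynomial Zbar) :
    E.eval₂ Zbar.subtype x ∈ acl S := by
  rw [Polynomial.eval₂_eq_sum_range]
  exact sum_mem fun i _ => mul_mem (Zbar_le_acl S (E.coeff i).2) (pow_mem hx i)

lemma GRel.mem_acl {S : Set ℂ} {x y : ℂ} (h : GRel x y) (hx : x ∈ acl S) : y ∈ acl S := by
  obtain ⟨g, -, rfl⟩ := h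
  rw [moeb_qmat]
  have hq : ∀ q : ℚ, (q : ℂ) ∈ acl S := fun q => SubfieldClass.ratCast_mem _ q
  exact div_mem (add_mem (mul_mem (hq _) hx) (hq _)) (add_mem (mul_mem (hq _) hx) (hq _))

variable {j : ℂ → ℂ}

/-- Two points related by an integral matrix satisfy the modular equation. -/
lemma modPoly_eval (hj : IsModularJ j) {m : Matrix (Fin 2) (Fin 2) ℤ} {N : ℕ} (hN : 0 < N)
    (hm : m.det = N) {z : ℂ} (hz : z ∈ HH) :
    ((modPoly hj hN).map (eval₂RingHom Zbar.subtype (j z))).eval (j (moeb (zmat m) z)) = 0 := by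
  rw [modPoly_map hj hN hz, eval_prod]
  refine Finset.prod_eq_zero (mem_branchFin.2 ⟨m, hm, rfl⟩) ?_
  simp [hz]

lemma GRel.exists_int {x y : ℂ} (h : GRel x y) : ∃ (N : ℕ) (m : Matrix (Fin 2) (Fin 2) ℤ),
    0 < N ∧ m.det = N ∧ y = moeb (zmat m) x := by
  obtain ⟨g, hg, rfl⟩ := h
  obtain ⟨m, hm, h⟩ := exists_int_matrix g hg
  obtain ⟨N, hN⟩ := Int.eq_ofNat_of_zero_le hm.le
  refine ⟨N, m, ?_, hN, ?_⟩
  · rw [hN] at hm; exact_mod_cast hm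
  · rw [h, zmat_eq_qmat]

lemma GRel.j_mem_acl (hj : IsModularJ j) {S : Set ℂ} {x y : ℂ} (h : GRel x y) (hx : x ∈ HH)
    (hS : j x ∈ acl S) : j y ∈ acl S := by
  obtain ⟨N, m, hN, hm, rfl⟩ := h.exists_int
  refine acl_root ((modPoly_monic hj hN).map _).ne_zero (fun n => ?_) (modPoly_eval hj hN hm hx)
  rw [coeff_map]
  exact poly_coeff_mem_acl hS _

end

section

open Polynomial Filter Topology

variable {j : ℂ → ℂ}

lemma tendsto_sexp_pow_unique {N : ℕ} (hN : 0 < N) {g : ℂ → ℂ} {k m : ℕ} {u v : ℂ}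
    (hk : Tendsto (fun z => sexp N z ^ k * g z) cusp (𝓝 u))
    (hm : Tendsto (fun z => sexp N z ^ m * g z) cusp (𝓝 v))
    (hu : u ≠ 0) (hv : v ≠ 0) : u = v := by
  have key : ∀ {k m : ℕ} {u v : ℂ}, Tendsto (fun z => sexp N z ^ k * g z) cusp (𝓝 u) →
      Tendsto (fun z => sexp N z ^ m * g z) cusp (𝓝 v) → k < m → v = 0 := by
    intro k m u v hk hm hkm
    have h1 : Tendsto (fun z => sexp N z ^ (m - k) * (sexp N z ^ k * g z)) cusp
        (𝓝 (0 ^ (m - k) * u)) := ((tendsto_sexp_cusp hN).pow _).mul hk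
    have h2 : (fun z => sexp N z ^ (m - k) * (sexp N z ^ k * g z)) =
        fun z => sexp N z ^ m * g z := by
      ext z; rw [← mul_assoc, ← pow_add, Nat.sub_add_cancel hkm.le]
    rw [h2, zero_pow (by omega), zero_mul] at h1
    exact tendsto_nhds_unique hm h1
  rcases lt_trichotomy k m with h | h | h
  · exact absurd (key hk hm h) hv
  · subst h; exact tendsto_nhds_unique hk hm
  · exact absurd (key hm hk h) hu

lemma IsModularJ.tendsto_poly (hj : IsModularJ j) (P : ℂ[X]) :
    Tendsto (fun z => sexp 1 z ^ P.natDegree * P.eval (j z)) cusp (𝓝 P.leadingCoeff) := by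
  have h0 := tendsto_sexp_cusp one_pos
  have h1 : Tendsto (fun z => ∑ i ∈ Finset.range (P.natDegree + 1),
      P.coeff i * sexp 1 z ^ (P.natDegree - i) * (sexp 1 z * j z) ^ i) cusp
      (𝓝 (∑ i ∈ Finset.range (P.natDegree + 1), P.coeff i * 0 ^ (P.natDegree - i) * 1 ^ i)) :=
    tendsto_finsetSum _ fun i _ => ((h0.pow _).const_mul _).mul (hj.tendsto_sexp_mul.pow _)
  have h2 : (∑ i ∈ Finset.range (P.natDegree + 1), P.coeff i * (0 : ℂ) ^ (P.natDegree - i) * 1 ^ i)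
      = P.leadingCoeff := by
    rw [Finset.sum_range_succ, Finset.sum_eq_zero]
    · simp
    · intro i hi
      have := Finset.mem_range.1 hi
      rw [zero_pow (by omega)]; simp
  rw [h2] at h1
  refine h1.congr fun z => ?_
  rw [eval_eq_sum_range, Finset.mul_sum]
  refine Finset.sum_congr rfl fun i hi => ?_
  have : i + (P.natDegree - i) = P.natDegree := by
    have := Finset.mem_range.1 hi; omega
  conv_rhs => rw [← this, pow_add]
  rw [mul_pow]; ring

lemma IsModularJ.sub_branch_tendsto (hj : IsModularJ j) {N : ℕ} (hN : 0 < N)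
    (hsq : ∀ w : ℕ, w * w ≠ N) {f : ℂ → ℂ} (hf : f ∈ branches j N) :
    ∃ (k : ℕ) (u : ℂ), u ≠ 0 ∧ u ∈ Zbar ∧ u⁻¹ ∈ Zbar ∧
      Tendsto (fun z => sexp N z ^ k * (j z - f z)) cusp (𝓝 u) := by
  obtain ⟨a, d, b, ha, hd, had, rfl⟩ := hj.branches_tri hN hf
  obtain ⟨G, -, hG0, hG⟩ := hj.triBranch_ps b ha hd had
  have hb := hG.tendsto hN
  rw [hG0] at hb
  have hjt : Tendsto (fun z => sexp N z ^ N * j z) cusp (𝓝 1) := by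
    simpa only [sexp_pow_self hN] using hj.tendsto_sexp_mul
  have h0 := tendsto_sexp_cusp hN
  rcases lt_trichotomy (a ^ 2) N with h | h | h
  · refine ⟨N, 1, one_ne_zero, one_mem _, by simp [one_mem], ?_⟩
    have h1 := hjt.sub ((h0.pow (N - a ^ 2)).mul hb)
    rw [zero_pow (by omega), zero_mul, sub_zero] at h1
    refine h1.congr fun z => ?_
    rw [← mul_assoc, ← pow_add, Nat.sub_add_cancel h.le]; ring
  · exact absurd (by rw [← sq, h]) (hsq a)
  · refine ⟨a ^ 2, -(triRoot d b)⁻¹, neg_ne_zero.2 (inv_ne_zero (triRoot_ne_zero _ _)),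
      neg_mem (triRoot_inv_mem hd b), ?_, ?_⟩
    · rw [inv_neg, inv_inv]; exact neg_mem (triRoot_mem hd b)
    have h1 := ((h0.pow (a ^ 2 - N)).mul hjt).sub hb
    rw [zero_pow (by omega), zero_mul, zero_sub] at h1
    refine h1.congr fun z => ?_
    rw [← mul_assoc, ← pow_add, Nat.sub_add_cancel h.le]; ring

lemma IsModularJ.prod_tendsto (hj : IsModularJ j) {N : ℕ} (hN : 0 < N)
    (hsq : ∀ w : ℕ, w * w ≠ N) (s : Finset (ℂ → ℂ)) (hs : ∀ f ∈ s, f ∈ branches j N) :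
    ∃ (k : ℕ) (u : ℂ), u ≠ 0 ∧ u ∈ Zbar ∧ u⁻¹ ∈ Zbar ∧
      Tendsto (fun z => sexp N z ^ k * ∏ f ∈ s, (j z - f z)) cusp (𝓝 u) := by
  classical
  induction s using Finset.induction_on with
  | empty => exact ⟨0, 1, one_ne_zero, one_mem _, by simp [one_mem], by simp⟩
  | insert f s hfs ih =>
    obtain ⟨k, u, hu, hu1, hu2, hk⟩ := ih fun g hg => hs g (Finset.mem_insert_of_mem hg)
    obtain ⟨l, v, hv, hv1, hv2, hl⟩ :=
      hj.sub_branch_tendsto hN hsq (hs f (Finset.mem_insert_self _ _))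
    refine ⟨l + k, v * u, mul_ne_zero hv hu, mul_mem hv1 hu1, ?_, ?_⟩
    · rw [mul_inv]; exact mul_mem hv2 hu2
    · refine (hl.mul hk).congr fun z => ?_
      rw [Finset.prod_insert hfs, pow_add]; ring

/-- If `τ` is fixed by an integral matrix of nonsquare determinant, `j τ` is integral. -/
lemma IsModularJ.isIntegral_of_fixed (hj : IsModularJ j) {N : ℕ} (hN : 0 < N)
    (hsq : ∀ w : ℕ, w * w ≠ N) {m : Matrix (Fin 2) (Fin 2) ℤ} (hm : m.det = N) {τ : ℂ}
    (hτ : τ ∈ HH) (h : moeb (zmat m) τ = τ) : IsIntegral ℤ (j τ) := by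
  set H : Polynomial Zbar := (modPoly hj hN).eval X with hH
  have hev : ∀ z ∈ HH, (H.map Zbar.subtype).eval (j z) =
      ((modPoly hj hN).map (eval₂RingHom Zbar.subtype (j z))).eval (j z) := by
    intro z _
    rw [hH, eval_map, ← coe_eval₂RingHom, eval_map, eval, Polynomial.hom_eval₂]
    simp
  obtain ⟨k, u, hu, -, hu2, hk⟩ := hj.prod_tendsto hN hsq (branchFin hj hN)
    fun f hf => mem_branchFin.1 hf
  have hprod : ∀ z ∈ HH, (H.map Zbar.subtype).eval (j z) =
      ∏ f ∈ branchFin hj hN, (j z - f z) := by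
    intro z hz
    rw [hev z hz, modPoly_map hj hN hz, eval_prod]
    simp
  have h1 : Tendsto (fun z => sexp N z ^ k * (H.map Zbar.subtype).eval (j z)) cusp (𝓝 u) := by
    refine hk.congr' ?_
    filter_upwards [eventually_cusp_mem_HH] with z hz
    rw [hprod z hz]
  have hH0 : H.map Zbar.subtype ≠ 0 := by
    intro h0
    rw [h0] at h1
    simp only [eval_zero, mul_zero] at h1
    exact hu (tendsto_nhds_unique h1 tendsto_const_nhds)
  have h2 := hj.tendsto_poly (H.map Zbar.subtype)
  simp only [← sexp_pow_self hN, ← pow_mul] at h2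
  have hlc := tendsto_sexp_pow_unique hN h1 h2 hu (leadingCoeff_ne_zero.2 hH0)
  have hroot : (H.map Zbar.subtype).eval (j τ) = 0 := by
    rw [hev τ hτ]
    have := modPoly_eval hj hN hm hτ
    rwa [h] at this
  have hinj : Function.Injective Zbar.subtype := Subtype.val_injective
  have hlc' : (H.leadingCoeff : ℂ) = u := by
    rw [hlc, leadingCoeff_map_of_injective hinj]; rfl
  have hmon : (C (⟨u⁻¹, hu2⟩ : Zbar) * H).Monic := by
    rw [Monic, leadingCoeff_mul, leadingCoeff_C]
    ext
    simp [hlc', hu]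
  have hIntegral : IsIntegral Zbar (j τ) := by
    refine ⟨_, hmon, ?_⟩
    rw [eval_map] at hroot
    rw [eval₂_mul]
    erw [hroot]
    rw [mul_zero]
  have : Algebra.IsIntegral ℤ Zbar := inferInstanceAs (Algebra.IsIntegral ℤ (integralClosure ℤ ℂ))
  exact isIntegral_trans (R := ℤ) (A := Zbar) _ hIntegral

lemma exists_quadratic {τ : ℂ} (hτ : τ ∈ SigmaSet) : ∃ A B C : ℤ, 0 < A ∧
    (A : ℂ) * τ ^ 2 + B * τ + C = 0 ∧ B ^ 2 - 4 * A * C < 0 := by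
  obtain ⟨him, hdeg⟩ := hτ
  have hne : minpoly ℚ τ ≠ 0 := fun h => by rw [h] at hdeg; simp at hdeg
  have hIntegral : IsIntegral ℚ τ := by
    by_contra h; exact hne (minpoly.eq_zero h)
  have hm := minpoly.monic hIntegral
  have h0 := minpoly.aeval ℚ τ
  rw [hm.as_sum, hdeg] at h0
  simp [Finset.sum_range_succ] at h0
  set b := (minpoly ℚ τ).coeff 1
  set c := (minpoly ℚ τ).coeff 0
  have hbd : (b.den : ℚ) ≠ 0 := by exact_mod_cast b.den_nz
  have hcd : (c.den : ℚ) ≠ 0 := by exact_mod_cast c.den_nz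
  have hq : ((b.den * c.den : ℕ) : ℂ) * τ ^ 2 + ((b.num * c.den : ℤ) : ℂ) * τ
      + ((c.num * b.den : ℤ) : ℂ) = 0 := by
    have h1 : (b : ℂ) = b.num / b.den := by
      exact_mod_cast congrArg (fun q : ℚ => (q : ℂ)) (Rat.num_div_den b).symm
    have h2 : (c : ℂ) = c.num / c.den := by
      exact_mod_cast congrArg (fun q : ℚ => (q : ℂ)) (Rat.num_div_den c).symm
    rw [h1, h2] at h0
    have hbd' : (b.den : ℂ) ≠ 0 := by exact_mod_cast b.den_nz
    have hcd' : (c.den : ℂ) ≠ 0 := by exact_mod_cast c.den_nz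
    field_simp at h0
    push_cast
    linear_combination h0
  refine ⟨(b.den * c.den : ℕ), b.num * c.den, c.num * b.den, ?_, ?_, ?_⟩
  · exact_mod_cast Nat.mul_pos b.den_pos c.den_pos
  · exact_mod_cast hq
  · have hA : (0 : ℝ) < (b.den * c.den : ℕ) := by exact_mod_cast Nat.mul_pos b.den_pos c.den_pos
    generalize b.den * c.den = A at *
    generalize b.num * c.den = B at *
    generalize c.num * b.den = C at *
    have e1 := congrArg Complex.re hq
    have e2 := congrArg Complex.im hq
    simp [sq] at e1 e2
    have hy : 0 < τ.im := him
    have hB : (B : ℝ) = -(2 * A * τ.re) := by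
      have : τ.im * (2 * A * τ.re + B) = 0 := by linear_combination e2
      rcases mul_eq_zero.1 this with h | h
      · exact absurd h hy.ne'
      · linarith
    have : ((B ^ 2 - 4 * A * C : ℤ) : ℝ) < 0 := by
      push_cast
      have hC : (C : ℝ) = A * (τ.re ^ 2 + τ.im ^ 2) := by
        rw [hB] at e1; linear_combination e1
      rw [hC, hB]
      have : 0 < (A : ℝ) ^ 2 * τ.im ^ 2 := by positivity
      nlinarith
    exact_mod_cast this

/-- Singular moduli are algebraic integers. -/
lemma IsModularJ.isIntegral_of_mem_SigmaSet (hj : IsModularJ j) {τ : ℂ} (hτ : τ ∈ SigmaSet) :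
    IsIntegral ℤ (j τ) := by
  obtain ⟨A, B, C, hA, h, hD⟩ := exists_quadratic hτ
  set D := 4 * A * C - B ^ 2 with hDdef
  have hDpos : 0 < D := by omega
  set u : ℤ := |B| + D with hu
  have hub : D ≤ 2 * u - B := by
    have := le_abs_self B
    have := abs_nonneg B
    omega
  have hdet : (!![u - B, -C; A, u]).det = u ^ 2 - B * u + A * C := by
    rw [Matrix.det_fin_two]; simp; ring
  have h4 : 4 * (u ^ 2 - B * u + A * C) = (2 * u - B) ^ 2 + D := by rw [hDdef]; ring
  obtain ⟨N, hN⟩ := Int.eq_ofNat_of_zero_le (by nlinarith : 0 ≤ u ^ 2 - B * u + A * C)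
  have hNpos : 0 < N := by
    have : (0 : ℤ) < N := by rw [← hN]; nlinarith
    exact_mod_cast this
  refine hj.isIntegral_of_fixed hNpos (fun w hw => ?_) (hdet.trans hN) hτ.1 ?_
  · have hw' : (w : ℤ) * w = N := by exact_mod_cast hw
    rw [hN, ← hw'] at h4
    have h5 : (2 * u - B) < 2 * w := by
      by_contra! h6
      have : (0 : ℤ) ≤ w := by positivity
      nlinarith
    nlinarith
  · have hne : (A : ℂ) * τ + u ≠ 0 := by
      intro h0
      have := congrArg Complex.im h0
      have hy : 0 < τ.im := hτ.1
      have hA' : (0 : ℝ) < A := by exact_mod_cast hA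
      simp at this
      rcases this with h1 | h1
      · omega
      · exact hy.ne' h1
    simp only [moeb, zmat]
    simp
    rw [div_eq_iff hne]
    linear_combination (-1 : ℂ) * h

end

section

open Polynomial Filter Topology

/-- Over a factorial domain embedded in a field, an irreducible polynomial divides every polynomial
sharing a root with it. -/
lemma dvd_of_common_root {R E : Type*} [CommRing R] [IsDomain R] [UniqueFactorizationMonoid R]
    [Field E] (φ : R →+* E) (hφ : Function.Injective φ) {P G : R[X]} (hP : Irreducible P)
    (hdeg : P.natDegree ≠ 0) {y : E} (hy : P.eval₂ φ y = 0) (hG : G.eval₂ φ y = 0) : P ∣ G := by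
  classical
  let _ := UniqueFactorizationMonoid.strongNormalizationMonoid (α := R)
  let _ := UniqueFactorizationMonoid.toNormalizedGCDMonoid R
  have hprim := hP.isPrimitive hdeg
  have hirr := (hprim.irreducible_iff_irreducible_map_fraction_map (K := FractionRing R)).1 hP
  set ψ : FractionRing R →+* E := IsFractionRing.lift hφ
  have hψ : ∀ Q : R[X], (Q.map (algebraMap R (FractionRing R))).eval₂ ψ y = Q.eval₂ φ y := by
    intro Q
    rw [eval₂_map]
    congr 1
    ext r
    simp [ψ]
  have hdvd : P.map (algebraMap R (FractionRing R)) ∣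
      G.map (algebraMap R (FractionRing R)) := by
    by_contra hnd
    obtain ⟨a, b, hab⟩ := (hirr.coprime_iff_not_dvd).2 hnd
    have := congrArg (eval₂ ψ y) hab
    simp [eval₂_add, eval₂_mul, hψ, hy, hG] at this
  exact hprim.dvd_of_fraction_map_dvd_fraction_map hdvd

/-- A nonzero bivariate polynomial vanishing at a point with independent first coordinate has an
irreducible factor doing so. -/
lemma exists_irreducible_factor {R E : Type*} [CommRing R] [IsDomain R]
    [UniqueFactorizationMonoid R] [Field E] (φ : R →+* E) (hφ : Function.Injective φ) {P : R[X]}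
    (hP : P ≠ 0) {y : E} (hy : P.eval₂ φ y = 0) :
    ∃ Q : R[X], Irreducible Q ∧ Q.natDegree ≠ 0 ∧ Q ∣ P ∧ Q.eval₂ φ y = 0 := by
  have key : ∀ P : R[X], P ≠ 0 → P.eval₂ φ y = 0 → ∃ Q, Irreducible Q ∧ Q ∣ P ∧
      Q.eval₂ φ y = 0 := by
    intro P
    induction P using WfDvdMonoid.induction_on_irreducible with
    | zero => intro h; exact absurd rfl h
    | unit u hu =>
      intro _ h
      have := hu.map (eval₂RingHom φ y)
      rw [coe_eval₂RingHom, h] at this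
      exact absurd this not_isUnit_zero
    | mul a i ha hi ih =>
      intro _ h
      rw [eval₂_mul] at h
      rcases mul_eq_zero.1 h with h | h
      · exact ⟨i, hi, dvd_mul_right _ _, h⟩
      · obtain ⟨Q, h1, h2, h3⟩ := ih ha h
        exact ⟨Q, h1, h2.mul_left _, h3⟩
  obtain ⟨Q, h1, h2, h3⟩ := key P hP hy
  refine ⟨Q, h1, fun h0 => ?_, h2, h3⟩
  rw [eq_C_of_natDegree_eq_zero h0, eval₂_C, map_eq_zero_iff φ hφ] at h3
  rw [eq_C_of_natDegree_eq_zero h0, h3, C_0] at h1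
  exact h1.ne_zero rfl

variable {j : ℂ → ℂ}

/-- `j` and its translate by a cyclic isogeny of degree `N` satisfy no relation of degree less
than `N`. -/
lemma IsModularJ.no_small_relation (hj : IsModularJ j) {N : ℕ} (hN : 0 < N) (b : ℤ)
    {Q : ℂ[X][X]} (hQ : Q ≠ 0) (hdeg : Q.natDegree < N)
    (h : ∀ z ∈ HH, (Q.map (evalRingHom (j z))).eval (triBranch j 1 N b z) = 0) : False := by
  obtain ⟨G, -, hG0, hG⟩ := hj.triBranch_ps (N := N) b one_pos hN (one_mul N)
  have hb := hG.tendsto hN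
  rw [hG0, one_pow] at hb
  simp only [pow_one] at hb
  have hζ := inv_ne_zero (triRoot_ne_zero N b)
  set ζ := (triRoot N b)⁻¹
  set e : ℕ → ℕ := fun i => N * (Q.coeff i).natDegree + i with he
  have hterm : ∀ i, Tendsto (fun z => sexp N z ^ e i *
      ((Q.coeff i).eval (j z) * triBranch j 1 N b z ^ i)) cusp
      (𝓝 ((Q.coeff i).leadingCoeff * ζ ^ i)) := by
    intro i
    have h1 := hj.tendsto_poly (Q.coeff i)
    simp only [← sexp_pow_self hN, ← pow_mul] at h1
    refine (h1.mul (hb.pow i)).congr fun z => ?_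
    rw [he]; simp only [pow_add, mul_pow]; ring
  obtain ⟨i₀, hi₀, hmax⟩ := Q.support.exists_max_image e (by simpa using hQ)
  have hlt : ∀ i ∈ Q.support, i ≠ i₀ → e i < e i₀ := by
    intro i hi hne
    refine lt_of_le_of_ne (hmax i hi) fun heq => hne ?_
    have h1 : i < N := (le_natDegree_of_mem_supp i hi).trans_lt hdeg
    have h2 : i₀ < N := (le_natDegree_of_mem_supp i₀ hi₀).trans_lt hdeg
    have h3 := congrArg (· % N) heq
    simpa [he, Nat.add_mod, Nat.mod_eq_of_lt h1, Nat.mod_eq_of_lt h2] using h3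
  have h1 : Tendsto (fun z => ∑ i ∈ Q.support, sexp N z ^ (e i₀ - e i) * (sexp N z ^ e i *
      ((Q.coeff i).eval (j z) * triBranch j 1 N b z ^ i))) cusp
      (𝓝 (∑ i ∈ Q.support, 0 ^ (e i₀ - e i) * ((Q.coeff i).leadingCoeff * ζ ^ i))) :=
    tendsto_finsetSum _ fun i _ => ((tendsto_sexp_cusp hN).pow _).mul (hterm i)
  rw [Finset.sum_eq_single_of_mem i₀ hi₀ (fun i hi hne => by
    have := hlt i hi hne
    rw [zero_pow (by omega), zero_mul])] at h1
  have h2 : Tendsto (fun _ : ℂ => (0 : ℂ)) cusp (𝓝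
      (0 ^ (e i₀ - e i₀) * ((Q.coeff i₀).leadingCoeff * ζ ^ i₀))) := by
    refine h1.congr' ?_
    filter_upwards [eventually_cusp_mem_HH] with z hz
    have h3 := h z hz
    rw [eval_map, eval₂_eq_sum, Polynomial.sum] at h3
    rw [← mul_zero (sexp N z ^ e i₀), ← h3, Finset.mul_sum]
    refine Finset.sum_congr rfl fun i hi => ?_
    rw [← mul_assoc, ← pow_add, Nat.sub_add_cancel (hmax i hi)]
    rfl
  have h3 := tendsto_nhds_unique h2 tendsto_const_nhds
  simp only [Nat.sub_self, pow_zero, one_mul] at h3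
  refine mul_ne_zero (leadingCoeff_ne_zero.2 (mem_support_iff.1 hi₀)) (pow_ne_zero _ hζ) h3

lemma exists_coprime_add {a b d : ℤ} (hd : d ≠ 0)
    (h : ∀ q : ℕ, q.Prime → (q : ℤ) ∣ a → (q : ℤ) ∣ b →
    (q : ℤ) ∣ d → False) : ∃ p : ℤ, IsCoprime (a * p + b) d := by
  classical
  refine ⟨((d.natAbs.primeFactors.filter (fun q : ℕ => ¬ ((q : ℤ) ∣ b))).prod (fun q : ℕ => q) : ℕ), ?_⟩
  rw [Int.isCoprime_iff_gcd_eq_one]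
  refine Nat.Coprime.gcd_eq_one (Nat.Coprime.symm (Nat.coprime_of_dvd fun q hq hqd hqn => ?_))
  have hqd' : (q : ℤ) ∣ d := Int.natCast_dvd.2 hqd
  have hqn' := Int.natCast_dvd.2 hqn
  by_cases hqb : (q : ℤ) ∣ b
  · have h1 := (dvd_add_left hqb).1 hqn'
    rcases (Nat.prime_iff_prime_int.1 hq).dvd_or_dvd h1 with h2 | h2
    · exact h q hq h2 hqb hqd'
    · have h3 := Int.natCast_dvd_natCast.1 h2
      obtain ⟨r, hr, hqr⟩ := (Prime.dvd_finsetProd_iff hq.prime _).1 h3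
      simp only [Finset.mem_filter, Nat.mem_primeFactors] at hr
      have := (Nat.prime_dvd_prime_iff_eq hq hr.1.1).1 hqr
      subst this
      exact hr.2 hqb
  · refine hqb ((dvd_add_right ?_).1 hqn')
    refine Dvd.dvd.mul_left (Int.natCast_dvd_natCast.2 (Finset.dvd_prod_of_mem _ ?_)) _
    simp only [Finset.mem_filter, Nat.mem_primeFactors]
    exact ⟨⟨hq, hqd, by omega⟩, hqb⟩

/-- Every branch is, after an `SL₂(ℤ)`-change of variable, the branch of a cyclic isogeny. -/
lemma IsModularJ.exists_cyclic (hj : IsModularJ j) {N : ℕ} (hN : 0 < N) {f : ℂ → ℂ}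
    (hf : f ∈ branches j N) : ∃ N₀ : ℕ, 0 < N₀ ∧ f ∈ branches j N₀ ∧
      ∃ (g : Matrix (Fin 2) (Fin 2) ℤ) (b : ℤ), g.det = 1 ∧
        ∀ z ∈ HH, f (moeb (zmat g) z) = triBranch j 1 N₀ b z := by
  obtain ⟨a, d, b, ha, hd, had, rfl⟩ := hj.branches_tri hN hf
  set e : ℤ := gcd (gcd (a : ℤ) d) b with he
  have hea : e ∣ a := (gcd_dvd_left _ _).trans (gcd_dvd_left _ _)
  have hed : e ∣ d := (gcd_dvd_left _ _).trans (gcd_dvd_right _ _)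
  have heb : e ∣ b := gcd_dvd_right _ _
  have hmax : ∀ x : ℤ, x ∣ a → x ∣ d → x ∣ b → x ∣ e := fun x h1 h2 h3 =>
    dvd_gcd (dvd_gcd h1 h2) h3
  have he0 : 0 < e := by
    refine lt_of_le_of_ne (by rw [he, ← Int.coe_gcd]; positivity) fun h0 => ?_
    rw [← h0] at hea
    have := zero_dvd_iff.1 hea
    omega
  obtain ⟨a', ha'⟩ := hea
  obtain ⟨d', hd'⟩ := hed
  obtain ⟨b', hb'⟩ := heb
  have ha0 : 0 < a' := by by_contra! h; nlinarith
  have hd0 : 0 < d' := by by_contra! h; nlinarith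
  have hfun : ∀ z : ℂ, ((a : ℂ) * z + b) / d = (a' * z + b') / d' := by
    intro z
    have h1 : (a : ℂ) = e * a' := by exact_mod_cast congrArg (Int.cast : ℤ → ℂ) ha'
    have h2 : (d : ℂ) = e * d' := by exact_mod_cast congrArg (Int.cast : ℤ → ℂ) hd'
    have h3 : (b : ℂ) = e * b' := by exact_mod_cast congrArg (Int.cast : ℤ → ℂ) hb'
    have h4 : (e : ℂ) ≠ 0 := by exact_mod_cast he0.ne'
    rw [h1, h2, h3, mul_assoc, ← mul_add, mul_div_mul_left _ _ h4]
  obtain ⟨p, x, y, hxy⟩ := exists_coprime_add (a := a') (b := b') hd0.ne' fun q hq h1 h2 h3 => by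
    have h4 : e * q ∣ e := hmax _ (ha' ▸ mul_dvd_mul_left e h1) (hd' ▸ mul_dvd_mul_left e h3)
      (hb' ▸ mul_dvd_mul_left e h2)
    have h5 := Int.le_of_dvd he0 h4
    have h6 : (2 : ℤ) ≤ q := by exact_mod_cast hq.two_le
    nlinarith
  obtain ⟨N₀, hN₀⟩ := Int.eq_ofNat_of_zero_le (mul_pos ha0 hd0).le
  have hN₀' : (0 : ℤ) < N₀ := hN₀ ▸ mul_pos ha0 hd0
  set m : Matrix (Fin 2) (Fin 2) ℤ := !![a', b'; 0, d'] with hm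
  have hmdet : m.det = N₀ := by rw [hm, Matrix.det_fin_two, ← hN₀]; simp
  set g : Matrix (Fin 2) (Fin 2) ℤ := !![p, -1; 1, 0] with hg
  have hgdet : g.det = 1 := by rw [hg, Matrix.det_fin_two]; simp
  set δ : Matrix (Fin 2) (Fin 2) ℤ := !![x, y; -d', a' * p + b'] with hδ
  have hδdet : δ.det = 1 := by
    rw [hδ, Matrix.det_fin_two]; simp; linear_combination hxy
  have hprod : δ * (m * g) = !![1, -x * a'; 0, (N₀ : ℤ)] := by
    rw [hδ, hm, hg, ← hN₀]
    ext i k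
    fin_cases i <;> fin_cases k <;> simp [Matrix.mul_apply, Fin.sum_univ_two] <;>
      first | linear_combination hxy | linear_combination -hxy | ring
  have hmz : ∀ z ∈ HH, triBranch j a d b z = j (moeb (zmat m) z) := by
    intro z hz
    rw [triBranch, Set.indicator_of_mem hz, hfun]
    simp [moeb, zmat, hm]
  refine ⟨N₀, by exact_mod_cast hN₀', ⟨m, hmdet, ?_⟩, g, -x * a', hgdet, fun z hz => ?_⟩
  · ext z
    by_cases hz : z ∈ HH
    · rw [hmz z hz, Set.indicator_of_mem hz]
    · simp [triBranch, hz]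
  · have hgz : moeb (zmat g) z ∈ HH := moeb_zmat_mem_HH (by simp [hgdet]) hz
    rw [hmz _ hgz, ← moeb_zmat_mul (by simp [hmdet]; exact_mod_cast hN₀') (by simp [hgdet]) hz,
      ← hj.invariant δ hδdet _ (moeb_zmat_mem_HH (by
        rw [Matrix.det_mul, hmdet, hgdet, mul_one]; exact hN₀') hz),
      ← moeb_zmat_mul (by simp [hδdet]) (by rw [Matrix.det_mul, hmdet, hgdet, mul_one]; exact hN₀')
        hz, hprod, triBranch, Set.indicator_of_mem hz]
    simp [moeb, zmat]

end

section

open Polynomial Filter Topology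

variable {j : ℂ → ℂ}

lemma not_countable_HH : ¬ HH.Countable := by
  intro h
  obtain ⟨x, hx, hx'⟩ := (h.dense_compl ℝ).inter_open_nonempty HH isOpen_HH
    ⟨Complex.I, by simp [HH]⟩
  exact hx' hx

lemma subfield_eval₂_injective {L : Subfield ℂ} {x : ℂ} (hx : Transcendental L x) :
    Function.Injective (eval₂RingHom L.subtype x) := by
  rw [injective_iff_map_eq_zero]
  intro P hP
  exact (transcendental_iff.1 hx) P hP

/-- If `j c` is transcendental over `L` and a modular translate `j (m c)` has degree at most `D`
over `L(j c)`, then some modular polynomial of level at most `D` relates the two. -/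
lemma IsModularJ.degree_bound (hj : IsModularJ j) {L : Subfield ℂ} (hL : Zbar ≤ L.toSubring)
    {c : ℂ} (hc : c ∈ HH) (hx : Transcendental L (j c)) {N : ℕ} (hN : 0 < N)
    {m : Matrix (Fin 2) (Fin 2) ℤ} (hm : m.det = N) {P : L[X][X]} (hP : P ≠ 0)
    (hy : P.eval₂ (eval₂RingHom L.subtype (j c)) (j (moeb (zmat m) c)) = 0) :
    ∃ (N₀ : ℕ) (h : 0 < N₀), N₀ ≤ P.natDegree ∧
      ((modPoly hj h).map (eval₂RingHom Zbar.subtype (j c))).eval (j (moeb (zmat m) c)) = 0 := by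
  classical
  have hinj := subfield_eval₂_injective hx
  set ι : Zbar →+* L := Subring.inclusion hL
  have hG : ∀ {M : ℕ} (hM : 0 < M) (z y : ℂ),
      ((modPoly hj hM).map (mapRingHom ι)).eval₂ (eval₂RingHom L.subtype z) y =
        ((modPoly hj hM).map (eval₂RingHom Zbar.subtype z)).eval y := by
    intro M hM z y
    rw [eval₂_map, eval_map]
    congr 1
    ext a
    · simp only [RingHom.comp_apply, coe_eval₂RingHom, eval₂_C, coe_mapRingHom, map_C]; rfl
    · simp
  obtain ⟨Q, hQirr, hQdeg, hQP, hQy⟩ := exists_irreducible_factor _ hinj hP hy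
  have hdvd : ∀ {M : ℕ} (hM : 0 < M) (y : ℂ), Q.eval₂ (eval₂RingHom L.subtype (j c)) y = 0 →
      ((modPoly hj hM).map (eval₂RingHom Zbar.subtype (j c))).eval y = 0 →
      Q ∣ (modPoly hj hM).map (mapRingHom ι) := fun hM y h1 h2 =>
    dvd_of_common_root _ hinj hQirr hQdeg h1 (by rw [hG, h2])
  have hQN := hdvd hN _ hQy (modPoly_eval hj hN hm hc)
  have hlead : IsUnit Q.leadingCoeff := by
    obtain ⟨R, hR⟩ := hQN
    have h1 := ((modPoly_monic hj hN).map (mapRingHom ι)).leadingCoeff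
    rw [hR, leadingCoeff_mul] at h1
    exact .of_mul_eq_one _ h1
  have hroot : ∀ z ∈ HH, ∃ f ∈ branchFin hj hN, Q.eval₂ (eval₂RingHom L.subtype (j z)) (f z) = 0 := by
    intro z hz
    have hd : (Q.map (eval₂RingHom L.subtype (j z))).natDegree = Q.natDegree :=
      natDegree_map_of_leadingCoeff_ne_zero _ (hlead.map _).ne_zero
    obtain ⟨y, hy⟩ := IsAlgClosed.exists_root (Q.map (eval₂RingHom L.subtype (j z)))
      (fun h => hQdeg (by rw [← hd, natDegree_eq_of_degree_eq_some (n := 0) h]))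
    rw [IsRoot, eval_map] at hy
    obtain ⟨R, hR⟩ := hQN
    have h1 := hG hN (j z) y
    rw [hR, eval₂_mul, hy, zero_mul, modPoly_map hj hN hz, eval_prod] at h1
    obtain ⟨f, hf, h2⟩ := Finset.prod_eq_zero_iff.1 h1.symm
    refine ⟨f, hf, ?_⟩
    rw [eval_sub, eval_X, eval_C, sub_eq_zero] at h2
    rw [← h2, hy]
  have hana : ∀ f ∈ branchFin hj hN, AnalyticOnNhd ℂ
      (fun z => Q.eval₂ (eval₂RingHom L.subtype (j z)) (f z)) HH := by
    intro f hf
    have hfd := (hj.branches_mem_cuspRing hN (mem_branchFin.1 hf)).1.analyticOnNhd isOpen_HH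
    have : (fun z => Q.eval₂ (eval₂RingHom L.subtype (j z)) (f z)) =
        fun z => ∑ i ∈ Q.support, ((Q.coeff i).map L.subtype).eval (j z) * f z ^ i := by
      ext z
      rw [eval₂_eq_sum, Polynomial.sum]
      simp [eval_map]
    rw [this]
    refine Finset.analyticOnNhd_fun_sum _ fun i _ => ?_
    exact AnalyticOnNhd.mul (fun z hz => (hj.analyticOnNhd z hz).aeval_polynomial _) (hfd.pow i)
  obtain ⟨f, hf, hfz⟩ : ∃ f ∈ branchFin hj hN, ∀ z ∈ HH,
      Q.eval₂ (eval₂RingHom L.subtype (j z)) (f z) = 0 := by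
    by_contra! hcon
    refine not_countable_HH ?_
    refine ((branchFin hj hN).countable_toSet.biUnion (t := fun f _ => {z ∈ HH |
      Q.eval₂ (eval₂RingHom L.subtype (j z)) (f z) = 0}) fun f hf =>
      countable_zeros (hana f hf) (hcon f hf)).mono fun z hz => ?_
    obtain ⟨f, hf, h⟩ := hroot z hz
    exact Set.mem_biUnion (Finset.mem_coe.2 hf) ⟨hz, h⟩
  obtain ⟨N₀, hN₀, hfN₀, g, b, hg, hfg⟩ := hj.exists_cyclic hN (mem_branchFin.1 hf)
  have hle : N₀ ≤ Q.natDegree := by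
    by_contra! hlt
    refine hj.no_small_relation hN₀ b (Q := Q.map (mapRingHom L.subtype)) ?_
      (natDegree_map_le.trans_lt hlt) fun z hz => ?_
    · rw [Ne, Polynomial.map_eq_zero_iff (map_injective _ L.subtype_injective)]
      exact hQirr.ne_zero
    · have hgz : moeb (zmat g) z ∈ HH := moeb_zmat_mem_HH (by simp [hg]) hz
      have h1 := hfz _ hgz
      rw [hfg z hz, hj.invariant g hg z hz] at h1
      rw [Polynomial.map_map, eval_map, ← h1]
      congr 1
      ext a
      · simp
      · simp
  refine ⟨N₀, hN₀, hle.trans (natDegree_le_of_dvd hQP hP), ?_⟩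
  obtain ⟨R, hR⟩ := hdvd hN₀ (f c) (hfz c hc) (by
    rw [modPoly_map hj hN₀ hc, eval_prod]
    exact Finset.prod_eq_zero (mem_branchFin.2 hfN₀) (by simp))
  rw [← hG, hR, eval₂_mul, hQy, zero_mul]

end

section

open Polynomial Filter Topology

variable {j : ℂ → ℂ}

lemma transcendental_of_notMem_acl {T : Set ℂ} {x : ℂ} (hx : x ∉ acl T) :
    Transcendental (acl T) x := by
  rintro ⟨P, hP, hPx⟩
  refine hx (acl_root (P := P.map (acl T).subtype) ?_ (fun n => ?_) (y := x) ?_)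
  · exact (Polynomial.map_ne_zero_iff (acl T).subtype_injective).2 hP
  · rw [coeff_map]; exact (P.coeff n).2
  · rw [eval_map]; exact hPx

/-- Clearing denominators in a polynomial with coefficients in a simple extension. -/
lemma exists_clear_denominators {L : Subfield ℂ} {x : ℂ} {q : ℂ[X]} (hq : q ≠ 0)
    (hcoef : ∀ n, q.coeff n ∈ IntermediateField.adjoin L {x}) :
    ∃ P : L[X][X], P ≠ 0 ∧ P.natDegree ≤ q.natDegree ∧
      ∀ y, q.eval y = 0 → P.eval₂ (eval₂RingHom L.subtype x) y = 0 := by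
  classical
  have hfrac : ∀ n, ∃ r s : L[X], eval₂ L.subtype x s ≠ 0 ∧
      q.coeff n * eval₂ L.subtype x s = eval₂ L.subtype x r := by
    intro n
    obtain ⟨r, s, hrs⟩ := (IntermediateField.mem_adjoin_simple_iff L _).1 (hcoef n)
    by_cases hs : eval₂ L.subtype x s = 0
    · refine ⟨0, 1, by simp, ?_⟩
      rw [hrs, aeval_def, aeval_def]
      change _ / eval₂ L.subtype x s * _ = _
      simp [hs]
    · refine ⟨r, s, hs, ?_⟩
      rw [hrs]
      exact div_mul_cancel₀ _ hs
  choose r s hs hrs using hfrac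
  set φ := eval₂RingHom L.subtype x with hφ
  set P : L[X][X] := ∑ n ∈ q.support, monomial n (r n * ∏ m ∈ q.support.erase n, s m) with hP
  have hcoeff : ∀ n, φ (P.coeff n) = (∏ m ∈ q.support, φ (s m)) * q.coeff n := by
    intro n
    rw [hP, finsetSum_coeff]
    simp only [coeff_monomial, Finset.sum_ite_eq']
    split_ifs with hn
    · rw [map_mul, map_prod, ← Finset.mul_prod_erase _ _ hn]
      have := hrs n
      simp only [hφ, coe_eval₂RingHom] at this ⊢
      rw [← this]; ring
    · rw [map_zero, notMem_support_iff.1 hn, mul_zero]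
  have hprod : ∏ m ∈ q.support, φ (s m) ≠ 0 := Finset.prod_ne_zero_iff.2 fun m _ => hs m
  refine ⟨P, fun h0 => ?_, ?_, fun y hy => ?_⟩
  · have := hcoeff q.natDegree
    rw [h0, coeff_zero, map_zero] at this
    exact mul_ne_zero hprod (leadingCoeff_ne_zero.2 hq) this.symm
  · exact natDegree_sum_le_of_forall_le _ _ fun n hn =>
      (natDegree_monomial_le _).trans (le_natDegree_of_mem_supp n hn)
  · have : P.map φ = C (∏ m ∈ q.support, φ (s m)) * q := by
      ext n; rw [coeff_map, hcoeff, coeff_C_mul]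
    rw [← eval_map, this, eval_mul, hy, mul_zero]

/-- `DegRel hj D x y`: some modular polynomial of level at most `D` vanishes at `(x, y)`. -/
def DegRel (hj : IsModularJ j) (D : ℕ) (x y : ℂ) : Prop :=
  ∃ (N : ℕ) (h : 0 < N), N ≤ D ∧
    ((modPoly hj h).map (eval₂RingHom Zbar.subtype x)).eval y = 0

lemma IsModularJ.degRel_of_eval (hj : IsModularJ j) {T : Set ℂ} {c c' : ℂ} (hc : c ∈ HH)
    (hg : GRel c c') (hx : j c ∉ acl T) {q : ℂ[X]} (hq : q ≠ 0)
    (hcoef : ∀ n, q.coeff n ∈ IntermediateField.adjoin (acl T) {j c})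
    (hy : q.eval (j c') = 0) : DegRel hj q.natDegree (j c) (j c') := by
  obtain ⟨N, m, hN, hm, rfl⟩ := hg.exists_int
  obtain ⟨P, hP, hdeg, hPy⟩ := exists_clear_denominators hq hcoef
  obtain ⟨N₀, h, h1, h2⟩ := hj.degree_bound (fun x hx => Zbar_le_acl T hx) hc
    (transcendental_of_notMem_acl hx) hN hm hP (hPy _ hy)
  exact ⟨N₀, h, h1.trans hdeg, h2⟩

lemma DegRel.eq_of_one {hj : IsModularJ j} {c y : ℂ} (hc : c ∈ HH) (h : DegRel hj 1 (j c) y) :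
    y = j c := by
  obtain ⟨N, hN, hN1, h⟩ := h
  obtain rfl : N = 1 := by omega
  rw [modPoly_map hj hN hc, eval_prod] at h
  obtain ⟨f, hf, h⟩ := Finset.prod_eq_zero_iff.1 h
  obtain ⟨m, hm, rfl⟩ := mem_branchFin.1 hf
  rw [eval_sub, eval_X, eval_C, sub_eq_zero] at h
  rw [h, Set.indicator_of_mem hc]
  exact hj.invariant m (by simpa using hm) c hc

lemma GRel.mem_subfield {x y : ℂ} (h : GRel x y) (F : Subfield ℂ) (hx : x ∈ F) : y ∈ F := by
  obtain ⟨g, -, rfl⟩ := h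
  rw [moeb_qmat]
  have hq : ∀ r : ℚ, (r : ℂ) ∈ F := fun r => SubfieldClass.ratCast_mem F r
  exact div_mem (add_mem (mul_mem (hq _) hx) (hq _)) (add_mem (mul_mem (hq _) hx) (hq _))

/-- Transcendental values of `j` at two points of one orbit lie in one orbit only if they agree. -/
lemma IsModularJ.eq_of_GRel (hj : IsModularJ j) {T : Set ℂ} {c c' : ℂ} (hc : c ∈ HH)
    (hg : GRel c c') (hx : j c ∉ acl T) (hx' : j c ∈ HH) (h : GRel (j c) (j c')) :
    j c' = j c := by
  obtain ⟨g, hg0, hgy⟩ := h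
  have hd := denom_ne hg0 hx'
  rw [moeb_qmat, div_eq_iff hd] at hgy
  have hq : ∀ r : ℚ, (r : ℂ) ∈ IntermediateField.adjoin (acl T) {j c} := fun r =>
    SubfieldClass.ratCast_mem _ r
  have hj' := IntermediateField.mem_adjoin_simple_self (acl T) (j c)
  set q : ℂ[X] := C ((g 1 0 : ℂ) * j c + g 1 1) * X + C (-((g 0 0 : ℂ) * j c + g 0 1)) with hqdef
  have hdeg : q.natDegree = 1 := natDegree_linear hd
  refine (hdeg ▸ hj.degRel_of_eval hc hg hx (q := q) (fun h0 => ?_) (fun n => ?_) ?_ :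
    DegRel hj 1 (j c) (j c')).eq_of_one hc
  · rw [h0, natDegree_zero] at hdeg; exact zero_ne_one hdeg
  · rw [hqdef, coeff_add, coeff_C_mul, coeff_X, coeff_C]
    refine add_mem (mul_mem (add_mem (mul_mem (hq _) hj') (hq _)) ?_) ?_
    · split_ifs
      exacts [one_mem _, zero_mem _]
    · split_ifs
      exacts [neg_mem (add_mem (mul_mem (hq _) hj') (hq _)), zero_mem _]
  · rw [hqdef]; simp only [eval_add, eval_mul, eval_C, eval_X]; linear_combination -hgy

end

section

open Filter Topology Metric

lemma exists_odd_fraction (r : ℝ) {ε : ℝ} (hε : 0 < ε) (B : ℝ) : ∃ a c : ℤ, IsCoprime a c ∧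
    B < c ∧ 0 < c ∧ |(a : ℝ) / c - r| < ε := by
  obtain ⟨k, hk⟩ := pow_unbounded_of_one_lt (max B (1 / ε)) (one_lt_two (α := ℝ))
  have hc : (0 : ℝ) < 2 ^ k := by positivity
  refine ⟨2 * ⌊r * 2 ^ k / 2⌋ + 1, 2 ^ k, ?_, ?_, by positivity, ?_⟩
  · exact IsCoprime.pow_right ⟨1, -⌊r * 2 ^ k / 2⌋, by ring⟩
  · push_cast; exact (le_max_left _ _).trans_lt hk
  · have h1 := Int.floor_le (r * 2 ^ k / 2)
    have h2 := Int.lt_floor_add_one (r * 2 ^ k / 2)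
    have h3 : 1 / ε < 2 ^ k := (le_max_right _ _).trans_lt hk
    rw [div_lt_iff₀ hε] at h3
    push_cast
    rw [div_sub' hc.ne', abs_div, abs_of_pos hc, div_lt_iff₀ hc]
    refine lt_of_le_of_lt (abs_le.2 ⟨?_, ?_⟩) (by rwa [mul_comm] : 1 < ε * 2 ^ k) <;> nlinarith

/-- Compact subsets of the upper half-plane can be moved close to any real point by `SL₂(ℤ)`. -/
lemma exists_moeb_near_real {K : Set ℂ} (hK : IsCompact K) (hKH : K ⊆ HH) (r : ℝ) {ε : ℝ}
    (hε : 0 < ε) : ∃ g : Matrix (Fin 2) (Fin 2) ℤ, g.det = 1 ∧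
      ∀ w ∈ K, ‖moeb (zmat g) w - r‖ < ε := by
  obtain ⟨h, hh, hhK⟩ : ∃ h : ℝ, 0 < h ∧ ∀ w ∈ K, h ≤ w.im := by
    rcases K.eq_empty_or_nonempty with rfl | hne
    · exact ⟨1, one_pos, by simp⟩
    · obtain ⟨w, hw, hmin⟩ := hK.exists_isMinOn hne Complex.continuous_im.continuousOn
      exact ⟨w.im, hKH hw, fun v hv => hmin hv⟩
  obtain ⟨a, c, hac, hcB, hc, hlt⟩ := exists_odd_fraction r (half_pos hε) (max 1 (2 / (ε * h)))
  obtain ⟨d, b, hdb⟩ := hac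
  set g : Matrix (Fin 2) (Fin 2) ℤ := !![a, -b; c, d] with hg
  have hdet : g.det = 1 := by rw [hg, Matrix.det_fin_two_of]; linear_combination hdb
  refine ⟨g, hdet, fun w hw => ?_⟩
  have hcR : (0 : ℝ) < c := by exact_mod_cast hc
  have hcC : (c : ℂ) ≠ 0 := by exact_mod_cast hc.ne'
  have him : c * h ≤ ‖(c : ℂ) * w + d‖ := by
    refine le_trans ?_ (Complex.abs_im_le_norm _)
    simp only [Complex.add_im, Complex.mul_im, Complex.intCast_re, Complex.intCast_im]
    refine le_trans ?_ (le_abs_self _)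
    nlinarith [hhK w hw]
  have hden : (c : ℂ) * w + d ≠ 0 := norm_pos_iff.1 (lt_of_lt_of_le (by positivity) him)
  have heq : moeb (zmat g) w - r = ((a / c - r : ℝ) : ℂ) - 1 / (c * (c * w + d)) := by
    simp only [moeb, zmat, hg, Matrix.map_apply, Matrix.of_apply, Matrix.cons_val', Matrix.cons_val_zero,
      Matrix.cons_val_one, Matrix.cons_val_fin_one]
    have hdb' : (d : ℂ) * a + b * c = 1 := by exact_mod_cast hdb
    push_cast
    rw [sub_right_comm, div_sub_div _ _ hcC (mul_ne_zero hcC hden), sub_left_inj,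
      div_eq_div_iff hden (mul_ne_zero hcC (mul_ne_zero hcC hden))]
    linear_combination (-(c : ℂ) * (c * w + d)) * hdb'
  rw [heq]
  refine (norm_sub_le _ _).trans_lt ?_
  rw [Complex.norm_real, Real.norm_eq_abs, norm_div, norm_one, norm_mul, Complex.norm_intCast,
    abs_of_pos hcR]
  have h2 : 1 / (c * ‖(c : ℂ) * w + d‖) < ε / 2 := by
    rw [div_lt_iff₀ (mul_pos hcR (norm_pos_iff.2 hden))]
    have h3 : 2 / (ε * h) < c := (le_max_right _ _).trans_lt hcB
    have h4 : (1 : ℝ) < c := (le_max_left _ _).trans_lt hcB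
    rw [div_lt_iff₀ (by positivity)] at h3
    have h5 : (c : ℝ) * h ≤ c * ‖(c : ℂ) * w + d‖ := by nlinarith [norm_nonneg ((c : ℂ) * w + d)]
    nlinarith
  linarith

variable {j : ℂ → ℂ}

/-- A holomorphic local section of `j` taking values in a compact subset of the half-plane. -/
lemma IsModularJ.exists_section (hj : IsModularJ j) {x : ℂ}
    (hx : x ∉ j '' {z ∈ HH | deriv j z = 0}) :
    ∃ (ψ : ℂ → ℂ) (V K : Set ℂ), IsOpen V ∧ x ∈ V ∧ DifferentiableOn ℂ ψ V ∧ IsCompact K ∧ K ⊆ HH ∧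
      (∀ w ∈ V, ψ w ∈ K) ∧ ∀ w ∈ V, j (ψ w) = w := by
  obtain ⟨τ, hτ, rfl⟩ := hj.surj x
  have hd : deriv j τ ≠ 0 := fun h => hx ⟨τ, ⟨hτ, h⟩, rfl⟩
  have han := hj.analyticOnNhd τ hτ
  have hcd : ContDiffAt ℂ 1 j τ := han.contDiffAt
  have hder := (han.differentiableAt.hasDerivAt).hasFDerivAt_equiv hd
  set ψ := hcd.localInverse hder one_ne_zero
  have h1 : ContDiffAt ℂ 1 ψ (j τ) := hcd.to_localInverse hder one_ne_zero
  have h2 : ψ (j τ) = τ := hcd.localInverse_apply_image hder one_ne_zero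
  have h3 : ∀ᶠ w in 𝓝 (j τ), j (ψ w) = w :=
    (hcd.hasStrictFDerivAt' hder one_ne_zero).eventually_right_inverse
  obtain ⟨ρ, hρ, hρH⟩ := Metric.nhds_basis_closedBall.mem_iff.1 (isOpen_HH.mem_nhds hτ)
  have h4 : ∀ᶠ w in 𝓝 (j τ), ψ w ∈ closedBall τ ρ :=
    h1.continuousAt.eventually (by rw [h2]; exact closedBall_mem_nhds _ hρ)
  have h5 : ∀ᶠ w in 𝓝 (j τ), DifferentiableAt ℂ ψ w :=
    (h1.eventually (by simp)).mono fun w hw => hw.differentiableAt one_ne_zero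
  obtain ⟨V, hV, hVo, hxV⟩ := _root_.eventually_nhds_iff.1 (h3.and (h4.and h5))
  exact ⟨ψ, V, closedBall τ ρ, hVo, hxV, fun w hw => (hV w hw).2.2.differentiableWithinAt,
    isCompact_closedBall _ _, hρH, fun w hw => (hV w hw).2.1, fun w hw => (hV w hw).1⟩

/-- Holomorphic backward orbits of `j` staying close to prescribed real points. -/
lemma IsModularJ.exists_backward_orbit (hj : IsModularJ j) {r : ℕ → ℝ}
    (hr : ∀ i, (r i : ℂ) ∉ j '' {z ∈ HH | deriv j z = 0}) {ε : ℝ} (hε : 0 < ε) (m : ℕ) :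
    ∃ (ζ : ℕ → ℂ → ℂ) (U : Set ℂ), IsOpen U ∧ (r m : ℂ) ∈ U ∧ (∀ w, ζ m w = w) ∧
      (∀ i ≤ m, DifferentiableOn ℂ (ζ i) (U ∩ HH)) ∧
      (∀ i ≤ m, ∀ w ∈ U ∩ HH, ζ i w ∈ HH ∧ ‖ζ i w - r i‖ < ε) ∧
      ∀ i < m, ∀ w ∈ U ∩ HH, j (ζ i w) = ζ (i + 1) w := by
  induction m with
  | zero =>
    refine ⟨fun _ w => w, ball (r 0) ε, isOpen_ball, mem_ball_self hε, fun _ => rfl,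
      fun i _ => differentiableOn_id, fun i hi w hw => ⟨hw.2, ?_⟩, fun i hi => absurd hi (by simp)⟩
    obtain rfl : i = 0 := by omega
    exact mem_ball_iff_norm.1 hw.1
  | succ m ih =>
    obtain ⟨ζ, U, hU, hrU, hid, hdiff, hnear, horb⟩ := ih
    obtain ⟨ψ, V, K, hV, hrV, hψ, hK, hKH, hVK, hsec⟩ := hj.exists_section (hr (m + 1))
    obtain ⟨δ, hδ, hδU⟩ := Metric.isOpen_iff.1 hU _ hrU
    obtain ⟨g, hg, hgK⟩ := exists_moeb_near_real hK hKH (r m) hδ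
    have hgpos : 0 < g.det := by simp [hg]
    have hmem : ∀ w ∈ V, moeb (zmat g) (ψ w) ∈ U ∩ HH := fun w hw =>
      ⟨hδU (mem_ball_iff_norm.2 (hgK _ (hVK w hw))), moeb_zmat_mem_HH hgpos (hKH (hVK w hw))⟩
    have hjη : ∀ w ∈ V, j (moeb (zmat g) (ψ w)) = w := fun w hw => by
      rw [hj.invariant g hg _ (hKH (hVK w hw)), hsec w hw]
    have hη : DifferentiableOn ℂ (fun w => moeb (zmat g) (ψ w)) V := by
      have h1 : DifferentiableOn ℂ (moeb (zmat g)) HH := by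
        rw [zmat_eq_qmat]
        exact differentiableOn_moeb (by rw [det_map_intCast]; exact_mod_cast hgpos)
      exact h1.comp hψ fun w hw => hKH (hVK w hw)
    refine ⟨fun i w => if i ≤ m then ζ i (moeb (zmat g) (ψ w)) else w, V ∩ ball (r (m + 1)) ε,
      hV.inter isOpen_ball, ⟨hrV, mem_ball_self hε⟩, fun w => by simp, fun i hi => ?_,
      fun i hi w hw => ?_, fun i hi w hw => ?_⟩
    · by_cases him : i ≤ m
      · simp only [him, if_true]
        exact ((hdiff i him).comp hη hmem).mono fun w hw => hw.1.1
      · simp only [him, if_false]; exact differentiableOn_id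
    · by_cases him : i ≤ m
      · simp only [him, if_true]
        exact hnear i him _ (hmem w hw.1.1)
      · obtain rfl : i = m + 1 := by omega
        simp only [him, if_false]
        exact ⟨hw.2, mem_ball_iff_norm.1 hw.1.2⟩
    · have him : i ≤ m := by omega
      rcases him.lt_or_eq with h | rfl
      · simp only [him, if_true, Nat.succ_le_of_lt h]
        exact horb i h _ (hmem w hw.1.1)
      · simp [hid, hjη w hw.1.1]

end

section

open Filter Topology Metric

/-- The point of `ℂ^{n+1}` with first `n` coordinates `r` and last coordinate `y`. -/
def pt (n : ℕ) (r : ℕ → ℂ) (y : ℂ) : Fin (n + 1) → ℂ := fun k => if (k : ℕ) < n then r k else y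

lemma pt_dist_lt {n : ℕ} {r s : ℕ → ℂ} {y y' : ℂ} {ε : ℝ} (hε : 0 < ε)
    (h : ∀ i < n, ‖s i - r i‖ < ε) (hy : ‖y' - y‖ < ε) : dist (pt n r y) (pt n s y') < ε := by
  rw [dist_comm, dist_pi_lt_iff hε]
  intro k
  rw [dist_eq_norm, pt, pt]
  split_ifs with hk
  · exact h k hk
  · exact hy

lemma continuous_pt (n : ℕ) (r : ℕ → ℂ) : Continuous (pt n r) := by
  refine continuous_pi fun k => ?_
  unfold pt
  split_ifs <;> fun_prop

/-- A perturbation of a function with an isolated zero still has a zero. -/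
lemma exists_zero_of_perturbation {f F : ℂ → ℂ} {u : ℂ} {ρ μ : ℝ} (hρ : 0 < ρ) (hμ : 0 < μ)
    (hf : DifferentiableOn ℂ f (closedBall u ρ)) (hF0 : F u = 0)
    (hF : ∀ z ∈ sphere u ρ, μ ≤ ‖F z‖) (hfF : ∀ z ∈ closedBall u ρ, ‖f z - F z‖ < μ / 8) :
    ∃ z ∈ closedBall u ρ, f z = 0 := by
  have hu : ‖f u‖ < μ / 8 := by simpa [hF0] using hfF u (mem_closedBall_self hρ.le)
  have hsph : ∀ z ∈ sphere u ρ, 3 / 4 * μ ≤ ‖f z - f u‖ := by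
    intro z hz
    have h1 := hF z hz
    have h2 := hfF z (sphere_subset_closedBall hz)
    have h3 : ‖F z‖ ≤ ‖f z - F z‖ + ‖f z - f u‖ + ‖f u‖ := by
      calc ‖F z‖ = ‖-(f z - F z) + (f z - f u) + f u‖ := by congr 1; ring
        _ ≤ _ := by
          refine (norm_add_le _ _).trans (add_le_add_left ((norm_add_le _ _).trans ?_) _)
          rw [norm_neg]
    linarith
  have hcl : DiffContOnCl ℂ f (ball u ρ) :=
    ⟨hf.mono ball_subset_closedBall, by rw [closure_ball u hρ.ne']; exact hf.continuousOn⟩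
  have hfreq : ∃ᶠ z in 𝓝 u, f z ≠ f u := by
    intro hev
    simp only [not_not] at hev
    have h1 : Set.EqOn f (fun _ => f u) (ball u ρ) :=
      (hcl.differentiableOn.analyticOnNhd isOpen_ball).eqOn_of_preconnected_of_eventuallyEq
        analyticOnNhd_const (convex_ball u ρ).isPreconnected (mem_ball_self hρ) hev
    have h2 : Set.EqOn f (fun _ => f u) (closure (ball u ρ)) :=
      h1.of_subset_closure hcl.continuousOn continuousOn_const subset_closure subset_rfl
    obtain ⟨z, hz⟩ := (NormedSpace.sphere_nonempty (x := u) (r := ρ)).2 hρ.le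
    have h3 := hsph z hz
    rw [h2 (by rw [closure_ball u hρ.ne']; exact sphere_subset_closedBall hz)] at h3
    simp at h3
    linarith
  obtain ⟨z, hz, h⟩ := hcl.ball_subset_image_closedBall hρ hsph hfreq
    (show (0 : ℂ) ∈ _ by rw [mem_ball, dist_eq_norm, zero_sub, norm_neg]; linarith)
  exact ⟨z, hz, h⟩

variable {j : ℂ → ℂ}

/-- Solutions of `p(z, j(z), …, j_n(z)) = 0` near real noncritical points of the hypersurface. -/
lemma IsModularJ.exists_solution (hj : IsModularJ j) {n : ℕ} (hn : 0 < n)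
    (p : MvPolynomial (Fin (n + 1)) ℂ) {r : ℕ → ℝ}
    (hr : ∀ i, (r i : ℂ) ∉ j '' {z ∈ HH | deriv j z = 0}) {y₀ : ℂ}
    (h0 : MvPolynomial.eval (pt n (fun i => r i) y₀) p = 0)
    (hne : ∃ y, MvPolynomial.eval (pt n (fun i => r i) y) p ≠ 0) {ε : ℝ} (hε : 0 < ε) :
    ∃ z, (∀ i < n, jIt j i z ∈ HH ∧ ‖jIt j i z - r i‖ < ε) ∧ ‖jIt j n z - y₀‖ < ε ∧
      MvPolynomial.eval (fun k : Fin (n + 1) => jIt j k z) p = 0 := by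
  obtain ⟨m, rfl⟩ := Nat.exists_eq_succ_of_ne_zero hn.ne'
  set R : ℕ → ℂ := fun i => r i with hR
  obtain ⟨u₀, hu₀, hju₀⟩ := hj.surj y₀
  set F : ℂ → ℂ := fun u => MvPolynomial.eval (pt (m + 1) R (j u)) p with hFdef
  have hcoord : ∀ (s : ℕ → ℂ → ℂ) (A : Set ℂ), IsOpen A → (∀ i ≤ m, DifferentiableOn ℂ (s i) A) →
      A ⊆ HH → DifferentiableOn ℂ
        (fun u => MvPolynomial.eval (pt (m + 1) (fun i => s i u) (j u)) p) A := by
    intro s A hA hs hAH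
    have h1 : ∀ i, AnalyticOnNhd ℂ (fun u => pt (m + 1) (fun i => s i u) (j u) i) A := by
      intro i
      unfold pt
      split_ifs with hi
      · exact (hs i (by omega)).analyticOnNhd hA
      · exact hj.analyticOnNhd.mono hAH
    have h2 := AnalyticOnNhd.aeval_mvPolynomial h1 p
    exact (h2.congr hA fun u _ => by
      rw [MvPolynomial.aeval_eq_eval]).differentiableOn
  have hFan : AnalyticOnNhd ℂ F HH :=
    (hcoord (fun i _ => R i) HH isOpen_HH (fun i _ => differentiableOn_const _)
      subset_rfl).analyticOnNhd isOpen_HH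
  have hF0 : F u₀ = 0 := by rw [hFdef]; simp only [hju₀]; exact h0
  have hiso : ∀ᶠ z in 𝓝[≠] u₀, F z ≠ 0 := by
    refine (hFan u₀ hu₀).eventually_eq_zero_or_eventually_ne_zero.resolve_left fun hz => ?_
    obtain ⟨y, hy⟩ := hne
    obtain ⟨u, hu, rfl⟩ := hj.surj y
    exact hy (hFan.eqOn_of_preconnected_of_eventuallyEq analyticOnNhd_const
      isPreconnected_HH hu₀ hz hu)
  have hjc : ∀ᶠ z in 𝓝 u₀, ‖j z - y₀‖ < ε := by
    have h1 := (hj.analyticOnNhd u₀ hu₀).continuousAt.eventually (ball_mem_nhds _ hε)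
    filter_upwards [h1] with z hz
    rwa [hju₀, dist_eq_norm] at hz
  obtain ⟨ρ, hρ, hρb⟩ := Metric.nhds_basis_closedBall.mem_iff.1
    ((eventually_nhdsWithin_iff.1 hiso).and (hjc.and (isOpen_HH.mem_nhds hu₀)))
  obtain ⟨z₁, hz₁, hmin⟩ := (isCompact_sphere u₀ ρ).exists_isMinOn
    ((NormedSpace.sphere_nonempty (x := u₀) (r := ρ)).2 hρ.le)
    ((hFan.continuousOn.mono fun z hz =>
      (hρb (sphere_subset_closedBall hz)).2.2).norm)
  have hμ : 0 < ‖F z₁‖ := norm_pos_iff.2 ((hρb (sphere_subset_closedBall hz₁)).1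
    (ne_of_mem_sphere hz₁ hρ.ne'))
  have hBH : closedBall u₀ ρ ⊆ HH := fun z hz => (hρb hz).2.2
  have hcomp : IsCompact ((fun u => pt (m + 1) R (j u)) '' closedBall u₀ ρ) :=
    (isCompact_closedBall u₀ ρ).image_of_continuousOn
      ((continuous_pt _ _).comp_continuousOn (hj.holo.continuousOn.mono hBH))
  have hunif := hcomp.uniformContinuousAt_of_continuousAt (fun x => MvPolynomial.eval x p)
    (fun x _ => (MvPolynomial.continuous_eval p).continuousAt)
    (Metric.dist_mem_uniformity (show 0 < ‖F z₁‖ / 8 by positivity))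
  obtain ⟨δ, hδ, hδp⟩ := Metric.mem_uniformity_dist.1 hunif
  obtain ⟨ζ, U, hU, hrU, hid, hdiff, hnear, horb⟩ := hj.exists_backward_orbit hr (lt_min hδ hε) m
  obtain ⟨θ, hθ, hθU⟩ := Metric.isOpen_iff.1 hU _ hrU
  obtain ⟨g, hg, hgK⟩ := exists_moeb_near_real (isCompact_closedBall u₀ ρ) hBH (r m) hθ
  have hgpos : 0 < g.det := by simp [hg]
  have hmem : ∀ w ∈ closedBall u₀ ρ, moeb (zmat g) w ∈ U ∩ HH := fun w hw =>
    ⟨hθU (mem_ball_iff_norm.2 (hgK w hw)), moeb_zmat_mem_HH hgpos (hBH hw)⟩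
  have hmd : DifferentiableOn ℂ (moeb (zmat g)) HH := by
    rw [zmat_eq_qmat]
    exact differentiableOn_moeb (by rw [det_map_intCast]; exact_mod_cast hgpos)
  have hA : IsOpen (HH ∩ moeb (zmat g) ⁻¹' U) := hmd.continuousOn.isOpen_inter_preimage isOpen_HH hU
  have hfd := hcoord (fun i u => ζ i (moeb (zmat g) u)) _ hA (fun i hi =>
    (hdiff i hi).comp (hmd.mono Set.inter_subset_left)
      fun u hu => ⟨hu.2, moeb_zmat_mem_HH hgpos hu.1⟩) Set.inter_subset_left
  obtain ⟨u, hu, hu0⟩ := exists_zero_of_perturbation hρ hμ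
    (hfd.mono fun u hu => ⟨hBH hu, (hmem u hu).1⟩) hF0 (fun z hz => hmin hz) fun z hz => by
      have h1 := hδp (pt_dist_lt (n := m + 1) (r := R) (s := fun i => ζ i (moeb (zmat g) z))
        (y := j z) (y' := j z) hδ (fun i hi =>
          ((hnear i (by omega) _ (hmem z hz)).2.trans_le (min_le_left _ _))) (by simpa using hδ))
        ⟨z, hz, rfl⟩
      simp only [Set.mem_ofPred_eq] at h1
      rwa [dist_comm, dist_eq_norm] at h1
  have hjI : ∀ i ≤ m, jIt j i (ζ 0 (moeb (zmat g) u)) = ζ i (moeb (zmat g) u) := by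
    intro i
    induction i with
    | zero => intro _; rfl
    | succ i ih =>
      intro hi
      rw [jIt, Function.comp_apply, ih (by omega), horb i (by omega) _ (hmem u hu)]
  have hlast : jIt j (m + 1) (ζ 0 (moeb (zmat g) u)) = j u := by
    rw [jIt, Function.comp_apply, hjI m le_rfl, hid, hj.invariant g hg u (hBH hu)]
  refine ⟨ζ 0 (moeb (zmat g) u), fun i hi => ?_, ?_, ?_⟩
  · rw [hjI i (by omega)]
    have := hnear i (by omega) _ (hmem u hu)
    exact ⟨this.1, this.2.trans_le (min_le_right _ _)⟩
  · rw [hlast]; exact (hρb hu).2.1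
  · rw [← hu0]
    congr 1
    congr 1
    ext k
    unfold pt
    split_ifs with hk
    · rw [hjI k (by omega)]
    · rw [show (k : ℕ) = m + 1 by omega, hlast]

end

section

open Polynomial

/-- The transcendence rank over `ℚ` of a set of complex numbers. -/
def rk (S : Set ℂ) : ℕ∞ := (AlgebraicIndependent.matroid ℚ ℂ).eRk S

lemma rk_mono {S T : Set ℂ} (h : S ⊆ T) : rk S ≤ rk T := Matroid.eRk_mono _ h

lemma rk_acl (S : Set ℂ) : rk (acl S) = rk S := by
  rw [coe_acl]; exact Matroid.eRk_closure_eq _ S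

lemma rk_le_of_subset_acl {S T : Set ℂ} (h : S ⊆ acl T) : rk S ≤ rk T :=
  (rk_mono h).trans (rk_acl T).le

lemma rk_union_le (S T : Set ℂ) : rk (S ∪ T) ≤ rk S + T.encard :=
  Matroid.eRk_union_le_eRk_add_encard _ S T

lemma rk_ne_top {S : Set ℂ} (h : S.Finite) : rk S ≠ ⊤ :=
  ne_top_of_le_ne_top (Set.encard_ne_top_iff.2 h) (Matroid.eRk_le_encard _ S)

/-- Algebraic independence over `T` of the family `v` restricted to `s`. -/
def AIndOn {ι : Type*} (T : Set ℂ) (v : ι → ℂ) (s : Set ι) : Prop :=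
  ∀ k ∈ s, v k ∉ acl (T ∪ v '' (s \ {k}))

variable {ι : Type*} {T : Set ℂ} {v : ι → ℂ} {s : Set ι}

lemma AIndOn.mono (h : AIndOn T v s) {t : Set ι} (hts : t ⊆ s) : AIndOn T v t := fun k hk hk' =>
  h k (hts hk) (acl_mono (Set.union_subset_union_right _
    (Set.image_mono (Set.sdiff_subset_sdiff_left hts))) hk')

lemma AIndOn.insert_of_notMem (h : AIndOn T v s) {k : ι} (hv : v k ∉ acl (T ∪ v '' s)) :
    AIndOn T v (insert k s) := by
  intro i hi hvi
  by_cases hik : i = k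
  · subst hik
    refine hv (acl_mono (Set.union_subset_union_right _ (Set.image_mono ?_)) hvi)
    rintro x ⟨hx | hx, hx'⟩
    · exact absurd hx hx'
    · exact hx
  have his : i ∈ s := hi.resolve_left hik
  refine hv ?_
  have h1 : v i ∈ acl (insert (v k) (T ∪ v '' (s \ {i}))) := by
    refine acl_mono ?_ hvi
    rintro x (hx | ⟨l, ⟨hl | hl, hl'⟩, rfl⟩)
    · exact Or.inr (Or.inl hx)
    · subst hl; exact Or.inl rfl
    · exact Or.inr (Or.inr ⟨l, ⟨hl, hl'⟩, rfl⟩)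
  refine acl_mono ?_ (acl_exchange h1 (h i his))
  rintro x (rfl | hx | ⟨l, hl, rfl⟩)
  · exact Or.inr ⟨i, his, rfl⟩
  · exact Or.inl hx
  · exact Or.inr ⟨l, hl.1, rfl⟩

lemma AIndOn.algebraicIndependent (h : AIndOn T v s) {L : Subfield ℂ} (hL : L ≤ acl T) :
    AlgebraicIndependent L (fun i : s => v i) := by
  refine algebraicIndependent_of_finite_type' (algebraMap L ℂ).injective fun t _ _ i hi => ?_
  obtain ⟨B, hB⟩ : ∃ B, B = Algebra.adjoin L ((fun i : s => v i) '' t) := ⟨_, rfl⟩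
  rw [← hB]
  rintro ⟨P, hP, hPi⟩
  refine h i i.2 ?_
  have hBle : ∀ x : B, (x : ℂ) ∈ acl (T ∪ v '' (s \ {↑i})) := by
    subst hB
    rintro ⟨x, hx⟩
    induction hx using Algebra.adjoin_induction with
    | mem x hx =>
      obtain ⟨l, hl, rfl⟩ := hx
      refine mem_acl_of_mem (Or.inr ⟨l, ⟨l.2, ?_⟩, rfl⟩)
      rintro hli
      exact hi (Subtype.ext hli ▸ hl)
    | algebraMap r => exact acl_mono Set.subset_union_left (hL r.2)
    | add x y _ _ hx hy => exact add_mem hx hy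
    | mul x y _ _ hx hy => exact mul_mem hx hy
  refine acl_root (P := P.map (algebraMap B ℂ)) ?_ (fun n => ?_) ?_
  · rwa [Ne, Polynomial.map_eq_zero_iff (FaithfulSMul.algebraMap_injective B ℂ)]
  · rw [coeff_map]; exact hBle _
  · rwa [eval_map, ← aeval_def]

/-- If few elements generate a set of large rank over `F`, they are independent. -/
lemma aIndOn_of_rank {F A : Set ℂ} (hF : F.Finite) {z : ι → ℂ} {s : Finset ι} {d : ℕ}
    (hA : A ⊆ acl (F ∪ z '' s)) (hd : rk F + d ≤ rk (F ∪ A)) (hs : s.card ≤ d) :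
    s.card = d ∧ AIndOn F z (s : Set ι) := by
  classical
  have key : ∀ t : Finset ι, A ⊆ acl (F ∪ z '' t) → d ≤ t.card := by
    intro t ht
    have h1 : rk (F ∪ A) ≤ rk F + (t.card : ℕ∞) := by
      refine (rk_le_of_subset_acl (Set.union_subset
        (Set.subset_union_left.trans (subset_acl _)) ht)).trans ((rk_union_le _ _).trans ?_)
      gcongr
      exact (Set.encard_image_le _ _).trans (by simp)
    have h2 := hd.trans h1
    rw [ENat.add_le_add_iff_left (rk_ne_top hF)] at h2
    exact_mod_cast h2
  refine ⟨hs.antisymm (key s hA), fun k hk hk' => ?_⟩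
  have h3 := key (s.erase k) fun x hx => by
    refine acl_le (Set.union_subset ?_ ?_) (hA hx)
    · exact Set.subset_union_left.trans (subset_acl _)
    · rintro _ ⟨l, hl, rfl⟩
      by_cases hlk : l = k
      · subst hlk; simpa using hk'
      · exact mem_acl_of_mem (Or.inr ⟨l, by simpa [hlk] using hl, rfl⟩)
  rw [Finset.card_erase_of_mem hk] at h3
  have : 0 < s.card := Finset.card_pos.2 ⟨k, hk⟩
  omega

/-- The transcendence degree over the prime field is bounded by the rank. -/
lemma trdegF_bot_le {ι : Type*} [Fintype ι] (v : ι → ℂ) : (trdegF ⊥ v : ℕ∞) ≤ rk (Set.range v) := by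
  classical
  unfold trdegF
  set A := {k | ∃ t : Finset ι, t.card = k ∧
    AlgebraicIndependent (⊥ : Subfield ℂ) (fun i : t => v i.1)} with hA
  have hne : A.Nonempty := ⟨0, ∅, rfl, by
    rw [algebraicIndependent_empty_type_iff]; exact (algebraMap (⊥ : Subfield ℂ) ℂ).injective⟩
  have hbdd : BddAbove A := ⟨Fintype.card ι, by rintro _ ⟨t, rfl, _⟩; exact t.card_le_univ⟩
  obtain ⟨t, ht, hi⟩ := Nat.sSup_mem hne hbdd
  rw [← ht]
  have hQ : AlgebraicIndependent ℚ (fun i : t => v i.1) :=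
    hi.restrictScalars (algebraMap ℚ (⊥ : Subfield ℂ)).injective
  rw [rk, Matroid.le_eRk_iff]
  refine ⟨Set.range (fun i : t => v i.1), ?_, ?_, ?_⟩
  · rintro _ ⟨i, rfl⟩; exact ⟨i, rfl⟩
  · exact AlgebraicIndependent.matroid_indep_iff.2 hQ.to_subtype_range
  · rw [← Set.image_univ, hQ.injective.injOn.encard_image]
    simp

end

section

open Polynomial

lemma countable_acl {T : Set ℂ} (hT : T.Countable) : (acl T : Set ℂ).Countable := by
  have : Countable T := hT
  have h2 : Countable (Algebra.adjoin ℚ T) := by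
    have h := Algebra.lift_cardinalMk_adjoin_le ℚ T
    simp only [Cardinal.lift_id] at h
    exact Cardinal.mk_le_aleph0_iff.1 (h.trans (by simp))
  exact Algebraic.countable (Algebra.adjoin ℚ T) ℂ

variable {ι : Type*}

lemma exists_lift {f : MvPolynomial ι ℂ} {L : Subfield ℂ} (hf : ∀ m, f.coeff m ∈ L) :
    ∃ g : MvPolynomial ι L, g.map L.subtype = f :=
  MvPolynomial.mem_range_map_iff_coeffs_subset.2 fun x hx => by
    obtain ⟨m, -, rfl⟩ := MvPolynomial.mem_coeffs_iff.1 hx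
    exact ⟨⟨_, hf m⟩, rfl⟩

lemma AIndOn.eval_ne_zero {T : Set ℂ} {v : ι → ℂ} (h : AIndOn T v Set.univ)
    {f : MvPolynomial ι ℂ} (hf0 : f ≠ 0) (hf : ∀ m, f.coeff m ∈ acl T) :
    MvPolynomial.eval v f ≠ 0 := by
  obtain ⟨g, rfl⟩ := exists_lift hf
  have hi := (h.algebraicIndependent le_rfl).comp (fun i : ι => (⟨i, trivial⟩ : Set.univ))
    (fun a b hab => congrArg Subtype.val hab)
  intro h0
  refine hf0 ?_
  rw [(algebraicIndependent_iff.1 hi) g, map_zero]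
  rw [MvPolynomial.eval_map] at h0
  exact h0

variable [DecidableEq ι]

/-- The one-variable polynomial obtained by specialising all variables but `i`. -/
def slice (i : ι) (v : ι → ℂ) (f : MvPolynomial ι ℂ) : ℂ[X] :=
  MvPolynomial.aeval (fun k => if k = i then X else C (v k)) f

variable {i : ι} {v : ι → ℂ} {f : MvPolynomial ι ℂ}

lemma eval_slice (y : ℂ) : (slice i v f).eval y = MvPolynomial.eval (Function.update v i y) f := by
  have h := MvPolynomial.map_aeval (fun k => if k = i then (X : ℂ[X]) else C (v k))
    (Polynomial.evalRingHom y) f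
  rw [Polynomial.coe_evalRingHom] at h
  rw [slice, h]
  have h1 : (Polynomial.evalRingHom y).comp (algebraMap ℂ ℂ[X]) = RingHom.id ℂ := by
    ext1 x; simp
  have h2 : (fun k => Polynomial.eval y (if k = i then (X : ℂ[X]) else C (v k)))
      = Function.update v i y := by
    ext1 k
    by_cases hk : k = i
    · subst hk; simp
    · simp [hk]
  rw [h1, h2]
  rfl

lemma eval_slice_self : (slice i v f).eval (v i) = MvPolynomial.eval v f := by
  rw [eval_slice, Function.update_eq_self]

lemma slice_congr {w : ι → ℂ} (h : ∀ k, k ≠ i → v k = w k) : slice i v f = slice i w f := by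
  unfold slice
  congr 2
  ext1 k
  by_cases hk : k = i
  · simp [hk]
  · simp [hk, h k hk]

lemma natDegree_slice_le : (slice i v f).natDegree ≤ f.totalDegree := by
  have h := MvPolynomial.aeval_natDegree_le f (m := f.totalDegree) le_rfl (n := 1)
    (fun k : ι => if k = i then (X : ℂ[X]) else C (v k)) (fun k => by split_ifs <;> simp)
  simpa [slice] using h

lemma coeff_slice_mem {F : Subfield ℂ} (hf : ∀ m, f.coeff m ∈ F) (hv : ∀ k, k ≠ i → v k ∈ F)
    (n : ℕ) : (slice i v f).coeff n ∈ F := by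
  have : slice i v f ∈ Polynomial.lifts F.subtype := by
    obtain ⟨g, rfl⟩ := exists_lift hf
    rw [slice, MvPolynomial.aeval_def, MvPolynomial.eval₂_eq]
    refine sum_mem fun m _ => mul_mem ?_ (prod_mem fun k _ => pow_mem ?_ _)
    · exact Polynomial.C_mem_lifts F.subtype ⟨_, hf m⟩
    · split_ifs with hk
      · exact Polynomial.X_mem_lifts _
      · exact Polynomial.C_mem_lifts F.subtype ⟨_, hv k hk⟩
  obtain ⟨x, hx⟩ := (Polynomial.lifts_iff_coeff_lifts _).1 this n
  rw [← hx]; exact x.2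

lemma mem_acl_of_slice {T : Set ℂ} (hf : ∀ m, f.coeff m ∈ acl T) (h0 : MvPolynomial.eval v f = 0)
    (hs : slice i v f ≠ 0) {U : Set ℂ} (hTU : T ⊆ acl U) (hU : ∀ k, k ≠ i → v k ∈ acl U) :
    v i ∈ acl U := by
  refine acl_root hs (coeff_slice_mem (fun m => acl_le hTU (hf m)) hU) ?_
  rw [eval_slice_self, h0]

lemma isOpen_slice_ne_zero (i : ι) (f : MvPolynomial ι ℂ) : IsOpen {v | slice i v f ≠ 0} := by
  have : {v | slice i v f ≠ 0} = ⋃ y : ℂ, {v | MvPolynomial.eval (Function.update v i y) f ≠ 0} := by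
    ext v
    simp only [Set.mem_ofPred_eq, Set.mem_iUnion, ← eval_slice]
    constructor
    · intro h
      by_contra! h'
      exact h (Polynomial.funext fun y => by simp [h'])
    · rintro ⟨y, hy⟩ h
      simp [h] at hy
  rw [this]
  refine isOpen_iUnion fun y => isOpen_ne_fun ?_ continuous_const
  exact (MvPolynomial.continuous_eval f).comp (continuous_id.update i continuous_const)

lemma slice_ne_zero_of_aIndOn [Countable ι] {T : Set ℂ} (hT : T.Countable) (h : AIndOn T v {i}ᶜ)
    (hf0 : f ≠ 0) (hf : ∀ m, f.coeff m ∈ acl T) : slice i v f ≠ 0 := by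
  obtain ⟨y, hy⟩ : ∃ y, y ∉ acl (T ∪ Set.range v) := by
    by_contra! h'
    refine not_countable_HH ((countable_acl (hT.union (Set.countable_range v))).mono ?_)
    exact fun x _ => h' x
  have hw : AIndOn T (Function.update v i y) {i}ᶜ := by
    intro k hk hk'
    rw [Function.update_of_ne hk] at hk'
    refine h k hk (acl_mono (Set.union_subset_union_right _ ?_) hk')
    rintro _ ⟨l, hl, rfl⟩
    exact ⟨l, hl, by rw [Function.update_of_ne hl.1]⟩
  have hw' := hw.insert_of_notMem (k := i) (by
    rw [Function.update_self]
    refine fun hy' => hy (acl_mono (Set.union_subset_union_right _ ?_) hy')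
    rintro _ ⟨l, hl, rfl⟩
    exact ⟨l, by rw [Function.update_of_ne hl]⟩)
  have hu : insert i {i}ᶜ = (Set.univ : Set ι) := by ext x; simp [em]
  rw [hu] at hw'
  have := hw'.eval_ne_zero hf0 hf
  rw [← eval_slice] at this
  intro h0
  simp [h0] at this

end

section

open Polynomial

/-- The set of values of `z, j, j', j''` on a set of points. -/
def jet (j : ℂ → ℂ) (X : Set ℂ) : Set ℂ := X ∪ j '' X ∪ deriv j '' X ∪ deriv (deriv j) '' X

lemma jet_union (j : ℂ → ℂ) (X Y : Set ℂ) : jet j (X ∪ Y) = jet j X ∪ jet j Y := by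
  simp only [jet, Set.image_union]
  ext x
  simp only [Set.mem_union]
  tauto

lemma jet_finite (j : ℂ → ℂ) {X : Set ℂ} (hX : X.Finite) : (jet j X).Finite :=
  ((hX.union (hX.image _)).union (hX.image _)).union (hX.image _)

/-- The non-quadratic orbits met by a set. -/
def orbs (X : Set ℂ) : Set (Set ℂ) := {S | ∃ x ∈ X, S = Gorb x ∧ ∀ c ∈ SigmaSet, ¬ GRel x c}

lemma orbs_finite {X : Set ℂ} (hX : X.Finite) : (orbs X).Finite :=
  (hX.image Gorb).subset fun _ ⟨x, hx, h, _⟩ => ⟨x, hx, h.symm⟩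

variable {j : ℂ → ℂ}

lemma MSCD.rk_jet (hM : MSCD j) (X : Finset ℂ) (hX : ∀ x ∈ X, x ∈ HH) :
    ((3 * (orbs X).ncard : ℕ) : ℕ∞) ≤ rk (jet j X) := by
  let z : Fin X.card → ℂ := fun i => X.equivFin.symm i
  have hz : ∀ x, x ∈ X ↔ ∃ i, z i = x := fun x => by
    constructor
    · intro hx
      exact ⟨X.equivFin ⟨x, hx⟩, by simp [z]⟩
    · rintro ⟨i, rfl⟩
      exact (X.equivFin.symm i).2
  have h1 := hM X.card z fun i => hX _ ((hz _).2 ⟨i, rfl⟩)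
  have h2 : dimG z SigmaSet = (orbs X).ncard := by
    unfold dimG orbs
    congr 1
    ext S
    constructor
    · rintro ⟨i, h⟩
      exact ⟨z i, (hz _).2 ⟨i, rfl⟩, h⟩
    · rintro ⟨x, hx, h⟩
      obtain ⟨i, rfl⟩ := (hz x).1 hx
      exact ⟨i, h⟩
  rw [h2] at h1
  refine le_trans (by exact_mod_cast h1) ((trdegF_bot_le _).trans (rk_mono ?_))
  rintro _ ⟨⟨k, i⟩, rfl⟩
  have hi : z i ∈ (X : Set ℂ) := (hz _).2 ⟨i, rfl⟩
  fin_cases k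
  · exact Or.inl (Or.inl (Or.inl hi))
  · exact Or.inl (Or.inl (Or.inr ⟨_, hi, rfl⟩))
  · exact Or.inl (Or.inr ⟨_, hi, rfl⟩)
  · exact Or.inr ⟨_, hi, rfl⟩

/-- A finite base `F` over which points of `HH` outside the saturated set `S` are as
independent as possible. -/
structure SBase (j : ℂ → ℂ) (F S : Set ℂ) : Prop where
  finite : F.Finite
  sub : S ⊆ HH
  grel : ∀ {z w}, z ∈ S → GRel z w → w ∈ S
  alg : ∀ {z}, z ∈ S → z ∈ acl F ∧ j z ∈ acl F
  ind : ∀ X : Finset ℂ, (∀ x ∈ X, x ∈ HH ∧ x ∉ S) → (∀ x ∈ X, ∀ y ∈ X, GRel x y → x = y) →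
    rk F + (3 * X.card : ℕ) ≤ rk (F ∪ jet j X)

/-- The set of points in the orbits of quadratic points and of points of `t`. -/
def sat (t : Set ℂ) : Set ℂ := {w ∈ HH | ∃ c ∈ SigmaSet ∪ t, GRel w c}

lemma ncard_orbs_union_le {t X : Finset ℂ} (ht : ∀ x ∈ t, x ∈ HH) (hX : ∀ x ∈ X, x ∈ HH ∧ x ∉ sat t)
    (hXX : ∀ x ∈ X, ∀ y ∈ X, GRel x y → x = y) :
    (orbs t).ncard + X.card ≤ (orbs (t ∪ X : Set ℂ)).ncard := by
  have hG : ∀ {x y}, y ∈ HH → Gorb x = Gorb y → GRel x y := fun {x y} hy h => by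
    have : y ∈ Gorb y := GRel.refl y
    rw [← h] at this
    exact this
  have hi : Set.InjOn Gorb (X : Set ℂ) := fun x hx y hy h => hXX x hx y hy (hG (hX y hy).1 h)
  have h1 : (Gorb '' (X : Set ℂ)).ncard = X.card := by
    rw [hi.ncard_image, Set.ncard_coe_finset]
  rw [← h1, ← Set.ncard_union_eq ?_ (orbs_finite t.finite_toSet) (X.finite_toSet.image _)]
  · refine Set.ncard_le_ncard ?_ (orbs_finite (t.finite_toSet.union X.finite_toSet))
    rintro S (⟨x, hx, h⟩ | ⟨x, hx, rfl⟩)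
    · exact ⟨x, Or.inl hx, h⟩
    · exact ⟨x, Or.inr hx, rfl, fun c hc h => (hX x hx).2 ⟨(hX x hx).1, c, Or.inl hc, h⟩⟩
  · rw [Set.disjoint_left]
    rintro S ⟨y, hy, rfl, -⟩ ⟨x, hx, h⟩
    exact (hX x hx).2 ⟨(hX x hx).1, y, Or.inr hy, hG (ht y hy) h⟩

lemma mem_acl_of_mem_SigmaSet {c : ℂ} (hc : c ∈ SigmaSet) (T : Set ℂ) : c ∈ acl T := by
  have h : IsIntegral ℚ c := by
    by_contra h
    have := hc.2
    rw [minpoly.eq_zero h] at this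
    simp at this
  exact acl_mono (Set.empty_subset T) (mem_acl.2 (h.isAlgebraic.extendScalars
    (algebraMap ℚ (Algebra.adjoin ℚ (∅ : Set ℂ))).injective))

lemma IsModularJ.j_mem_acl_of_mem_SigmaSet (hj : IsModularJ j) {c : ℂ} (hc : c ∈ SigmaSet)
    (T : Set ℂ) : j c ∈ acl T :=
  Zbar_le_acl T (hj.isIntegral_of_mem_SigmaSet hc)

lemma IsModularJ.sat_alg (hj : IsModularJ j) {t F : Set ℂ} (ht : t ⊆ HH) (hF : jet j t ⊆ F) {z : ℂ}
    (hz : z ∈ sat t) : z ∈ acl F ∧ j z ∈ acl F := by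
  obtain ⟨hz, c, hc, h⟩ := hz
  have h1 : c ∈ HH ∧ c ∈ acl F ∧ j c ∈ acl F := by
    rcases hc with hc | hc
    · exact ⟨hc.1, mem_acl_of_mem_SigmaSet hc _, hj.j_mem_acl_of_mem_SigmaSet hc _⟩
    · exact ⟨ht hc, mem_acl_of_mem (hF (Or.inl (Or.inl (Or.inl hc)))),
        mem_acl_of_mem (hF (Or.inl (Or.inl (Or.inr ⟨c, hc, rfl⟩))))⟩
  exact ⟨(h.symm hz).mem_acl h1.2.1, (h.symm hz).j_mem_acl hj h1.1 h1.2.2⟩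

lemma sat_grel {t : Set ℂ} {z w : ℂ} (hz : z ∈ sat t) (h : GRel z w) : w ∈ sat t := by
  obtain ⟨hz, c, hc, h'⟩ := hz
  exact ⟨h.mem hz, c, hc, (h.symm hz).trans h' (h.mem hz)⟩

theorem MSCD.sBase_empty (hj : IsModularJ j) (hM : MSCD j) : SBase j ∅ (sat ∅) where
  finite := Set.finite_empty
  sub := fun _ h => h.1
  grel := sat_grel
  alg := fun h => hj.sat_alg (Set.empty_subset _) (by simp [jet]) h
  ind := fun X hX hXX => by
    have h1 := hM.rk_jet X fun x hx => (hX x hx).1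
    have h2 := ncard_orbs_union_le (t := ∅) (by simp) (by simpa using hX) hXX
    have h3 : rk ∅ = 0 := Matroid.eRk_empty _
    rw [h3, zero_add, Set.empty_union]
    refine le_trans ?_ h1
    norm_cast
    simp [orbs] at h2 ⊢
    omega

theorem MSCD.exists_sBase (hj : IsModularJ j) (hM : MSCD j) {κ : Set ℂ} (hκ : κ.Finite) :
    ∃ t : Finset ℂ, (t : Set ℂ) ⊆ HH ∧ SBase j (κ ∪ jet j t) (sat t) := by
  classical
  let P : ℕ → Prop := fun m => ∃ t : Finset ℂ, (t : Set ℂ) ⊆ HH ∧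
    rk (κ ∪ jet j t) ≤ (m + 3 * (orbs t).ncard : ℕ)
  have hfin : ∀ t : Finset ℂ, (κ ∪ jet j t).Finite := fun t => hκ.union (jet_finite j t.finite_toSet)
  have hP : ∃ m, P m := by
    obtain ⟨m, hm⟩ := ENat.ne_top_iff_exists.1 (rk_ne_top (hfin ∅))
    exact ⟨m, ∅, by simp, by rw [← hm]; exact_mod_cast Nat.le_add_right _ _⟩
  obtain ⟨t, ht, hm⟩ := Nat.find_spec hP
  refine ⟨t, ht, hfin t, fun _ h => h.1, sat_grel, fun h => hj.sat_alg ht Set.subset_union_right h,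
    fun X hX hXX => ?_⟩
  have h2 := ncard_orbs_union_le ht hX hXX
  by_contra! hlt
  obtain ⟨a, ha⟩ := ENat.ne_top_iff_exists.1 (rk_ne_top (hfin t))
  have hU : κ ∪ jet j t ∪ jet j X = κ ∪ jet j ((t ∪ X : Finset ℂ) : Set ℂ) := by
    rw [Finset.coe_union, jet_union, Set.union_assoc]
  obtain ⟨b, hb⟩ := ENat.ne_top_iff_exists.1 (rk_ne_top (hfin (t ∪ X)))
  rw [hU, ← ha, ← hb] at hlt
  rw [← ha] at hm
  have hsub : ((t ∪ X : Finset ℂ) : Set ℂ) ⊆ HH := by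
    rw [Finset.coe_union]
    exact Set.union_subset ht fun x hx => (hX x hx).1
  have h3 := (hM.rk_jet (t ∪ X) hsub).trans (rk_mono (Set.subset_union_right (s := κ)))
  rw [← hb] at h3
  rw [← Finset.coe_union] at h2
  norm_cast at hlt hm h3
  have h4 := Nat.find_min' hP (m := b - 3 * (orbs ((t ∪ X : Finset ℂ) : Set ℂ)).ncard)
    ⟨t ∪ X, hsub, by rw [← hb]; norm_cast; omega⟩
  omega

end

section

open Polynomial

variable {j : ℂ → ℂ} {F S : Set ℂ} {z : ℕ → ℂ} {n : ℕ}

lemma GRel.mem_acl_insert {x y : ℂ} (h : GRel x y) (T : Set ℂ) : y ∈ acl (insert x T) :=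
  h.mem_acl (mem_acl_of_mem (Or.inl rfl))

/-- Along an orbit, the elements in new orbits form an independent initial segment. -/
lemma SBase.exists_initial (hB : SBase j F S) (hj : IsModularJ j) (hz : ∀ i < n, z i ∈ HH)
    (hstep : ∀ i < n, z (i + 1) = j (z i)) (hinj : ∀ i < n, ∀ k < n, z i = z k → i = k)
    (hlast : z n ∈ acl (F ∪ z '' Set.Iio n)) :
    ∃ k ≤ n, AIndOn F z (Set.Iio k) ∧ (∀ i < k, z i ∉ S) ∧
      ∀ m, k ≤ m → m < n → z m ∈ S ∨ ∃ i < k, GRel (z i) (z m) := by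
  classical
  let isRep : ℕ → Prop := fun i => z i ∉ S ∧ ∀ l < i, ¬ GRel (z l) (z i)
  let I : Finset ℕ := (Finset.range n).filter isRep
  have hI : ∀ i, i ∈ I ↔ i < n ∧ isRep i := fun i => by simp [I]
  have hspan : ∀ l < n, z l ∈ acl (F ∪ z '' {m | m ∈ I ∧ m ≤ l}) := by
    intro l
    induction l using Nat.strong_induction_on with
    | _ l ih =>
      intro hl
      by_cases hr : isRep l
      · exact mem_acl_of_mem (Or.inr ⟨l, ⟨(hI l).2 ⟨hl, hr⟩, le_rfl⟩, rfl⟩)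
      by_cases hS : z l ∈ S
      · exact acl_mono Set.subset_union_left (hB.alg hS).1
      obtain ⟨i, hi, h⟩ : ∃ i < l, GRel (z i) (z l) := by
        by_contra! h
        exact hr ⟨hS, h⟩
      refine h.mem_acl (acl_mono (Set.union_subset_union_right _ (Set.image_mono ?_))
        (ih i hi (hi.trans hl)))
      exact fun m hm => ⟨hm.1, hm.2.trans hi.le⟩
  have hspanI : ∀ l < n, z l ∈ acl (F ∪ z '' I) := fun l hl =>
    acl_mono (Set.union_subset_union_right _ (Set.image_mono fun m hm => hm.1)) (hspan l hl)
  have hX : rk F + (3 * I.card : ℕ) ≤ rk (F ∪ jet j (I.image z : Finset ℂ)) := by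
    have h := hB.ind (I.image z) (fun x hx => by
      obtain ⟨i, hi, rfl⟩ := Finset.mem_image.1 hx
      exact ⟨hz i ((hI i).1 hi).1, ((hI i).1 hi).2.1⟩) (fun x hx y hy hxy => by
      obtain ⟨a, ha, rfl⟩ := Finset.mem_image.1 hx
      obtain ⟨b, hb, rfl⟩ := Finset.mem_image.1 hy
      rcases lt_trichotomy a b with hab | rfl | hab
      · exact absurd hxy (((hI b).1 hb).2.2 a hab)
      · rfl
      · exact absurd (hxy.symm (hz a ((hI a).1 ha).1)) (((hI a).1 ha).2.2 b hab))
    rwa [Finset.card_image_of_injOn] at h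
    intro a ha b hb h
    exact hinj a ((hI a).1 ha).1 b ((hI b).1 hb).1 h
  have hA : rk F + I.card ≤ rk (F ∪ z '' Set.Iic n) := by
    have h1 : rk (F ∪ jet j (I.image z : Finset ℂ)) ≤
        rk (F ∪ z '' Set.Iic n) + ((2 * I.card : ℕ) : ℕ∞) := by
      refine (rk_mono ?_).trans ((rk_union_le (F ∪ z '' Set.Iic n) (deriv j '' (I.image z : Finset ℂ) ∪
        deriv (deriv j) '' (I.image z : Finset ℂ))).trans ?_)
      · rintro x (hx | ((hx | ⟨_, hx, rfl⟩) | hx) | hx)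
        · exact Or.inl (Or.inl hx)
        · obtain ⟨i, hi, rfl⟩ := Finset.mem_image.1 (Finset.mem_coe.1 hx)
          exact Or.inl (Or.inr ⟨i, ((hI i).1 hi).1.le, rfl⟩)
        · obtain ⟨i, hi, rfl⟩ := Finset.mem_image.1 (Finset.mem_coe.1 hx)
          exact Or.inl (Or.inr ⟨i + 1, ((hI i).1 hi).1, hstep i ((hI i).1 hi).1⟩)
        · exact Or.inr (Or.inl hx)
        · exact Or.inr (Or.inr hx)
      · gcongr
        have hc : (z '' (I : Set ℕ)).encard ≤ I.card :=
          (Set.encard_image_le _ _).trans (Set.encard_coe_eq_coe_finsetCard I).le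
        refine (Set.encard_union_le _ _).trans ?_
        push_cast
        rw [two_mul]
        exact add_le_add ((Set.encard_image_le _ _).trans hc) ((Set.encard_image_le _ _).trans hc)
    have h2 := hX.trans h1
    rw [show 3 * I.card = I.card + 2 * I.card by ring, Nat.cast_add, ← add_assoc] at h2
    exact (ENat.add_le_add_iff_right (ENat.natCast_ne_top _)).1 h2
  obtain ⟨-, hind⟩ := aIndOn_of_rank hB.finite (s := I) (z := z) (d := I.card) (by
    have hlast' : z n ∈ acl (F ∪ z '' I) := acl_le (Set.union_subset
      (Set.subset_union_left.trans (subset_acl _)) (by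
        rintro _ ⟨l, hl, rfl⟩; exact hspanI l hl)) hlast
    rintro _ ⟨l, hl, rfl⟩
    rcases (Set.mem_Iic.1 hl).lt_or_eq with hl | rfl
    · exact hspanI l hl
    · exact hlast') hA le_rfl
  have hk : ∃ k, k = n ∨ ¬ isRep k := ⟨n, Or.inl rfl⟩
  set k := Nat.find hk with hkdef
  have hkn : k ≤ n := Nat.find_min' hk (Or.inl rfl)
  have hlt : ∀ i < k, isRep i := fun i hi => by
    have := Nat.find_min hk hi
    push Not at this
    exact this.2
  have hge : ∀ m, k ≤ m → m < n → ¬ isRep m := by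
    intro m
    induction m with
    | zero =>
      intro h0 hn hr
      have := Nat.find_spec hk
      rw [← hkdef, Nat.le_zero.1 h0] at this
      exact this.elim (fun h => hn.ne h) fun h => h hr
    | succ m ih =>
      intro hkm hm hr
      rcases hkm.lt_or_eq with hkm | hkm
      swap
      · have := Nat.find_spec hk
        rw [← hkdef, hkm] at this
        exact this.elim (fun h => hm.ne h) fun h => h hr
      have hnr := ih (Nat.lt_succ_iff.1 hkm) (by omega)
      refine hind (m + 1) ((hI _).2 ⟨hm, hr⟩) ?_
      have hsub : ∀ l ≤ m, z l ∈ acl (F ∪ z '' ((I : Set ℕ) \ {m + 1})) := fun l hl =>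
        acl_mono (Set.union_subset_union_right _ (Set.image_mono fun a ha => by
          refine ⟨ha.1, fun h => ?_⟩
          have h1 := ha.2
          rw [Set.mem_singleton_iff] at h
          omega)) (hspan l (by omega))
      rw [hstep m (by omega)]
      by_cases hS : z m ∈ S
      · exact acl_mono Set.subset_union_left (hB.alg hS).2
      obtain ⟨i, hi, h⟩ : ∃ i < m, GRel (z i) (z m) := by
        by_contra! h
        exact hnr ⟨hS, h⟩
      refine h.j_mem_acl hj (hz i (by omega)) ?_
      rw [← hstep i (by omega)]
      exact hsub _ hi
  refine ⟨k, hkn, hind.mono fun i hi => (hI i).2 ⟨lt_of_lt_of_le hi hkn, hlt i hi⟩,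
    fun i hi => (hlt i hi).1, fun m => ?_⟩
  induction m using Nat.strong_induction_on with
  | _ m ih =>
    intro hkm hm
    by_cases hS : z m ∈ S
    · exact Or.inl hS
    obtain ⟨i, hi, h⟩ : ∃ i < m, GRel (z i) (z m) := by
      by_contra! h
      exact hge m hkm hm ⟨hS, h⟩
    by_cases hik : i < k
    · exact Or.inr ⟨i, hik, h⟩
    rcases ih i hi (not_lt.1 hik) (by omega) with h' | ⟨a, ha, h'⟩
    · exact absurd (hB.grel h' h) hS
    · exact Or.inr ⟨a, ha, h'.trans h (hz a (by omega))⟩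

end

section

open Polynomial

variable {j : ℂ → ℂ} {F S : Set ℂ} {z : ℕ → ℂ} {n : ℕ}

lemma AIndOn.notMem {ι : Type*} {T : Set ℂ} {v : ι → ℂ} {s : Set ι} (h : AIndOn T v s) {i : ι}
    (hi : i ∈ s) : v i ∉ acl T := fun h' => h i hi (acl_mono Set.subset_union_left h')

lemma AIndOn.eq_of_mem {ι : Type*} {T : Set ℂ} {v : ι → ℂ} {s : Set ι} (h : AIndOn T v s)
    {i e : ι} (hi : i ∈ s) (he : e ∈ s) (h' : v i ∈ acl (insert (v e) T)) : i = e := by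
  by_contra hie
  refine h i hi (acl_mono ?_ h')
  rintro x (rfl | hx)
  · exact Or.inr ⟨e, ⟨he, fun h => hie h.symm⟩, rfl⟩
  · exact Or.inl hx

lemma DegRel.mono {hj : IsModularJ j} {D D' : ℕ} (hD : D ≤ D') {x y : ℂ} (h : DegRel hj D x y) :
    DegRel hj D' x y := by
  obtain ⟨N, hN, h1, h2⟩ := h
  exact ⟨N, hN, h1.trans hD, h2⟩

/-- Beyond the independent initial segment, all points but the last lie in the saturated set. -/
lemma SBase.mem_of_initial (hB : SBase j F S) (hj : IsModularJ j) (hz : ∀ i < n, z i ∈ HH)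
    (hstep : ∀ i < n, z (i + 1) = j (z i)) (hinj : ∀ i < n, ∀ k < n, z i = z k → i = k)
    {k : ℕ} (hind : AIndOn F z (Set.Iio k))
    (hrel : ∀ m, k ≤ m → m < n → z m ∈ S ∨ ∃ i < k, GRel (z i) (z m)) :
    (∀ m, k ≤ m → m + 1 < n → z m ∈ S) ∧ (∀ m, k ≤ m → m + 1 < n → z m ∈ S → z (m + 1) ∈ S) := by
  have hacl : ∀ m, k ≤ m → m < n → z m ∈ acl F → z m ∈ S := by
    intro m hkm hm h
    refine (hrel m hkm hm).resolve_right ?_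
    rintro ⟨i, hi, h'⟩
    exact hind.notMem hi ((h'.symm (hz i (by omega))).mem_acl h)
  have hS : ∀ m, k ≤ m → m + 1 < n → z m ∈ S → z (m + 1) ∈ S := by
    intro m hkm hm h
    refine hacl _ (by omega) hm ?_
    rw [hstep m (by omega)]
    exact (hB.alg h).2
  refine ⟨fun m hkm hm => ?_, hS⟩
  by_contra hmS
  obtain ⟨i, hi, h⟩ := (hrel m hkm (by omega)).resolve_left hmS
  have hzi := hz i (by omega)
  have hzm := hz m (by omega)
  by_cases hS' : z (m + 1) ∈ S
  · have h1 : z (i + 1) ∈ acl F := by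
      rw [hstep i (by omega)]
      refine (h.symm hzi).j_mem_acl hj hzm ?_
      rw [← hstep m (by omega)]
      exact (hB.alg hS').1
    have hik : i + 1 = k := by
      by_contra hne
      exact hind.notMem (show i + 1 < k by omega) h1
    have h2 : z k ∈ S := hacl k le_rfl (by omega) (hik ▸ h1)
    have h3 : ∀ l, k ≤ l → l < n → z l ∈ S := by
      intro l hl
      induction l, hl using Nat.le_induction with
      | base => exact fun _ => h2
      | succ l hl ih => exact fun h => hS l hl h (ih (by omega))
    exact hmS (h3 m hkm (by omega))
  · obtain ⟨i', hi', h'⟩ := (hrel (m + 1) (by omega) hm).resolve_left hS'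
    have hzi' := hz i' (by omega)
    have hzm1 := hz (m + 1) hm
    have hzi1 := hz (i + 1) (by omega)
    have ham : z (m + 1) ∈ acl (insert (z (i + 1)) F) := by
      rw [hstep m (by omega)]
      refine h.j_mem_acl hj hzi ?_
      rw [← hstep i (by omega)]
      exact mem_acl_of_mem (Or.inl rfl)
    have hi1 : z (i + 1) ∉ acl F := by
      intro h0
      have : z (m + 1) ∈ acl F := acl_le (Set.insert_subset h0 (subset_acl F)) ham
      exact hS' (hacl _ (by omega) hm this)
    obtain ⟨e, he, hrel_e⟩ : ∃ e < k, GRel (z e) (z (i + 1)) := by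
      rcases lt_or_ge (i + 1) k with hlt | hge
      · exact ⟨i + 1, hlt, GRel.refl _⟩
      · exact (hrel (i + 1) hge (by omega)).resolve_left fun hs => hi1 (hB.alg hs).1
    have hze := hz e (by omega)
    have hee : i' = e := by
      refine hind.eq_of_mem hi' he ((h'.symm hzi').mem_acl ?_)
      exact acl_le (Set.insert_subset (hrel_e.mem_acl_insert F)
        ((Set.subset_insert _ _).trans (subset_acl _))) ham
    subst hee
    have hg : GRel (z (i + 1)) (z (m + 1)) := (hrel_e.symm hze).trans h' hzi1
    have heq : z (m + 1) = z (i + 1) := by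
      rw [hstep i (by omega)] at hg hi1 hzi1 ⊢
      rw [hstep m (by omega)] at hg ⊢
      exact hj.eq_of_GRel hzi h hi1 hzi1 hg
    have := hinj _ hm _ (by omega) heq
    omega

/-- A generic enough solution consists of independent points or of points of the saturated set. -/
theorem SBase.dichotomy (hB : SBase j F S) (hj : IsModularJ j) (hz : ∀ i < n, z i ∈ HH)
    (hstep : ∀ i < n, z (i + 1) = j (z i)) {f : MvPolynomial (Fin (n + 1)) ℂ}
    (hf : ∀ m, f.coeff m ∈ acl F) (h0 : MvPolynomial.eval (fun k : Fin (n + 1) => z k) f = 0)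
    (hlast : slice (Fin.last n) (fun k : Fin (n + 1) => z k) f ≠ 0)
    (hfirst : slice 0 (fun k : Fin (n + 1) => z k) f ≠ 0)
    (hinj : ∀ i < n, ∀ k < n, z i = z k → i = k)
    (hdeg : ∀ l, 1 ≤ l → l < n → ¬ DegRel hj f.totalDegree (z l) (z n)) :
    (∀ i < n, z i ∈ S) ∨ AIndOn F z (Set.Iio n) := by
  have hzn : z n ∈ acl (F ∪ z '' Set.Iio n) := by
    have := mem_acl_of_slice hf h0 hlast (U := F ∪ z '' Set.Iio n)
      (Set.subset_union_left.trans (subset_acl _)) fun k hk => mem_acl_of_mem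
        (Or.inr ⟨k, Fin.val_lt_last hk, rfl⟩)
    simpa using this
  obtain ⟨k, hkn, hind, hkS, hrel⟩ := hB.exists_initial hj hz hstep hinj hzn
  rcases hkn.eq_or_lt with rfl | hkn
  · exact Or.inr hind
  obtain ⟨hmS, hSS⟩ := hB.mem_of_initial hj hz hstep hinj hind hrel
  rcases Nat.eq_zero_or_pos k with rfl | hk
  · exact Or.inl fun i hi => (hrel i (Nat.zero_le i) hi).resolve_right fun ⟨_, h, _⟩ => by omega
  exfalso
  by_cases hn1 : z (n - 1) ∈ S
  · have hall : ∀ m, k ≤ m → m ≤ n → z m ∈ acl F := by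
      intro m hkm hm
      rcases lt_trichotomy (m + 1) n with h | h | h
      · exact (hB.alg (hmS m hkm h)).1
      · obtain rfl : m = n - 1 := by omega
        exact (hB.alg hn1).1
      · obtain rfl : m = n - 1 + 1 := by omega
        rw [hstep (n - 1) (by omega)]
        exact (hB.alg hn1).2
    have := mem_acl_of_slice hf h0 hfirst (U := F ∪ z '' (Set.Iio k \ {0}))
      (Set.subset_union_left.trans (subset_acl _)) fun l hl => by
        rcases lt_or_ge (l : ℕ) k with h | h
        · exact mem_acl_of_mem (Or.inr ⟨l, ⟨h, fun h' => hl (Fin.ext (Set.mem_singleton_iff.1 h'))⟩, rfl⟩)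
        · exact acl_mono Set.subset_union_left (hall l h (by omega))
    exact hind 0 hk (by simpa using this)
  obtain rfl : k = n - 1 := by
    by_contra hne
    have := hSS (n - 2) (by omega) (by omega) (hmS (n - 2) (by omega) (by omega))
    rw [show n - 2 + 1 = n - 1 by omega] at this
    exact hn1 this
  obtain ⟨i, hi, h⟩ := (hrel (n - 1) le_rfl (by omega)).resolve_left hn1
  have hzi := hz i (by omega)
  have hzn1 := hz (n - 1) (by omega)
  have hjn : j (z (n - 1)) = z n := by
    rw [← hstep (n - 1) (by omega)]; congr 1; omega
  have hji : j (z i) = z (i + 1) := (hstep i (by omega)).symm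
  -- The parameter transcendental over the remaining points.
  obtain ⟨e, he, hei, hT⟩ : ∃ e < n - 1, (∃ E : ℂ, E = z (i + 1) ∧ GRel E (z e)) ∧
      (i + 1 = e ∨ (i = e ∧ i + 1 = n - 1)) := by
    rcases lt_or_ge (i + 1) (n - 1) with hlt | hge
    · exact ⟨i + 1, hlt, ⟨_, rfl, GRel.refl _⟩, Or.inl rfl⟩
    · have : i + 1 = n - 1 := by omega
      exact ⟨i, hi, ⟨_, rfl, this ▸ h.symm hzi⟩, Or.inr ⟨rfl, this⟩⟩
  obtain ⟨_, rfl, hei⟩ := hei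
  obtain ⟨T, hTdef⟩ : ∃ T, T = F ∪ z '' (Set.Iio (n - 1) \ {e}) := ⟨_, rfl⟩
  have hFT : acl F ≤ acl T := acl_mono (hTdef ▸ Set.subset_union_left)
  have hx : z (i + 1) ∉ acl T := fun hx => hind e he (hTdef ▸ hei.mem_acl hx)
  have hmem : ∀ l < n - 1, l ≠ e → z l ∈ acl T := fun l hl hle =>
    mem_acl_of_mem (hTdef ▸ Or.inr ⟨l, ⟨hl, hle⟩, rfl⟩)
  obtain ⟨L, hL⟩ : ∃ L, L = IntermediateField.adjoin (acl T) {z (i + 1)} := ⟨_, rfl⟩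
  have hTL : ∀ x ∈ acl T, x ∈ L := fun x hx => L.algebraMap_mem (⟨x, hx⟩ : acl T)
  have hxL : z (i + 1) ∈ L := hL ▸ IntermediateField.mem_adjoin_simple_self _ _
  have hlL : ∀ l < n, z l ∈ L := by
    intro l hl
    by_cases hle : l = e
    · subst hle; exact hei.mem_subfield L.toSubfield hxL
    rcases lt_or_ge l (n - 1) with h' | h'
    · exact hTL _ (hmem l h' hle)
    · obtain rfl : l = n - 1 := by omega
      rcases hT with hT | ⟨-, hT⟩
      · exact h.mem_subfield L.toSubfield (hTL _ (hmem i hi (by omega)))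
      · rwa [hT] at hxL
  refine hdeg (i + 1) (by omega) (by omega) ?_
  rw [← hji, ← hjn]
  refine (hj.degRel_of_eval hzi h (hji ▸ hx) hlast (fun a => ?_) ?_).mono natDegree_slice_le
  · rw [hji, ← hL]
    exact coeff_slice_mem (F := L.toSubfield) (fun m => hTL _ (hFT (hf m)))
      (fun l hl => hlL l (Fin.val_lt_last hl)) a
  · rw [hjn]
    have := eval_slice_self (i := Fin.last n) (v := fun k : Fin (n + 1) => z k) (f := f)
    rw [h0] at this
    simpa using this

end

section

open MvPolynomial

lemma degreeOf_map_of_injective {σ R S : Type*} [CommSemiring R] [CommSemiring S] {φ : R →+* S}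
    (hφ : Function.Injective φ) (p : MvPolynomial σ R) (i : σ) :
    (p.map φ).degreeOf i = p.degreeOf i := by
  classical
  rw [degreeOf_eq_sup, degreeOf_eq_sup, support_map_of_injective p hφ]

lemma irreducible_of_map {σ K E : Type*} [DecidableEq σ] [Field K] [Field E] (φ : K →+* E)
    {p : MvPolynomial σ K}
    (h : Irreducible (p.map φ)) : Irreducible p := by
  have hu : ∀ a : MvPolynomial σ K, IsUnit (a.map φ) → IsUnit a := by
    intro a ha
    obtain ⟨r, hr, h⟩ := MvPolynomial.isUnit_iff_eq_C_of_isReduced.1 ha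
    have h2 : a = C (a.coeff 0) := by
      ext m
      have h3 := congrArg (coeff m) h
      rw [coeff_map, coeff_C] at h3
      rw [coeff_C]
      split_ifs at h3 ⊢ with hm
      · rw [hm]
      · exact (map_eq_zero φ).1 h3
    rw [h2]
    refine IsUnit.map C (isUnit_iff_ne_zero.2 fun h0 => ?_)
    rw [h2, h0] at ha
    simp at ha
  refine ⟨fun h' => h.not_isUnit (h'.map (MvPolynomial.map φ)), fun a b hab => ?_⟩
  rcases h.isUnit_or_isUnit (a := a.map φ) (b := b.map φ) (by rw [hab, map_mul]) with h | h
  · exact Or.inl (hu a h)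
  · exact Or.inr (hu b h)

lemma pderiv_eq_zero_of_degreeOf {σ R : Type*} [CommRing R] {p : MvPolynomial σ R} {i : σ}
    (h : p.degreeOf i = 0) : pderiv i p = 0 := by
  refine pderiv_eq_zero_of_notMem_vars fun hi => ?_
  rw [mem_vars_iff_mem_support] at hi
  obtain ⟨d, hd, hi⟩ := hi
  have := monomial_le_degreeOf i hd
  rw [h, Nat.le_zero] at this
  exact Finsupp.mem_support_iff.1 hi this

lemma eval₂_finSuccEquiv {n : ℕ} {L : Subfield ℂ} (v : Fin (n + 1) → ℂ)
    (f : MvPolynomial (Fin (n + 1)) L) :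
    (finSuccEquiv L n f).eval₂ (eval₂Hom L.subtype fun k : Fin n => v k.succ) (v 0)
      = eval v (f.map L.subtype) := by
  have : (Polynomial.eval₂RingHom (eval₂Hom L.subtype fun k : Fin n => v k.succ) (v 0)).comp
      (finSuccEquiv L n : MvPolynomial (Fin (n + 1)) L →+* _) =
      (eval v).comp (MvPolynomial.map L.subtype) := by
    refine MvPolynomial.ringHom_ext (fun a => ?_) fun k => ?_
    · have : finSuccEquiv L n (C a) = Polynomial.C (C a) := (finSuccEquiv L n).commutes a
      simp [this]
    · refine Fin.cases ?_ (fun k => ?_) k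
      · simp [finSuccEquiv_X_zero]
      · simp [finSuccEquiv_X_succ]
  exact congrArg (fun g => g f) this

variable {n : ℕ} {T : Set ℂ} {v : Fin (n + 1) → ℂ} {p f : MvPolynomial (Fin (n + 1)) ℂ}

lemma dvd_of_eval_zero (hp : Irreducible p) (hpT : ∀ m, p.coeff m ∈ acl T)
    (hd : p.degreeOf 0 ≠ 0) (hv : AIndOn T v {0}ᶜ) (h0 : eval v p = 0)
    (hf : ∀ m, f.coeff m ∈ acl T) (hf0 : eval v f = 0) : p ∣ f := by
  obtain ⟨p, rfl⟩ := exists_lift hpT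
  obtain ⟨f, rfl⟩ := exists_lift hf
  refine map_dvd (MvPolynomial.map (acl T).subtype) ?_
  rw [← eval₂_finSuccEquiv] at h0 hf0
  have h := dvd_of_common_root (eval₂Hom (acl T).subtype fun k : Fin n => v k.succ) ?_
    (P := finSuccEquiv (acl T) n p) (G := finSuccEquiv (acl T) n f) ?_ ?_ h0 hf0
  · exact (map_dvd_iff (finSuccEquiv (acl T) n)).1 h
  · have hi := (hv.algebraicIndependent le_rfl).comp
      (fun k : Fin n => (⟨k.succ, Fin.succ_ne_zero k⟩ : ({0}ᶜ : Set (Fin (n + 1)))))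
      (fun a b hab => Fin.succ_injective n (congrArg Subtype.val hab))
    exact hi
  · exact (MulEquiv.irreducible_iff (finSuccEquiv (acl T) n)).2 (irreducible_of_map _ hp)
  · rw [natDegree_finSuccEquiv]
    intro h
    refine hd ?_
    exact (degreeOf_map_of_injective (acl T).subtype.injective _ _).trans h

lemma dvd_of_eval_zero_last (hp : Irreducible p) (hpT : ∀ m, p.coeff m ∈ acl T)
    (hd : p.degreeOf (Fin.last n) ≠ 0) (hv : AIndOn T v {Fin.last n}ᶜ) (h0 : eval v p = 0)
    (hf : ∀ m, f.coeff m ∈ acl T) (hf0 : eval v f = 0) : p ∣ f := by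
  let e : Equiv.Perm (Fin (n + 1)) := Equiv.swap 0 (Fin.last n)
  have hee : ∀ k, e (e k) = k := fun k => Equiv.swap_apply_self _ _ k
  have hev : ∀ g : MvPolynomial (Fin (n + 1)) ℂ, eval (v ∘ e) (rename e g) = eval v g := by
    intro g
    rw [eval_rename]
    congr 2
    ext k
    simp [hee]
  have hco : ∀ g : MvPolynomial (Fin (n + 1)) ℂ, (∀ m, g.coeff m ∈ acl T) →
      ∀ m, (rename e g).coeff m ∈ acl T := by
    intro g hg m
    by_cases hm : (rename e g).coeff m = 0
    · rw [hm]; exact zero_mem _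
    · obtain ⟨u, rfl, -⟩ := coeff_rename_ne_zero e g m hm
      rw [coeff_rename_mapDomain e e.injective]
      exact hg u
  have h := dvd_of_eval_zero (p := rename e p) (f := rename e f) (v := v ∘ e)
    ((MulEquiv.irreducible_iff (renameEquiv ℂ e)).2 hp) (hco p hpT) ?_ ?_ ((hev p).trans h0)
    (hco f hf) ((hev f).trans hf0)
  · exact (map_dvd_iff (renameEquiv ℂ e)).1 h
  · rw [show (0 : Fin (n + 1)) = e (Fin.last n) by simp [e],
      degreeOf_rename_of_injective e.injective]
    exact hd
  · intro k hk hk'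
    refine hv (e k) (fun h => hk ?_) (acl_mono (Set.union_subset_union_right _ ?_) hk')
    · rw [Set.mem_singleton_iff] at h ⊢
      rw [← hee k, h]; simp [e]
    · rintro _ ⟨l, ⟨hl, hlk⟩, rfl⟩
      refine ⟨e l, ⟨fun h => hl ?_, fun h => hlk (e.injective h)⟩, rfl⟩
      rw [Set.mem_singleton_iff] at h ⊢
      rw [← hee l, h]; simp [e]

lemma aIndOn_of_algebraicIndependent {ι : Type*} {v : ι → ℂ} {s : Set ι}
    (h : AlgebraicIndependent (acl T) (fun i : s => v i)) : AIndOn T v s := by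
  intro k hk hk'
  refine h.transcendental_adjoin (s := {⟨k, hk⟩}ᶜ) (i := ⟨k, hk⟩) (by simp) ?_
  obtain ⟨B, hB⟩ : ∃ B, B = Algebra.adjoin (acl T) ((fun i : s => v i) '' {⟨k, hk⟩}ᶜ) := ⟨_, rfl⟩
  rw [← hB]
  have hle : ∀ x ∈ Algebra.adjoin ℚ (T ∪ v '' (s \ {k})), x ∈ B := by
    intro x hx
    induction hx using Algebra.adjoin_induction with
    | mem x hx =>
      rcases hx with hx | ⟨l, hl, rfl⟩
      · exact B.algebraMap_mem (⟨x, mem_acl_of_mem hx⟩ : acl T)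
      · rw [hB]
        exact Algebra.subset_adjoin ⟨⟨l, hl.1⟩, fun h => hl.2 (congrArg Subtype.val h), rfl⟩
    | algebraMap r =>
      exact B.algebraMap_mem (⟨(r : ℂ), SubfieldClass.ratCast_mem _ r⟩ : acl T)
    | add x y _ _ hx hy => exact add_mem hx hy
    | mul x y _ _ hx hy => exact mul_mem hx hy
  obtain ⟨P, hP, hPk⟩ := mem_acl.1 hk'
  let φ : Algebra.adjoin ℚ (T ∪ v '' (s \ {k})) →+* B :=
    (Subring.inclusion (S := (Algebra.adjoin ℚ (T ∪ v '' (s \ {k}))).toSubring)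
      (T := B.toSubring) hle)
  have hφ : Function.Injective φ := Subring.inclusion_injective _
  refine ⟨P.map φ, (Polynomial.map_ne_zero_iff hφ).2 hP, ?_⟩
  rw [Polynomial.aeval_def, Polynomial.eval₂_map]
  exact hPk

/-- A generic point of the hypersurface over its last projection is generic over the first one. -/
lemma AIndOn.zero_of_last (hp : Irreducible p) (hpT : ∀ m, p.coeff m ∈ acl T)
    (hd : p.degreeOf (Fin.last n) ≠ 0) (hd0 : p.degreeOf 0 ≠ 0) (hv : AIndOn T v {Fin.last n}ᶜ)
    (h0 : eval v p = 0) : AIndOn T v {0}ᶜ := by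
  refine aIndOn_of_algebraicIndependent (algebraicIndependent_iff.2 fun g hg => ?_)
  by_contra hg0
  let f : MvPolynomial (Fin (n + 1)) ℂ := rename Subtype.val (g.map (acl T).subtype)
  have hinj := Subtype.val_injective (p := fun x => x ∈ ({0}ᶜ : Set (Fin (n + 1))))
  have hgm : g.map (acl T).subtype ≠ 0 := fun h =>
    hg0 ((map_eq_zero_iff _ (map_injective _ (acl T).subtype.injective)).1 h)
  have hf0 : f ≠ 0 := fun h => hgm ((map_eq_zero_iff _ (rename_injective _ hinj)).1 h)
  have hdvd : p ∣ f := by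
    refine dvd_of_eval_zero_last hp hpT hd hv h0 (fun m => ?_) ?_
    · by_cases hm : f.coeff m = 0
      · rw [hm]; exact zero_mem _
      · obtain ⟨u, rfl, -⟩ := coeff_rename_ne_zero _ _ _ hm
        rw [coeff_rename_mapDomain _ hinj, coeff_map]
        exact (g.coeff u).2
    · rw [eval_rename, eval_map]
      exact hg
  obtain ⟨q, hq⟩ := hdvd
  have hdeg : f.degreeOf 0 = 0 := by
    rw [← Nat.le_zero, degreeOf_le_iff]
    intro m hm
    refine Nat.le_zero.2 ?_
    obtain ⟨u, rfl, -⟩ := coeff_rename_ne_zero _ _ _ (mem_support_iff.1 hm)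
    refine Finsupp.mapDomain_of_notMem_range _ _ ?_
    simp
  rw [hq, degreeOf_mul_eq (fun h => hp.ne_zero h) (fun h => hf0 (by rw [hq, h, mul_zero]))] at hdeg
  omega

end

section

open Filter Topology

lemma exists_generic_reals {A T : Set ℂ} (hA : A.Countable) (hT : T.Countable) :
    ∃ r : ℕ → ℝ, (∀ i, (r i : ℂ) ∉ A) ∧ ∀ n, AIndOn T (fun i => (r i : ℂ)) (Set.Iio n) := by
  have key : ∀ U : {U : Set ℂ // U.Countable}, ∃ x : ℝ, (x : ℂ) ∉ A ∪ (acl U.1 : Set ℂ) := by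
    rintro ⟨U, hU⟩
    have h1 : (Complex.ofReal ⁻¹' (A ∪ (acl U : Set ℂ))).Countable :=
      (hA.union (countable_acl hU)).preimage Complex.ofReal_injective
    obtain ⟨x, hx⟩ := (h1.dense_compl ℝ).nonempty
    exact ⟨x, hx⟩
  choose pick hpick using key
  let st : ℕ → {U : Set ℂ // U.Countable} := fun n =>
    Nat.rec ⟨T, hT⟩ (fun _ U => ⟨insert (pick U : ℂ) U.1, U.2.insert _⟩) n
  have hst : ∀ n, (st (n + 1)).1 = insert (pick (st n) : ℂ) (st n).1 := fun n => rfl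
  have hsub : ∀ n, T ∪ (fun i => (pick (st i) : ℂ)) '' Set.Iio n ⊆ (st n).1 := by
    intro n
    induction n with
    | zero => simp [st]
    | succ n ih =>
      rw [hst]
      rintro x (hx | ⟨i, hi, rfl⟩)
      · exact Or.inr (ih (Or.inl hx))
      · rcases (Nat.lt_succ_iff_lt_or_eq.1 hi) with hi | rfl
        · exact Or.inr (ih (Or.inr ⟨i, hi, rfl⟩))
        · exact Or.inl rfl
  refine ⟨fun n => pick (st n), fun i hi => hpick (st i) (Or.inl hi), fun n => ?_⟩
  induction n with
  | zero => intro k hk; exact absurd hk (by simp)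
  | succ n ih =>
    have h := ih.insert_of_notMem (k := n) (fun h => hpick (st n) (Or.inr (acl_mono (hsub n) h)))
    refine h.mono fun x hx => ?_
    rcases (Nat.lt_succ_iff_lt_or_eq.1 hx) with hi | rfl
    · exact Or.inr hi
    · exact Or.inl rfl

variable {n : ℕ} {T : Set ℂ} {r : ℕ → ℂ} {y : ℂ} {p f : MvPolynomial (Fin (n + 1)) ℂ}
  {v : Fin (n + 1) → ℂ} {j : ℂ → ℂ}

lemma aIndOn_pt (h : AIndOn T r (Set.Iio n)) : AIndOn T (pt n r y) {Fin.last n}ᶜ := by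
  have hlt : ∀ k : Fin (n + 1), k ∈ ({Fin.last n}ᶜ : Set (Fin (n + 1))) → (k : ℕ) < n := by
    intro k hk
    have : k ≠ Fin.last n := hk
    have h1 := k.2
    have h2 : (k : ℕ) ≠ n := fun h => this (Fin.ext h)
    omega
  intro k hk hk'
  refine h k (hlt k hk) (acl_mono (Set.union_subset_union_right _ ?_)
    (by simpa [pt, hlt k hk] using hk'))
  rintro _ ⟨l, ⟨hl, hlk⟩, rfl⟩
  refine ⟨l, ⟨hlt l hl, fun h => hlk (Fin.ext h)⟩, ?_⟩
  simp [pt, hlt l hl]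

lemma derivative_slice (i : Fin (n + 1)) (v : Fin (n + 1) → ℂ)
    (f : MvPolynomial (Fin (n + 1)) ℂ) :
    (slice i v f).derivative = slice i v (MvPolynomial.pderiv i f) := by
  unfold slice
  induction f using MvPolynomial.induction_on with
  | C a => simp
  | add f g hf hg => simp [hf, hg]
  | mul_X f k hf =>
    rw [map_mul, Polynomial.derivative_mul, hf, Derivation.leibniz, MvPolynomial.pderiv_X]
    by_cases hk : k = i
    · subst hk
      simp
      ring
    · simp [hk]
      ring

lemma exists_root_of_aIndOn (hT : T.Countable) (h : AIndOn T v {Fin.last n}ᶜ)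
    (hp : ∀ m, p.coeff m ∈ acl T) (hd : MvPolynomial.pderiv (Fin.last n) p ≠ 0) :
    ∃ y, MvPolynomial.eval (Function.update v (Fin.last n) y) p = 0 := by
  have h1 : slice (Fin.last n) v (MvPolynomial.pderiv (Fin.last n) p) ≠ 0 := by
    refine slice_ne_zero_of_aIndOn hT h hd fun m => ?_
    rw [MvPolynomial.coeff_pderiv]
    exact mul_mem (hp _) (by exact_mod_cast natCast_mem (acl T) (m (Fin.last n) + 1))
  rw [← derivative_slice] at h1
  have h2 : (slice (Fin.last n) v p).degree ≠ 0 := by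
    intro h
    rw [Polynomial.eq_C_of_degree_eq_zero h, Polynomial.derivative_C] at h1
    exact h1 rfl
  obtain ⟨y, hy⟩ := IsAlgClosed.exists_root _ h2
  exact ⟨y, by rw [← eval_slice]; exact hy⟩

lemma DegRel.mem_acl {hj : IsModularJ j} {D : ℕ} {x y : ℂ} (h : DegRel hj D x y) (hx : x ∈ acl T) :
    y ∈ acl T := by
  obtain ⟨N, hN, -, h⟩ := h
  refine acl_root ((modPoly_monic hj hN).map _).ne_zero (fun k => ?_) h
  rw [Polynomial.coeff_map]
  exact poly_coeff_mem_acl hx _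

lemma isClosed_degRel (hj : IsModularJ j) (D : ℕ) :
    IsClosed {w : ℂ × ℂ | DegRel hj D w.1 w.2} := by
  have : {w : ℂ × ℂ | DegRel hj D w.1 w.2} = ⋃ N ∈ Finset.Iic D, {w | ∃ h : 0 < N,
      ((modPoly hj h).map (Polynomial.eval₂RingHom Zbar.subtype w.1)).eval w.2 = 0} := by
    ext w
    simp only [DegRel, Set.mem_ofPred_eq, Set.mem_iUnion, Finset.mem_Iic]
    exact ⟨fun ⟨N, h, hN, e⟩ => ⟨N, hN, h, e⟩, fun ⟨N, hN, h, e⟩ => ⟨N, h, hN, e⟩⟩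
  rw [this]
  refine Set.Finite.isClosed_biUnion (Finset.finite_toSet _) fun N _ => ?_
  by_cases h : 0 < N
  · simp only [h, exists_true_left]
    refine isClosed_eq ?_ continuous_const
    simp only [Polynomial.eval_map, Polynomial.eval₂_eq_sum_range, Polynomial.coe_eval₂RingHom]
    fun_prop
  · simp [h]

lemma eventually_not_degRel (hj : IsModularJ j) (D : ℕ) {X : Type*} [TopologicalSpace X]
    {a b : X → ℂ} (ha : Continuous a) (hb : Continuous b) {x : X} (h : ¬DegRel hj D (a x) (b x)) :
    ∀ᶠ w in 𝓝 x, ¬DegRel hj D (a w) (b w) :=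
  (((isClosed_degRel hj D).preimage (ha.prodMk hb)).isOpen_compl.mem_nhds h)

/-- The open conditions satisfied by a generic point of the hypersurface. -/
lemma eventually_of_generic (hj : IsModularJ j) (hT : T.Countable)
    (hv : AIndOn T v {Fin.last n}ᶜ) (hv0 : AIndOn T v {0}ᶜ) (hf0 : f ≠ 0)
    (hf : ∀ m, f.coeff m ∈ acl T) (D : ℕ) :
    ∀ᶠ w in 𝓝 v, slice (Fin.last n) w f ≠ 0 ∧ slice 0 w f ≠ 0 ∧
      (∀ i, i ≠ Fin.last n → ∀ k, k ≠ Fin.last n → w i = w k → i = k) ∧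
      ∀ l, l ≠ 0 → l ≠ Fin.last n → ¬DegRel hj D (w l) (w (Fin.last n)) := by
  refine Filter.Eventually.and ((isOpen_slice_ne_zero _ f).mem_nhds
    (slice_ne_zero_of_aIndOn hT hv hf0 hf)) (Filter.Eventually.and
    ((isOpen_slice_ne_zero _ f).mem_nhds (slice_ne_zero_of_aIndOn hT hv0 hf0 hf))
    (Filter.Eventually.and ?_ ?_))
  · refine eventually_all.2 fun i => eventually_all.2 fun hi => eventually_all.2 fun k =>
      eventually_all.2 fun hk => ?_
    by_cases hik : i = k
    · exact Eventually.of_forall fun _ _ => hik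
    · have : v i ≠ v k := fun h => hik (hv.eq_of_mem hi hk
        (h ▸ mem_acl_of_mem (Set.mem_insert _ _)))
      filter_upwards [((continuous_apply i).continuousAt.ne_iff_eventually_ne
        (continuous_apply k).continuousAt).1 this] with w hw h
      exact absurd h hw
  · refine eventually_all.2 fun l => eventually_all.2 fun hl => eventually_all.2 fun hl' => ?_
    refine eventually_not_degRel hj D (continuous_apply l) (continuous_apply (Fin.last n)) fun h => ?_
    have h0 : Fin.last n ≠ 0 := by
      intro h0
      exact hl (Fin.ext (by have h1 := congrArg Fin.val h0; have h2 := l.2; simp at h1 ⊢; omega))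
    exact hl' (hv0.eq_of_mem (i := Fin.last n) (e := l) h0 hl
      (DegRel.mem_acl h (mem_acl_of_mem (Set.mem_insert _ _)))).symm

end

section

open Filter Topology IntermediateField

lemma exists_exchange {F : Set ℂ} (hF : F.Finite) {x : ℂ} (hx : x ∉ acl ∅) :
    ∃ T, x ∉ acl T ∧ F ⊆ acl (insert x T) := by
  have hfin : {T | T ⊆ F ∧ x ∉ acl T}.Finite := hF.finite_subsets.subset fun T hT => hT.1
  obtain ⟨T, hT⟩ := hfin.exists_maximal ⟨∅, Set.empty_subset F, hx⟩
  refine ⟨T, hT.prop.2, fun f hf => ?_⟩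
  by_contra hfT
  have h : x ∈ acl (insert f T) := by
    by_contra h
    have := hT.le_of_ge (y := insert f T) ⟨Set.insert_subset hf hT.prop.1, h⟩ (Set.subset_insert _ _)
    exact hfT (mem_acl_of_mem (Or.inr (this (Set.mem_insert _ _))))
  exact hfT (acl_exchange h hT.prop.2)

lemma isAlgebraic_of_mem_acl_insert {T : Set ℂ} {x y : ℂ} (hy : y ∈ acl (insert x T)) :
    IsAlgebraic (adjoin (acl T) {x}) y := by
  obtain ⟨P, hP, hPy⟩ := mem_acl.1 hy
  have hle : ∀ a ∈ Algebra.adjoin ℚ (insert x T), a ∈ (adjoin (acl T) {x}) := by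
    intro a ha
    induction ha using Algebra.adjoin_induction with
    | mem a ha =>
      rcases ha with rfl | ha
      · exact mem_adjoin_simple_self _ _
      · exact (adjoin (acl T) {x}).algebraMap_mem (⟨a, mem_acl_of_mem ha⟩ : acl T)
    | algebraMap r => exact SubfieldClass.ratCast_mem _ r
    | add a b _ _ ha hb => exact add_mem ha hb
    | mul a b _ _ ha hb => exact mul_mem ha hb
  let φ : Algebra.adjoin ℚ (insert x T) →+* adjoin (acl T) {x} :=
    Subring.inclusion (S := (Algebra.adjoin ℚ (insert x T)).toSubring)
      (T := (adjoin (acl T) {x}).toSubfield.toSubring) hle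
  refine ⟨P.map φ, (Polynomial.map_ne_zero_iff (Subring.inclusion_injective _)).2 hP, ?_⟩
  rw [Polynomial.aeval_def, Polynomial.eval₂_map]
  exact hPy

lemma minpoly_natDegree_le_mul {M : Type*} [Field M] [Algebra M ℂ] (E : IntermediateField M ℂ)
    [FiniteDimensional M E] {q₀ : Polynomial ℂ} (hq : q₀ ≠ 0) (hc : ∀ n, q₀.coeff n ∈ E) {y : ℂ}
    (hy : q₀.eval y = 0) :
    IsIntegral M y ∧ (minpoly M y).natDegree ≤ Module.finrank M E * q₀.natDegree := by
  obtain ⟨q, rfl⟩ : ∃ q : Polynomial E, q.map (algebraMap E ℂ) = q₀ := by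
    have : q₀ ∈ Polynomial.lifts (algebraMap E ℂ) :=
      (Polynomial.lifts_iff_coeff_lifts _).2 fun n => ⟨⟨_, hc n⟩, rfl⟩
    exact this
  have hq0 : q ≠ 0 := fun h => hq (by rw [h, Polynomial.map_zero])
  have hqy : Polynomial.aeval y q = 0 := by rwa [Polynomial.eval_map] at hy
  have hyE : IsIntegral E y := isAlgebraic_iff_isIntegral.1 ⟨q, hq0, hqy⟩
  have : FiniteDimensional E E⟮y⟯ := adjoin.finiteDimensional hyE
  have : FiniteDimensional M E⟮y⟯ := FiniteDimensional.trans M E E⟮y⟯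
  have : IsScalarTower M E⟮y⟯ ℂ := IsScalarTower.of_algebraMap_eq fun _ => rfl
  have h1 := minpoly.natDegree_le (A := M) (AdjoinSimple.gen E y)
  have h2 : minpoly M (AdjoinSimple.gen E y) = minpoly M y := by
    rw [← minpoly.algebraMap_eq (algebraMap E⟮y⟯ ℂ).injective]
    rfl
  have h3 : IsIntegral M y := by
    have := Algebra.IsIntegral.isIntegral (R := M) (AdjoinSimple.gen E y)
    exact this.algebraMap (B := ℂ)
  refine ⟨h3, ?_⟩
  rw [h2, ← Module.finrank_mul_finrank M E E⟮y⟯, adjoin.finrank hyE] at h1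
  refine h1.trans (Nat.mul_le_mul_left _ ?_)
  rw [Polynomial.natDegree_map]
  exact Polynomial.natDegree_le_of_dvd (minpoly.dvd E y hqy) hq0

lemma exists_degree_bound {F : Set ℂ} (hF : F.Finite) {x : ℂ} (hx : x ∉ acl ∅) :
    ∃ (T : Set ℂ) (D : ℕ) (E : Subfield ℂ), x ∉ acl T ∧ F ⊆ E ∧ acl T ≤ E ∧
      ∀ q₀ : Polynomial ℂ, q₀ ≠ 0 → (∀ n, q₀.coeff n ∈ E) → ∀ y, q₀.eval y = 0 →
        ∃ q : Polynomial ℂ, q ≠ 0 ∧ (∀ n, q.coeff n ∈ adjoin (acl T) {x}) ∧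
          q.natDegree ≤ D * q₀.natDegree ∧ q.eval y = 0 := by
  obtain ⟨T, hT, hFT⟩ := exists_exchange hF hx
  have hIntegral : ∀ f ∈ F, IsIntegral (adjoin (acl T) {x}) f := fun f hf =>
    isAlgebraic_iff_isIntegral.1 (isAlgebraic_of_mem_acl_insert (hFT hf))
  let E := adjoin (adjoin (acl T) {x}) F
  have : Finite F := hF
  have : FiniteDimensional (adjoin (acl T) {x}) E := finiteDimensional_adjoin hIntegral
  refine ⟨T, Module.finrank (adjoin (acl T) {x}) E, E.toSubfield, hT, subset_adjoin _ _, ?_, ?_⟩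
  · intro a ha
    exact E.algebraMap_mem (⟨a, (adjoin (acl T) {x}).algebraMap_mem ⟨a, ha⟩⟩ : adjoin (acl T) {x})
  · intro q₀ hq hc y hy
    obtain ⟨h1, h2⟩ := minpoly_natDegree_le_mul E hq hc hy
    refine ⟨(minpoly (adjoin (acl T) {x}) y).map (algebraMap _ ℂ),
      (Polynomial.map_ne_zero_iff (algebraMap (adjoin (acl T) {x}) ℂ).injective).2
        (minpoly.ne_zero h1), fun k => ?_, ?_, ?_⟩
    · rw [Polynomial.coeff_map]; exact ((minpoly (adjoin (acl T) {x}) y).coeff k).2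
    · rwa [Polynomial.natDegree_map]
    · rw [Polynomial.eval_map]; exact minpoly.aeval _ y

lemma IsModularJ.exists_degRel {j : ℂ → ℂ} (hj : IsModularJ j) {n : ℕ}
    {p : MvPolynomial (Fin (n + 1)) ℂ} {F t : Set ℂ} (hF : F.Finite) (htF : t ⊆ F)
    (hpF : (p.coeffs : Set ℂ) ⊆ F) {c : ℂ} (hc : c ∈ HH) (hjc : j c ∉ acl ∅) :
    ∃ D, ∀ v : Fin (n + 1) → ℂ, (∀ k, k ≠ Fin.last n → v k ∈ sat t) →
      slice (Fin.last n) v p ≠ 0 → MvPolynomial.eval v p = 0 → ∀ w, GRel c w →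
      v (Fin.last n) = j w → DegRel hj D (j c) (v (Fin.last n)) := by
  obtain ⟨T, D, E, hT, hFE, hTE, h⟩ := exists_degree_bound hF hjc
  refine ⟨D * p.totalDegree, fun v hv hs h0 w hw hvw => ?_⟩
  have hvE : ∀ k, k ≠ Fin.last n → v k ∈ E := by
    intro k hk
    obtain ⟨hvk, b, hb, hgr⟩ := hv k hk
    have hb' : GRel b (v k) := hgr.symm hvk
    rcases hb with hb | hb
    · exact hTE (hb'.mem_acl (mem_acl_of_mem_SigmaSet hb T))
    · exact hb'.mem_subfield E (hFE (htF hb))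
  have hpE : ∀ m, p.coeff m ∈ E := by
    intro m
    by_cases hm : p.coeff m = 0
    · rw [hm]; exact zero_mem _
    · exact hFE (hpF (MvPolynomial.coeff_mem_coeffs m hm))
  obtain ⟨q, hq, hqc, hqd, hq0⟩ := h _ hs (coeff_slice_mem hpE hvE) (v (Fin.last n))
    (by rw [eval_slice_self, h0])
  rw [hvw] at hq0 ⊢
  refine (hj.degRel_of_eval hc hw hT hq hqc hq0).mono ?_
  exact hqd.trans (Nat.mul_le_mul_left _ natDegree_slice_le)

end

section

open Filter Topology Polynomial

variable {n : ℕ} {T : Set ℂ} {v : Fin (n + 1) → ℂ} {f : MvPolynomial (Fin (n + 1)) ℂ}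

lemma iterate_derivative_slice (i : Fin (n + 1)) (v : Fin (n + 1) → ℂ)
    (f : MvPolynomial (Fin (n + 1)) ℂ) (d : ℕ) :
    derivative^[d] (slice i v f) = slice i v ((MvPolynomial.pderiv i)^[d] f) := by
  induction d generalizing f with
  | zero => rfl
  | succ d ih => rw [Function.iterate_succ_apply, derivative_slice, ih, Function.iterate_succ_apply]

lemma eq_zero_of_forall_slice {i : Fin (n + 1)} (h : ∀ v, slice i v f = 0) : f = 0 :=
  MvPolynomial.funext fun v => by rw [← eval_slice_self (i := i), h]; simp

lemma coeff_pderiv_mem {F : Subfield ℂ} (hf : ∀ m, f.coeff m ∈ F) (i : Fin (n + 1)) (d : ℕ) :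
    ∀ m, ((MvPolynomial.pderiv i)^[d] f).coeff m ∈ F := by
  induction d generalizing f with
  | zero => exact hf
  | succ d ih =>
    rw [Function.iterate_succ_apply]
    refine ih fun m => ?_
    rw [MvPolynomial.coeff_pderiv]
    exact mul_mem (hf _) (by exact_mod_cast natCast_mem F (m i + 1))

lemma coeff_slice_eq (i : Fin (n + 1)) (v : Fin (n + 1) → ℂ) (f : MvPolynomial (Fin (n + 1)) ℂ)
    (d : ℕ) : (slice i v f).coeff d =
      MvPolynomial.eval (Function.update v i 0) ((MvPolynomial.pderiv i)^[d] f) / d.factorial := by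
  rw [← eval_slice, ← iterate_derivative_slice, ← coeff_zero_eq_eval_zero, coeff_iterate_derivative]
  simp [Nat.descFactorial_self, mul_div_cancel_left₀, Nat.factorial_ne_zero]

lemma continuous_coeff_slice (i : Fin (n + 1)) (f : MvPolynomial (Fin (n + 1)) ℂ) (d : ℕ) :
    Continuous fun v => (slice i v f).coeff d := by
  simp only [coeff_slice_eq]
  exact ((MvPolynomial.continuous_eval _).comp
    (continuous_id.update i continuous_const)).div_const _

lemma exists_root_bound {i : Fin (n + 1)} (hT : T.Countable) (hv : AIndOn T v {i}ᶜ) (hf0 : f ≠ 0)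
    (hf : ∀ m, f.coeff m ∈ acl T) :
    ∃ B : ℝ, ∀ᶠ w in 𝓝 v, ∀ y, (slice i w f).eval y = 0 → ‖y‖ ≤ B := by
  have hex : ∃ d, (MvPolynomial.pderiv i)^[d] f = 0 := by
    refine ⟨f.totalDegree + 1, eq_zero_of_forall_slice (i := i) fun w => ?_⟩
    rw [← iterate_derivative_slice]
    exact iterate_derivative_eq_zero (Nat.lt_succ_of_le natDegree_slice_le)
  classical
  obtain ⟨d, hd⟩ : ∃ d, Nat.find hex = d + 1 := by
    refine Nat.exists_eq_succ_of_ne_zero fun h => hf0 ?_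
    have := Nat.find_spec hex
    rwa [h] at this
  have h1 : (MvPolynomial.pderiv i)^[d] f ≠ 0 := Nat.find_min hex (by omega)
  have h2 : (MvPolynomial.pderiv i)^[d + 1] f = 0 := hd ▸ Nat.find_spec hex
  have hle : ∀ w, (slice i w f).natDegree ≤ d := by
    intro w
    rw [natDegree_le_iff_coeff_eq_zero]
    intro k hk
    rw [coeff_slice_eq]
    obtain ⟨e, rfl⟩ := Nat.exists_eq_add_of_lt hk
    rw [show d + e + 1 = e + (d + 1) by ring, Function.iterate_add_apply, h2]
    have : (MvPolynomial.pderiv i)^[e] (0 : MvPolynomial (Fin (n + 1)) ℂ) = 0 := by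
      exact iterate_map_zero (MvPolynomial.pderiv (R := ℂ) i) e
    simp [this]
  have hne : (slice i v f).coeff d ≠ 0 := by
    intro h
    refine slice_ne_zero_of_aIndOn hT hv h1 (coeff_pderiv_mem hf i d) ?_
    rw [← iterate_derivative_slice]
    ext k
    rw [coeff_iterate_derivative, coeff_zero]
    rcases Nat.eq_zero_or_pos k with rfl | hk
    · rw [Nat.zero_add, h, smul_zero]
    · rw [coeff_eq_zero_of_natDegree_lt ((hle v).trans_lt (by omega)), smul_zero]
  obtain ⟨C, hC⟩ : ∃ C : ℝ, ∀ k ∈ Finset.range d,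
      ‖(slice i v f).coeff k‖ / ‖(slice i v f).coeff d‖ < C :=
    ⟨(∑ k ∈ Finset.range d, ‖(slice i v f).coeff k‖ / ‖(slice i v f).coeff d‖) + 1, fun k hk =>
      lt_of_le_of_lt (Finset.single_le_sum (f := fun k =>
        ‖(slice i v f).coeff k‖ / ‖(slice i v f).coeff d‖) (fun _ _ => by positivity) hk)
        (lt_add_one _)⟩
  have hev : ∀ᶠ w in 𝓝 v, ∀ k ∈ Finset.range d,
      ‖(slice i w f).coeff k‖ / ‖(slice i w f).coeff d‖ < C := by
    rw [Finset.eventually_all]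
    intro k hk
    have hcont : ContinuousAt (fun w => ‖(slice i w f).coeff k‖ / ‖(slice i w f).coeff d‖) v :=
      ((continuous_coeff_slice i f k).norm.continuousAt).div
        ((continuous_coeff_slice i f d).norm.continuousAt) (norm_ne_zero_iff.2 hne)
    exact hcont.eventually_lt continuousAt_const (hC k hk)
  refine ⟨max C 0 + 1, ?_⟩
  filter_upwards [hev, (continuous_coeff_slice i f d).continuousAt.eventually_ne hne] with w hw hd y hy
  have hdeg : (slice i w f).natDegree = d := le_antisymm (hle w) (le_natDegree_of_ne_zero hd)
  have hlt := IsRoot.norm_lt_cauchyBound (p := slice i w f)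
    (fun h => hd (by rw [h, coeff_zero])) (a := y) hy
  rw [cauchyBound, hdeg, leadingCoeff, hdeg] at hlt
  have hC0 : ((Finset.range d).sup fun k => ‖(slice i w f).coeff k‖₊) /
      ‖(slice i w f).coeff d‖₊ ≤ (max C 0).toNNReal := by
    have hpos : 0 < ‖(slice i w f).coeff d‖₊ := nnnorm_pos.2 hd
    rw [div_le_iff₀ hpos, Finset.sup_le_iff]
    intro k hk
    rw [← div_le_iff₀ hpos, ← NNReal.coe_le_coe, Real.coe_toNNReal _ (le_max_right _ _)]
    exact (hw k hk).le.trans (le_max_left _ _)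
  refine (NNReal.coe_le_coe.2 hlt.le).trans ?_
  rw [NNReal.coe_add, NNReal.coe_one]
  refine add_le_add_left ?_ 1
  rw [← NNReal.coe_le_coe, Real.coe_toNNReal _ (le_max_right _ _)] at hC0
  exact hC0

lemma finite_isIntegral_le (d : ℕ) (B : ℝ) :
    {y : ℂ | IsIntegral ℤ y ∧ (minpoly ℤ y).natDegree ≤ d ∧
      ∀ y' : ℂ, aeval y' (minpoly ℤ y) = 0 → ‖y'‖ ≤ B}.Finite := by
  classical
  let C : ℤ := ⌈max B 1 ^ d * d.choose (d / 2)⌉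
  refine (bUnion_roots_finite (algebraMap ℤ ℂ) d (Set.finite_Icc (-C) C)).subset ?_
  rintro y ⟨hy, hd, hB⟩
  rw [Set.mem_iUnion₂]
  have hm := minpoly.monic hy
  refine ⟨minpoly ℤ y, ⟨hd, fun k => ?_⟩, ?_⟩
  · have h := coeff_bdd_of_roots_le (algebraMap ℤ ℂ) hm (IsAlgClosed.splits _) hd (B := B)
      (fun z hz => hB z (by
        have := (mem_roots'.1 hz).2
        rwa [IsRoot, eval_map] at this)) k
    rw [coeff_map] at h
    have h1 : |((minpoly ℤ y).coeff k : ℝ)| ≤ max B 1 ^ d * d.choose (d / 2) := by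
      simpa using h
    have h2 : |((minpoly ℤ y).coeff k : ℝ)| ≤ C := h1.trans (Int.le_ceil _)
    rw [Set.mem_Icc, ← abs_le]
    exact_mod_cast h2
  · rw [Finset.mem_coe, Multiset.mem_toFinset, mem_roots (hm.map _).ne_zero, IsRoot, eval_map]
    exact minpoly.aeval _ _

end

section

open Filter Topology Polynomial

variable {n : ℕ} {j : ℂ → ℂ}

lemma mem_SigmaSet_of_mem_sat_empty {z : ℂ} (hz : z ∈ sat ∅) : z ∈ SigmaSet := by
  obtain ⟨hz, c, hc, h⟩ := hz
  rw [Set.union_empty] at hc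
  have hci : IsIntegral ℚ c := by
    by_contra h
    have := hc.2
    rw [minpoly.eq_zero h] at this
    simp at this
  have hzc : z ∈ IntermediateField.adjoin ℚ {c} :=
    (h.symm hz).mem_subfield _ (IntermediateField.mem_adjoin_simple_self ℚ c)
  have hcz : c ∈ IntermediateField.adjoin ℚ {z} :=
    h.mem_subfield _ (IntermediateField.mem_adjoin_simple_self ℚ z)
  have heq : IntermediateField.adjoin ℚ {z} = IntermediateField.adjoin ℚ {c} :=
    le_antisymm (IntermediateField.adjoin_simple_le_iff.2 hzc)
      (IntermediateField.adjoin_simple_le_iff.2 hcz)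
  have hzi : IsIntegral ℚ z := by
    have := IntermediateField.adjoin.finiteDimensional hci
    exact (Algebra.IsIntegral.isIntegral (R := ℚ)
      (⟨z, hzc⟩ : IntermediateField.adjoin ℚ {c})).map (IntermediateField.val _)
  refine ⟨hz, ?_⟩
  rw [← IntermediateField.adjoin.finrank hzi, heq, IntermediateField.adjoin.finrank hci]
  exact hc.2

lemma root_minpoly_of_mem_SigmaSet {z w : ℂ} (hz : z ∈ SigmaSet) (hw : aeval w (minpoly ℚ z) = 0) :
    w = z ∨ w = starRingEnd ℂ z := by
  by_contra! hne
  have hi : IsIntegral ℚ z := by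
    by_contra h
    have := hz.2
    rw [minpoly.eq_zero h] at this
    simp at this
  have hzz : z ≠ starRingEnd ℂ z := fun h => by
    have h1 := Complex.conj_eq_iff_im.1 h.symm
    have h2 : 0 < z.im := hz.1
    exact h2.ne' h1
  have hconj : aeval (starRingEnd ℂ z) (minpoly ℚ z) = 0 := by
    have h := (Polynomial.aeval_algHom_apply ((Complex.conjAe : ℂ →ₐ[ℝ] ℂ).restrictScalars ℚ) z
      (minpoly ℚ z))
    rw [minpoly.aeval, map_zero] at h
    exact h
  have hcard := Multiset.card_le_card ((Multiset.le_iff_subset (s := {w, z, starRingEnd ℂ z})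
    (t := ((minpoly ℚ z).map (algebraMap ℚ ℂ)).roots) (by simp [hne.1, hne.2, hzz])).2 (by
      intro x hx
      rw [mem_roots ((minpoly.monic hi).map _).ne_zero, IsRoot, eval_map]
      simp only [Multiset.insert_eq_cons, Multiset.mem_cons, Multiset.mem_singleton] at hx
      rcases hx with rfl | rfl | rfl
      · exact hw
      · exact minpoly.aeval _ _
      · exact hconj))
  have h2 := card_roots' ((minpoly ℚ z).map (algebraMap ℚ ℂ))
  rw [natDegree_map, hz.2] at h2
  simp at hcard
  omega

/-- Conjugates of a zero of a rational polynomial with quadratic coordinates. -/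
lemma exists_conjugate_zero {f : MvPolynomial (Fin (n + 1)) ℚ} {w : Fin (n + 1) → ℂ}
    (hw : ∀ k, k ≠ Fin.last n → w k ∈ SigmaSet)
    (hlast : IsIntegral ℚ (w (Fin.last n))) (h0 : MvPolynomial.aeval w f = 0) {y : ℂ}
    (hy : aeval y (minpoly ℚ (w (Fin.last n))) = 0) :
    ∃ w' : Fin (n + 1) → ℂ, (∀ k, k ≠ Fin.last n → w' k = w k ∨ w' k = starRingEnd ℂ (w k)) ∧
      w' (Fin.last n) = y ∧ MvPolynomial.aeval w' f = 0 := by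
  let A := algebraicClosure ℚ ℂ
  have : IsAlgClosure ℚ A := algebraicClosure.isAlgClosure ℚ ℂ
  have : Normal ℚ A := IsAlgClosure.normal ℚ A
  have hwA : ∀ k, w k ∈ A := by
    intro k
    rw [mem_algebraicClosure_iff]
    by_cases hk : k = Fin.last n
    · rw [hk]; exact hlast.isAlgebraic
    · by_contra h
      have := (hw k hk).2
      rw [minpoly.eq_zero (fun h' => h h'.isAlgebraic)] at this
      simp at this
  have hyA : y ∈ A := by
    rw [mem_algebraicClosure_iff]
    exact ⟨_, minpoly.ne_zero hlast, hy⟩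
  let wA : Fin (n + 1) → A := fun k => ⟨w k, hwA k⟩
  have hmin : ∀ k, minpoly ℚ (wA k) = minpoly ℚ (w k) := fun k =>
    (minpoly.algebraMap_eq (algebraMap A ℂ).injective (wA k)).symm
  have hval : ∀ (x : A) (q : ℚ[X]), aeval (x : ℂ) q = ((aeval x q : A) : ℂ) := fun x q =>
    (aeval_algHom_apply A.val x q)
  obtain ⟨σ, hσ⟩ := minpoly.exists_algEquiv_of_root' (K := ℚ) (x := (⟨y, hyA⟩ : A))
    (y := wA (Fin.last n)) (Algebra.IsAlgebraic.isAlgebraic _) (by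
      rw [hmin]
      have := hval ⟨y, hyA⟩ (minpoly ℚ (w (Fin.last n)))
      rw [hy] at this
      exact Subtype.ext this.symm)
  refine ⟨fun k => σ (wA k), fun k hk => ?_, congrArg Subtype.val hσ, ?_⟩
  · refine root_minpoly_of_mem_SigmaSet (hw k hk) ?_
    rw [hval, ← hmin k]
    have := aeval_algHom_apply (σ : A →ₐ[ℚ] A) (wA k) (minpoly ℚ (wA k))
    rw [minpoly.aeval, map_zero] at this
    have h2 : aeval (σ (wA k)) (minpoly ℚ (wA k)) = 0 := this
    rw [h2]; rfl
  · have h1 : MvPolynomial.aeval wA f = 0 := by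
      refine (algebraMap A ℂ).injective ?_
      rw [map_zero, ← h0]
      exact ((MvPolynomial.aeval_algebraMap_apply ℂ wA f)).symm
    have h2 : MvPolynomial.aeval (fun k => σ (wA k)) f = 0 := by
      have h := MvPolynomial.comp_aeval_apply wA (σ : A →ₐ[ℚ] A) f
      rw [h1, map_zero] at h
      exact h.symm
    have h3 := MvPolynomial.aeval_algebraMap_apply ℂ (fun k => σ (wA k)) f
    rw [h2, map_zero] at h3
    exact h3

end

section

open Filter Topology Polynomial

variable {n : ℕ} {j : ℂ → ℂ}

/-- Near a generic point there is no solution with quadratic coordinates of a rational equation. -/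
lemma IsModularJ.eventually_not_quadratic (hj : IsModularJ j)
    {f : MvPolynomial (Fin (n + 1)) ℚ} (hf0 : f ≠ 0) {v : Fin (n + 1) → ℂ}
    (hvr : ∀ k, k ≠ Fin.last n → (v k).im = 0) (hv : AIndOn ∅ v {Fin.last n}ᶜ)
    (hlast : v (Fin.last n) ∉ acl ∅) :
    ∀ᶠ w in 𝓝 v, (∀ k, k ≠ Fin.last n → w k ∈ sat ∅) → (∃ c ∈ SigmaSet, w (Fin.last n) = j c) →
      MvPolynomial.aeval w f ≠ 0 := by
  classical
  let fC : MvPolynomial (Fin (n + 1)) ℂ := f.map (algebraMap ℚ ℂ)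
  have hfC0 : fC ≠ 0 := fun h => hf0 (MvPolynomial.map_injective _ (algebraMap ℚ ℂ).injective
    (h.trans (map_zero _).symm))
  have hfC : ∀ m, fC.coeff m ∈ acl ∅ := fun m => by
    rw [MvPolynomial.coeff_map]
    exact SubfieldClass.ratCast_mem (acl ∅) _
  have heval : ∀ w : Fin (n + 1) → ℂ, MvPolynomial.eval w fC = MvPolynomial.aeval w f := fun w => by
    rw [MvPolynomial.eval_map]; rfl
  obtain ⟨B, hB⟩ := exists_root_bound Set.countable_empty hv hfC0 hfC
  have hs := (isOpen_slice_ne_zero (Fin.last n) fC).mem_nhds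
    (slice_ne_zero_of_aIndOn Set.countable_empty hv hfC0 hfC)
  obtain ⟨δ, hδ, hball⟩ := Metric.eventually_nhds_iff_ball.1 (hB.and hs)
  obtain ⟨d, hd⟩ : ∃ d, d = ∑ _ε : Fin (n + 1) → Bool, fC.totalDegree := ⟨_, rfl⟩
  have hfin := finite_isIntegral_le d B
  have hnot : v (Fin.last n) ∉ {y : ℂ | IsIntegral ℤ y ∧ (minpoly ℤ y).natDegree ≤ d ∧
      ∀ y' : ℂ, aeval y' (minpoly ℤ y) = 0 → ‖y'‖ ≤ B} := fun h => hlast (Zbar_le_acl ∅ h.1)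
  have hev := (continuous_apply (Fin.last n)).continuousAt (x := v)
    |>.eventually (hfin.isClosed.isOpen_compl.mem_nhds hnot)
  filter_upwards [hev, Metric.ball_mem_nhds v hδ] with w hw hwb hquad ⟨c, hc, hwc⟩ h0
  have hIntegral : IsIntegral ℤ (w (Fin.last n)) := hwc ▸ hj.isIntegral_of_mem_SigmaSet hc
  have hminQ : minpoly ℚ (w (Fin.last n)) = (minpoly ℤ (w (Fin.last n))).map (algebraMap ℤ ℚ) :=
    minpoly.isIntegrallyClosed_eq_field_fractions' ℚ hIntegral
  have hintQ : IsIntegral ℚ (w (Fin.last n)) := hIntegral.tower_top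
  let u : (Fin (n + 1) → Bool) → Fin (n + 1) → ℂ := fun ε k =>
    if k = Fin.last n then v k else if ε k then starRingEnd ℂ (w k) else w k
  have hu : ∀ ε, u ε ∈ Metric.ball v δ := by
    intro ε
    rw [Metric.mem_ball, dist_pi_lt_iff hδ]
    intro k
    by_cases hk : k = Fin.last n
    · simp [u, hk, hδ]
    · have h1 : dist (w k) (v k) < δ := (dist_pi_lt_iff hδ).1 hwb k
      simp only [u, hk, if_false]
      split_ifs
      · rw [← Complex.conj_eq_iff_im.2 (hvr k hk), Complex.dist_conj_conj]
        exact h1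
      · exact h1
  have hroot : ∀ y : ℂ, aeval y (minpoly ℤ (w (Fin.last n))) = 0 →
      ∃ ε, (slice (Fin.last n) (u ε) fC).eval y = 0 := by
    intro y hy
    obtain ⟨w', hw', hlw, h⟩ := exists_conjugate_zero (fun k hk =>
      mem_SigmaSet_of_mem_sat_empty (hquad k hk)) hintQ h0 (y := y) (by
        rw [hminQ, aeval_map_algebraMap, hy])
    refine ⟨fun k => decide (w' k ≠ w k), ?_⟩
    rw [← heval, ← eval_slice_self (i := Fin.last n)] at h
    rw [← hlw]
    convert h using 2
    refine slice_congr fun k hk => ?_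
    by_cases hkk : w' k = w k
    · simp [u, hk, hkk]
    · simp only [u, hk, if_false, hkk, ne_eq, not_false_eq_true, decide_true, if_true]
      exact ((hw' k hk).resolve_left hkk).symm
  refine hw ⟨hIntegral, ?_, fun y hy => ?_⟩
  · obtain ⟨P, hP⟩ : ∃ P : ℂ[X], P = ∏ ε, slice (Fin.last n) (u ε) fC := ⟨_, rfl⟩
    have hP0 : P ≠ 0 := hP ▸ Finset.prod_ne_zero_iff.2 fun ε _ => (hball _ (hu ε)).2
    have hPd : P.natDegree ≤ d := by
      rw [hP, hd]
      exact (natDegree_prod_le _ _).trans (Finset.sum_le_sum fun ε _ => natDegree_slice_le)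
    have hsep : (minpoly ℚ (w (Fin.last n))).Separable := (minpoly.irreducible hintQ).separable
    have hnd : ((minpoly ℚ (w (Fin.last n))).map (algebraMap ℚ ℂ)).roots.Nodup :=
      nodup_roots hsep.map
    have hle : ((minpoly ℚ (w (Fin.last n))).map (algebraMap ℚ ℂ)).roots ≤ P.roots := by
      rw [Multiset.le_iff_subset hnd]
      intro y hy
      have hy2 := (mem_roots'.1 hy).2
      rw [IsRoot, eval_map] at hy2
      obtain ⟨ε, hε⟩ := hroot y (by
        rw [← aeval_map_algebraMap ℚ, ← hminQ]; exact hy2)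
      rw [mem_roots hP0, IsRoot, hP, eval_prod]
      exact Finset.prod_eq_zero (Finset.mem_univ ε) hε
    have h1 := Multiset.card_le_card hle
    rw [← (IsAlgClosed.splits _).natDegree_eq_card_roots, natDegree_map, hminQ,
      (minpoly.monic hIntegral).natDegree_map] at h1
    exact h1.trans ((card_roots' P).trans hPd)
  · obtain ⟨ε, hε⟩ := hroot y hy
    exact (hball _ (hu ε)).1 y hε

end

section

open Polynomial

/-- A ring homomorphism section of the dual numbers deforming a given transcendental element. -/
theorem exists_dualNumber_section {s : ℂ} (hs : Transcendental ℚ s) :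
    ∃ φ : ℂ →+* DualNumber ℂ, (∀ x, (φ x).fst = x) ∧ (φ s).snd = 1 := by
  let K := FractionRing ℚ[X]
  let e : ℚ[X] →+* DualNumber ℂ :=
    (aeval (TrivSqZeroExt.inl s + TrivSqZeroExt.inr 1 : DualNumber ℂ)).toRingHom
  let π : DualNumber ℂ →+* ℂ := (TrivSqZeroExt.fstHom ℂ ℂ ℂ).toRingHom
  have hπe : ∀ P, π (e P) = aeval s P := by
    intro P
    have : (((TrivSqZeroExt.fstHom ℂ ℂ ℂ).restrictScalars ℚ).comp
      (aeval (TrivSqZeroExt.inl s + TrivSqZeroExt.inr 1 : DualNumber ℂ))) P = aeval s P := by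
      congr 1
      ext
      simp
    exact this
  have hunit : ∀ P : nonZeroDivisors ℚ[X], IsUnit (e P) := by
    intro P
    rw [TrivSqZeroExt.isUnit_iff_isUnit_fst]
    change IsUnit (π (e P))
    rw [hπe, isUnit_iff_ne_zero]
    exact fun h => nonZeroDivisors.coe_ne_zero P ((transcendental_iff.mp hs) _ h)
  let E : K →+* DualNumber ℂ := IsLocalization.lift hunit
  let _ : Algebra K (DualNumber ℂ) := E.toAlgebra
  let _ : Algebra K ℂ := (π.comp E).toAlgebra
  let g : DualNumber ℂ →ₐ[K] ℂ := { π with commutes' := fun _ => rfl }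
  have hg : Function.Surjective g := fun x => ⟨TrivSqZeroExt.inl x, rfl⟩
  have hnil : IsNilpotent (RingHom.ker (g : DualNumber ℂ →+* ℂ)) := by
    refine ⟨2, ?_⟩
    have h : RingHom.ker (g : DualNumber ℂ →+* ℂ) * RingHom.ker (g : DualNumber ℂ →+* ℂ) ≤ ⊥ := by
      rw [Ideal.mul_le]
      intro a ha b hb
      have ha' : a.fst = 0 := ha
      have hb' : b.fst = 0 := hb
      rw [Ideal.mem_bot]
      ext <;> simp [ha', hb']
    have h' : (RingHom.ker (g : DualNumber ℂ →+* ℂ)) ^ 2 = ⊥ := by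
      have h2 := Submodule.pow_succ (RingHom.ker (g : DualNumber ℂ →+* ℂ)) (n := 1)
      refine h2.trans ?_
      rw [Submodule.pow_one]
      exact le_bot_iff.mp h
    exact h'
  have hchar : CharZero K := charZero_of_injective_algebraMap (FaithfulSMul.algebraMap_injective ℚ K)
  have hsm : Algebra.FormallySmooth K ℂ := by
    obtain ⟨b, hb⟩ := exists_isTranscendenceBasis K ℂ
    have halg := hb.isAlgebraic_field
    have : Algebra.IsSeparable (IntermediateField.adjoin K
      (Set.range ((↑) : b → ℂ))) ℂ := inferInstance
    exact .of_algebraicIndependent_of_isSeparable hb.1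
  let φ := Algebra.FormallySmooth.liftOfSurjective (AlgHom.id K ℂ) g hg hnil
  have hφ : ∀ x, (φ x).fst = x := fun x =>
    Algebra.FormallySmooth.liftOfSurjective_apply (AlgHom.id K ℂ) g hg hnil x
  refine ⟨φ.toRingHom, hφ, ?_⟩
  have h1 : E (algebraMap ℚ[X] K X) = TrivSqZeroExt.inl s + TrivSqZeroExt.inr 1 := by
    rw [IsLocalization.lift_eq]
    simp [e]
  have h2 : algebraMap K ℂ (algebraMap ℚ[X] K X) = s := by
    change π (E _) = s
    rw [h1]
    simp [π]
  have h3 := φ.commutes (algebraMap ℚ[X] K X)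
  rw [h2] at h3
  change (φ s).snd = 1
  rw [h3]
  change (E _).snd = 1
  rw [h1]
  simp

theorem exists_derivation {s : ℂ} (hs : Transcendental ℚ s) :
    ∃ δ : Derivation ℚ ℂ ℂ, δ s = 1 := by
  obtain ⟨φ, h1, h2⟩ := exists_dualNumber_section hs
  refine ⟨Derivation.mk' (AddMonoidHom.toRatLinearMap
    { toFun := fun x => (φ x).snd
      map_zero' := by simp
      map_add' := by simp }) ?_, h2⟩
  intro a b
  change (φ (a * b)).snd = a • (φ b).snd + b • (φ a).snd
  rw [map_mul, TrivSqZeroExt.snd_mul, h1, h1]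
  simp [mul_comm]

theorem derivation_eq_zero (δ : Derivation ℚ ℂ ℂ) {x : ℂ} (hx : IsAlgebraic ℚ x) : δ x = 0 := by
  have h := δ.map_aeval (minpoly ℚ x) x
  rw [minpoly.aeval, map_zero] at h
  have hsep := (minpoly.irreducible hx.isIntegral).separable
  have h0 : aeval x (derivative (minpoly ℚ x)) ≠ 0 :=
    hsep.aeval_derivative_ne_zero (minpoly.aeval ℚ x)
  rw [smul_eq_mul] at h
  exact (mul_eq_zero.mp h.symm).resolve_left h0

end

section

open MvPolynomial

theorem isAlgebraic_of_mem_acl_empty {x : ℂ} (hx : x ∈ acl ∅) : IsAlgebraic ℚ x := by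
  have h := mem_acl.mp hx
  rw [Algebra.adjoin_empty] at h
  exact h.restrictScalars ℚ

theorem exists_mapDerivation {σ : Type*} [Fintype σ] [DecidableEq σ] (δ : Derivation ℚ ℂ ℂ)
    (p : MvPolynomial σ ℂ) :
    ∃ q : MvPolynomial σ ℂ, (∀ m, coeff m q = δ (coeff m p)) ∧
      ∀ v : σ → ℂ, δ (eval v p) = eval v q + ∑ i, eval v (pderiv i p) * δ (v i) := by
  induction p using MvPolynomial.induction_on with
  | C a =>
    refine ⟨C (δ a), fun m => ?_, fun v => by simp⟩
    rw [coeff_C, coeff_C]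
    split_ifs <;> simp
  | add p q hp hq =>
    obtain ⟨p', h1, h2⟩ := hp
    obtain ⟨q', h3, h4⟩ := hq
    refine ⟨p' + q', fun m => by simp [h1, h3], fun v => ?_⟩
    simp only [map_add, h2, h4, add_mul, Finset.sum_add_distrib]
    ring
  | mul_X p i hp =>
    obtain ⟨p', h1, h2⟩ := hp
    refine ⟨p' * X i, fun m => ?_, fun v => ?_⟩
    · rw [coeff_mul_X', coeff_mul_X']
      split_ifs <;> simp [h1]
    · have h3 : ∀ k, eval v (pderiv k (p * X i)) * δ (v k) =
          eval v (pderiv k p) * δ (v k) * v i + if k = i then eval v p * δ (v i) else 0 := by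
        intro k
        rw [Derivation.leibniz, pderiv_X]
        by_cases hk : k = i
        · subst hk
          simp
          ring
        · simp [hk, Ne.symm hk]
          ring
      rw [Finset.sum_congr rfl fun k _ => h3 k]
      simp only [Finset.sum_add_distrib, Finset.sum_ite_eq', Finset.mem_univ, if_true,
        ← Finset.sum_mul, map_mul, eval_X, Derivation.leibniz, smul_eq_mul, h2]
      ring

theorem norm_derivation_of_GRel (δ : Derivation ℚ ℂ ℂ) {c z : ℂ} (h : GRel c z) (hc : c ∈ HH) :
    ‖δ z‖ = z.im * (‖δ c‖ / c.im) := by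
  obtain ⟨g, hg, rfl⟩ := h
  have hne := denom_ne hg hc
  have hq : ∀ a : ℚ, δ (a : ℂ) = 0 := fun a => by
    have := δ.map_algebraMap a
    rwa [eq_ratCast] at this
  have h1 : moeb (qmat g) c * ((g 1 0 : ℂ) * c + (g 1 1 : ℂ)) = (g 0 0 : ℂ) * c + (g 0 1 : ℂ) := by
    rw [moeb_qmat, div_mul_cancel₀ _ hne]
  have h2 := congrArg δ h1
  simp only [Derivation.leibniz, map_add, hq, smul_eq_mul, mul_zero, add_zero] at h2
  have h3 : δ (moeb (qmat g) c) * ((g 1 0 : ℂ) * c + (g 1 1 : ℂ)) ^ 2 = (g.det : ℂ) * δ c := by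
    rw [Matrix.det_fin_two]
    push_cast
    linear_combination ((g 1 0 : ℂ) * c + (g 1 1 : ℂ)) * h2 - (g 1 0 : ℂ) * δ c * h1
  have h4 := congrArg norm h3
  have hdet : (0 : ℝ) < g.det := by exact_mod_cast hg
  have h5 : ‖(g.det : ℂ)‖ = (g.det : ℝ) := by
    rw [← Complex.ofReal_ratCast, Complex.norm_real, Real.norm_of_nonneg hdet.le]
  rw [norm_mul, norm_mul, norm_pow, h5, ← Complex.normSq_eq_norm_sq] at h4
  rw [im_moeb]
  have hc' : c.im ≠ 0 := ne_of_gt hc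
  have hn : Complex.normSq ((g 1 0 : ℂ) * c + (g 1 1 : ℂ)) ≠ 0 := (Complex.normSq_pos.2 hne).ne'
  rw [eq_div_of_mul_eq hn h4]
  field_simp

theorem exists_norm_derivation_le (δ : Derivation ℚ ℂ ℂ) {t : Set ℂ} (ht : t.Finite) :
    ∃ B : ℝ, ∀ z ∈ sat t, ‖δ z‖ ≤ |z.im| * B := by
  obtain ⟨B, hB⟩ := (ht.image fun c => ‖δ c‖ / c.im).bddAbove
  refine ⟨max B 0, fun z hz => ?_⟩
  obtain ⟨hzH, c, hc, hzc⟩ := hz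
  have hcz := hzc.symm hzH
  have hcH := hzc.mem hzH
  rw [norm_derivation_of_GRel δ hcz hcH, abs_of_pos hzH]
  refine mul_le_mul_of_nonneg_left ?_ (le_of_lt hzH)
  rcases hc with hc | hc
  · have h0 : δ c = 0 := derivation_eq_zero δ (by
      exact isAlgebraic_of_mem_acl_empty (mem_acl_of_mem_SigmaSet hc ∅))
    simp [h0]
  · exact (hB (Set.mem_image_of_mem _ hc)).trans (le_max_left _ _)

theorem eventually_not_algebraic {n : ℕ} {p : MvPolynomial (Fin (n + 1)) ℂ} {T t : Set ℂ}
    {v : Fin (n + 1) → ℂ} (δ : Derivation ℚ ℂ ℂ) (hp : Irreducible p)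
    (hpT : ∀ m, p.coeff m ∈ acl T) (hδT : ∀ m, δ (p.coeff m) ∈ acl T)
    (hd : p.degreeOf (Fin.last n) ≠ 0) (hv : AIndOn T v {Fin.last n}ᶜ) (h0 : eval v p = 0)
    (hvr : ∀ k, k ≠ Fin.last n → (v k).im = 0) {m₀ m₁ : Fin (n + 1) →₀ ℕ}
    (h1 : p.coeff m₀ = 1) (hs : δ (p.coeff m₁) ≠ 0) (ht : t.Finite) :
    ∀ᶠ w in nhds v, (∀ k, k ≠ Fin.last n → w k ∈ sat t) → w (Fin.last n) ∈ acl ∅ →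
      eval w p ≠ 0 := by
  obtain ⟨q, hq, hqv⟩ := exists_mapDerivation δ p
  obtain ⟨B, hB⟩ := exists_norm_derivation_le δ ht
  have hq0 : eval v q ≠ 0 := by
    intro hq0
    obtain ⟨h, rfl⟩ := dvd_of_eval_zero_last hp hpT hd hv h0 (fun m => by rw [hq]; exact hδT m) hq0
    have hne : p * h ≠ 0 := fun h' => hs (by rw [← hq, h', coeff_zero])
    have hdeg : (p * h).totalDegree ≤ p.totalDegree := by
      refine totalDegree_le_of_support_subset fun m hm => ?_
      rw [mem_support_iff, hq] at hm
      exact mem_support_iff.mpr fun h' => hm (by rw [h', map_zero])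
    rw [totalDegree_mul_of_isDomain hp.ne_zero (right_ne_zero_of_mul hne)] at hdeg
    rw [totalDegree_eq_zero_iff_eq_C.mp (show h.totalDegree = 0 by omega)] at hq hne
    have h2 := hq m₀
    rw [h1, mul_comm, coeff_C_mul, h1, Derivation.map_one_eq_zero, mul_one] at h2
    exact hne (by rw [h2, C_0, mul_zero])
  obtain ⟨I, hI⟩ : ∃ I : Finset (Fin (n + 1)), I = {Fin.last n}ᶜ := ⟨_, rfl⟩
  have hIl : ∀ k ∈ I, k ≠ Fin.last n := fun k hk => by simpa [hI] using hk
  have hcont : Continuous fun w : Fin (n + 1) → ℂ =>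
      ‖eval w q‖ - ∑ k ∈ I, ‖eval w (pderiv k p)‖ * (|(w k).im| * B) := by
    have hc : ∀ f : MvPolynomial (Fin (n + 1)) ℂ,
        Continuous fun w : Fin (n + 1) → ℂ => eval w f := fun f => f.continuous_eval
    exact (hc q).norm.sub (continuous_finsetSum _ fun k _ => (hc (pderiv k p)).norm.mul
      ((Complex.continuous_im.comp (continuous_apply k)).abs.mul continuous_const))
  have hpos : 0 < ‖eval v q‖ - ∑ k ∈ I, ‖eval v (pderiv k p)‖ * (|(v k).im| * B) := by
    have hz : ∑ k ∈ I, ‖eval v (pderiv k p)‖ * (|(v k).im| * B) = 0 := by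
      refine Finset.sum_eq_zero fun k hk => ?_
      rw [hvr k (hIl k hk), abs_zero, zero_mul, mul_zero]
    rw [hz, sub_zero]
    exact norm_pos_iff.mpr hq0
  filter_upwards [hcont.continuousAt.eventually (lt_mem_nhds hpos)] with w hw hwt hwl hw0
  have h2 := hqv w
  rw [hw0, map_zero, ← Finset.sum_compl_add_sum {Fin.last n}, Finset.sum_singleton, ← hI,
    derivation_eq_zero δ (isAlgebraic_of_mem_acl_empty hwl), mul_zero, add_zero] at h2
  rw [eq_neg_of_add_eq_zero_left h2.symm, norm_neg] at hw
  refine absurd hw (not_lt.mpr (sub_nonpos.mpr ((norm_sum_le _ _).trans ?_)))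
  refine Finset.sum_le_sum fun k hk => ?_
  rw [norm_mul]
  exact mul_le_mul_of_nonneg_left (hB _ (hwt k (hIl k hk))) (norm_nonneg _)

end

section

open MvPolynomial Filter Topology

theorem exists_rat_multiple {σ : Type*} {p : MvPolynomial σ ℂ} (hp : p ≠ 0)
    (hpA : ∀ m, p.coeff m ∈ acl ∅) :
    ∃ f : MvPolynomial σ ℚ, f ≠ 0 ∧ p ∣ f.map (algebraMap ℚ ℂ) := by
  obtain ⟨P, rfl⟩ := exists_lift hpA
  have hP : P ≠ 0 := fun h => hp (by rw [h, map_zero])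
  have halg : Algebra.IsAlgebraic ℚ (acl ∅) := ⟨fun x => by
    have h := isAlgebraic_of_mem_acl_empty x.2
    exact (isAlgebraic_algebraMap_iff (R := ℚ) (S := acl ∅) (A := ℂ)
      (FaithfulSMul.algebraMap_injective _ _)).mp h⟩
  let _ : Algebra (MvPolynomial σ ℚ) (MvPolynomial σ (acl ∅)) := algebraMvPolynomial
  obtain ⟨f, hf, hd⟩ := (Algebra.IsAlgebraic.isAlgebraic (R := MvPolynomial σ ℚ) P).exists_nonzero_dvd
    (mem_nonZeroDivisors_of_ne_zero hP)
  refine ⟨f, hf, ?_⟩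
  have h := map_dvd (MvPolynomial.map (acl ∅).subtype) hd
  rw [algebraMap_def, MvPolynomial.map_map] at h
  convert h using 2
  congr 1

variable {n : ℕ} {F T S t : Set ℂ} {p f : MvPolynomial (Fin (n + 1)) ℂ}
  {v : Fin (n + 1) → ℂ} {j : ℂ → ℂ}

theorem SBase.eventually_dichotomy (hB : SBase j F S) (hj : IsModularJ j) (hT : T.Countable)
    (hFT : F ⊆ acl T) (hv : AIndOn T v {Fin.last n}ᶜ) (hv0 : AIndOn T v {0}ᶜ) (hf0 : f ≠ 0)
    (hf : ∀ m, f.coeff m ∈ acl F) :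
    ∀ᶠ w in 𝓝 v, ∀ z : ℕ → ℂ, (∀ k : Fin (n + 1), w k = z k) → (∀ i < n, z i ∈ HH) →
      (∀ i < n, z (i + 1) = j (z i)) → eval w f = 0 →
      (∀ i < n, z i ∈ S) ∨ AIndOn F z (Set.Iio n) ∧ slice 0 w f ≠ 0 := by
  filter_upwards [eventually_of_generic hj hT hv hv0 hf0 (fun m => acl_le hFT (hf m))
    f.totalDegree] with w ⟨h1, h2, h3, h4⟩ z hwz hz hstep h0
  have hw : w = fun k : Fin (n + 1) => z k := funext hwz
  refine (hB.dichotomy hj hz hstep hf (by rwa [← hw]) (by rwa [← hw]) (by rwa [← hw]) ?_ ?_).imp id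
    fun h => ⟨h, h2⟩
  · intro i hi k hk hik
    have := h3 (⟨i, by omega⟩) (by simp [Fin.ext_iff]; omega)
      (⟨k, by omega⟩) (by simp [Fin.ext_iff]; omega) (by simpa [hwz] using hik)
    simpa [Fin.ext_iff] using this
  · intro l hl hln
    have := h4 (⟨l, by omega⟩) (by simp [Fin.ext_iff]; omega)
      (by simp [Fin.ext_iff]; omega)
    simpa [hwz] using this

theorem MSCD.eventually_ne_zero_of_rat (hM : MSCD j) (hj : IsModularJ j) (hn : 0 < n)
    (hT : T.Countable) (hv : AIndOn T v {Fin.last n}ᶜ) (hv0 : AIndOn T v {0}ᶜ)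
    (hvr : ∀ k, k ≠ Fin.last n → (v k).im = 0) {f : MvPolynomial (Fin (n + 1)) ℚ} (hf0 : f ≠ 0) :
    ∀ᶠ w in 𝓝 v, ∀ z : ℕ → ℂ, (∀ k : Fin (n + 1), w k = z k) → (∀ i < n, z i ∈ HH) →
      (∀ i < n, z (i + 1) = j (z i)) → z n ∈ acl ∅ → aeval w f ≠ 0 := by
  have hfA : ∀ m, (f.map (algebraMap ℚ ℂ)).coeff m ∈ acl ∅ := fun m => by
    rw [coeff_map, eq_ratCast]
    exact SubfieldClass.ratCast_mem _ _
  have hf0' : f.map (algebraMap ℚ ℂ) ≠ 0 := fun h =>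
    hf0 (map_injective _ (algebraMap ℚ ℂ).injective (by rw [h, map_zero]))
  have hlast : v (Fin.last n) ∉ acl T := hv0.notMem (by simp [Fin.ext_iff]; omega)
  filter_upwards [(hM.sBase_empty hj).eventually_dichotomy hj hT (Set.empty_subset _) hv hv0 hf0'
    hfA, hj.eventually_not_quadratic hf0 hvr 
      (fun k hk h => hv k hk (acl_mono (Set.union_subset_union_left _ (Set.empty_subset _)) h))
    (fun h => hlast (acl_mono (Set.empty_subset _) h))] with w h1 h2 z hwz hz hstep hzn h0
  have h0' : eval w (f.map (algebraMap ℚ ℂ)) = 0 := by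
    rwa [eval_map, ← aeval_def]
  rcases h1 z hwz hz hstep h0' with h | ⟨h, hs⟩
  · refine h2 (fun k hk => ?_) ⟨z (n - 1), mem_SigmaSet_of_mem_sat_empty (h _ (by omega)), ?_⟩ h0
    · rw [hwz]
      exact h _ (Fin.val_lt_last hk)
    · rw [hwz, Fin.val_last, ← hstep _ (by omega), Nat.sub_add_cancel hn]
  · refine h 0 hn ?_
    have := mem_acl_of_slice hfA h0' hs (U := ∅ ∪ z '' (Set.Iio n \ {0}))
      (Set.empty_subset _) fun k hk => ?_
    · simpa [hwz] using this
    · rw [hwz]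
      by_cases hkn : (k : ℕ) = n
      · rw [hkn]
        exact acl_mono (Set.empty_subset _) hzn
      · exact mem_acl_of_mem (Or.inr ⟨k, ⟨show (k : ℕ) < n by omega, fun h => hk (Fin.ext h)⟩, rfl⟩)

end

section

open MvPolynomial Filter Topology

variable {n : ℕ} {F T S t : Set ℂ} {p f : MvPolynomial (Fin (n + 1)) ℂ}
  {v : Fin (n + 1) → ℂ} {j : ℂ → ℂ}

theorem MSCD.exists_eventually_ne_zero (hM : MSCD j) (hj : IsModularJ j) (hn : 0 < n)
    (hF : F.Finite) (ht : t.Finite) (hp : Irreducible p) (hpF : ∀ m, p.coeff m ∈ F)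
    (hd : p.degreeOf (Fin.last n) ≠ 0) {m₀ : Fin (n + 1) →₀ ℕ} (hm₀ : p.coeff m₀ = 1) :
    ∃ T : Set ℂ, T.Finite ∧ F ⊆ T ∧ ∀ v : Fin (n + 1) → ℂ, AIndOn T v {Fin.last n}ᶜ →
      AIndOn T v {0}ᶜ → (∀ k, k ≠ Fin.last n → (v k).im = 0) → eval v p = 0 →
      ∀ᶠ w in 𝓝 v, ∀ z : ℕ → ℂ, (∀ k : Fin (n + 1), w k = z k) → (∀ i < n, z i ∈ sat t) →
        (∀ i < n, z (i + 1) = j (z i)) → z n ∈ acl ∅ → eval w p ≠ 0 := by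
  by_cases hpA : ∀ m, p.coeff m ∈ acl ∅
  · obtain ⟨f, hf0, g, hg⟩ := exists_rat_multiple hp.ne_zero hpA
    refine ⟨F, hF, subset_rfl, fun v hv hv0 hvr _ => ?_⟩
    filter_upwards [hM.eventually_ne_zero_of_rat hj hn hF.countable hv hv0 hvr hf0]
      with w hw z hwz hz hstep hzn h0
    refine hw z hwz (fun i hi => (hz i hi).1) hstep hzn ?_
    rw [aeval_def, ← eval_map, hg, map_mul, h0, zero_mul]
  · push Not at hpA
    obtain ⟨m₁, hm₁⟩ := hpA
    have htr : Transcendental ℚ (p.coeff m₁) := fun h => hm₁ (mem_acl.mpr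
      (h.extendScalars (FaithfulSMul.algebraMap_injective _ _)))
    obtain ⟨δ, hδ⟩ := exists_derivation htr
    refine ⟨F ∪ δ '' F, hF.union (hF.image δ), Set.subset_union_left,
      fun v hv hv0 hvr h0 => ?_⟩
    filter_upwards [eventually_not_algebraic δ hp (fun m => mem_acl_of_mem (Or.inl (hpF m)))
      (fun m => mem_acl_of_mem (Or.inr ⟨_, hpF m, rfl⟩)) hd hv h0 hvr hm₀
      (by rw [hδ]; exact one_ne_zero) ht] with w hw z hwz hz _ hzn
    refine hw (fun k hk => ?_) ?_
    · rw [hwz]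
      exact hz _ (Fin.val_lt_last hk)
    · rwa [hwz, Fin.val_last]

/-- Solutions near a generic real point are generic, provided that the equation is
normalized to have a coefficient equal to one. -/
theorem MSCD.exists_independent_solution (hM : MSCD j) (hj : IsModularJ j) (hn : 0 < n)
    (hp : Irreducible p) (hd0 : p.degreeOf 0 ≠ 0) (hdn : pderiv (Fin.last n) p ≠ 0)
    {m₀ : Fin (n + 1) →₀ ℕ} (hm₀ : p.coeff m₀ = 1) {κ : Set ℂ} (hκ : κ.Finite)
    (hpκ : ∀ m, p.coeff m ∈ κ) :
    ∃ z, (∀ i < n, jIt j i z ∈ HH) ∧ eval (fun k : Fin (n + 1) => jIt j k z) p = 0 ∧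
      AIndOn κ (fun i => jIt j i z) (Set.Iio n) := by
  have hd : p.degreeOf (Fin.last n) ≠ 0 := fun h => hdn (pderiv_eq_zero_of_degreeOf h)
  have h0n : (Fin.last n) ≠ 0 := by simp [Fin.ext_iff]; omega
  obtain ⟨t, htH, hB⟩ := hM.exists_sBase hj hκ
  obtain ⟨F, hF⟩ : ∃ F, F = κ ∪ jet j t := ⟨_, rfl⟩
  rw [← hF] at hB
  have htF : (t : Set ℂ) ⊆ F := fun c hc => hF ▸ Or.inr (Or.inl (Or.inl (Or.inl hc)))
  have hpF : ∀ m, p.coeff m ∈ F := fun m => hF ▸ Or.inl (hpκ m)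
  have hpF' : (p.coeffs : Set ℂ) ⊆ F := fun x hx => by
    obtain ⟨m, -, rfl⟩ := mem_coeffs_iff.1 hx
    exact hpF m
  obtain ⟨T, hTf, hFT, hT⟩ := hM.exists_eventually_ne_zero hj hn hB.finite t.finite_toSet hp hpF hd hm₀
  have hpT : ∀ m, p.coeff m ∈ acl T := fun m => mem_acl_of_mem (hFT (hpF m))
  obtain ⟨r, hrA, hr⟩ := exists_generic_reals hj.countable_crit hTf.countable
  have hind := fun y => aIndOn_pt (y := y) (hr n)
  obtain ⟨y₀, hy₀⟩ := exists_root_of_aIndOn hTf.countable (hind 0) hpT hdn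
  have hupd : ∀ a b, Function.update (pt n (fun i => (r i : ℂ)) a) (Fin.last n) b =
      pt n (fun i => (r i : ℂ)) b := by
    intro a b
    ext k
    by_cases hk : k = Fin.last n
    · subst hk; simp [pt]
    · rw [Function.update_of_ne hk]
      simp [pt, Fin.val_lt_last hk]
  rw [hupd] at hy₀
  obtain ⟨v, hv⟩ : ∃ v, v = pt n (fun i => (r i : ℂ)) y₀ := ⟨_, rfl⟩
  have hvl : AIndOn T v {Fin.last n}ᶜ := hv ▸ hind y₀
  have hv0 : AIndOn T v {0}ᶜ := hvl.zero_of_last hp hpT hd hd0 (hv ▸ hy₀)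
  have hvr : ∀ k, k ≠ Fin.last n → (v k).im = 0 := fun k hk => by
    simp [hv, pt, Fin.val_lt_last hk]
  have hvT : v (Fin.last n) ∉ acl T := hv0.notMem h0n
  have hs := slice_ne_zero_of_aIndOn hTf.countable hvl hp.ne_zero hpT
  have hE : ∀ c ∈ t, j c ∉ acl ∅ → ∃ D, (∀ v : Fin (n + 1) → ℂ,
      (∀ k, k ≠ Fin.last n → v k ∈ sat t) → slice (Fin.last n) v p ≠ 0 → eval v p = 0 →
      ∀ w, GRel c w → v (Fin.last n) = j w → DegRel hj D (j c) (v (Fin.last n))) ∧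
      ∀ᶠ w in 𝓝 v, ¬DegRel hj D (j c) (w (Fin.last n)) := by
    intro c hc hjc
    obtain ⟨D, hD⟩ := hj.exists_degRel hB.finite htF hpF' (htH hc) hjc
    refine ⟨D, hD, eventually_not_degRel hj D continuous_const (continuous_apply _) fun h => ?_⟩
    exact hvT (h.mem_acl (mem_acl_of_mem (hFT (hF ▸ Or.inr (Or.inl (Or.inl (Or.inr ⟨c, hc, rfl⟩)))))))
  choose! D hD hDe using hE
  have hev : ∀ᶠ w in 𝓝 v, ∀ c ∈ t, j c ∉ acl ∅ → ¬DegRel hj (D c) (j c) (w (Fin.last n)) :=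
    (Filter.eventually_all_finset t).2 fun c hc => by
      by_cases hjc : j c ∈ acl ∅
      · exact Filter.Eventually.of_forall fun _ h => absurd hjc h
      · exact (hDe c hc hjc).mono fun _ h _ => h
  have hev2 := (isOpen_slice_ne_zero (Fin.last n) p).mem_nhds hs
  obtain ⟨ε, hε, hball⟩ := Metric.eventually_nhds_iff.1 ((hev.and hev2).and
    ((hT v hvl hv0 hvr (hv ▸ hy₀)).and (hB.eventually_dichotomy hj hTf.countable
      (hFT.trans (subset_acl T)) hvl hv0 hp.ne_zero fun m => mem_acl_of_mem (hpF m))))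
  have hne : ∃ y, eval (pt n (fun i => (r i : ℂ)) y) p ≠ 0 := by
    by_contra! h
    refine hs (Polynomial.funext fun y => ?_)
    rw [eval_slice, hv, hupd, h, Polynomial.eval_zero]
  obtain ⟨z, hz, hzy, hz0⟩ := hj.exists_solution hn p hrA hy₀ hne hε
  have hpt : pt n (fun i => jIt j i z) (jIt j n z) = fun k : Fin (n + 1) => jIt j k z := by
    ext k
    by_cases hk : (k : ℕ) < n
    · simp [pt, hk]
    · have : (k : ℕ) = n := by omega
      simp [pt, this]
  have hdist := pt_dist_lt hε (r := fun i => (r i : ℂ)) (s := fun i => jIt j i z)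
    (fun i hi => (hz i hi).2) hzy
  rw [hpt, ← hv, dist_comm] at hdist
  obtain ⟨⟨h1, h2⟩, h3, h4⟩ := hball hdist
  have hstep : ∀ i < n, jIt j (i + 1) z = j (jIt j i z) := fun _ _ => rfl
  refine ⟨z, fun i hi => (hz i hi).1, hz0, ?_⟩
  rcases h4 (fun i => jIt j i z) (fun _ => rfl) (fun i hi => (hz i hi).1) hstep hz0 with hS | ⟨h, -⟩
  · exfalso
    have hnot := fun h => h3 (fun i => jIt j i z) (fun _ => rfl) hS hstep h hz0
    obtain ⟨hzH, c, hc, hcz⟩ := hS (n - 1) (by omega)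
    have hcz' := hcz.symm hzH
    have hcH := hcz.mem hzH
    have hlast : jIt j n z = j (jIt j (n - 1) z) := by
      rw [← hstep _ (by omega), Nat.sub_add_cancel hn]
    have hjc : j c ∉ acl ∅ := fun h => hnot (by
      simp only [hlast]
      exact hcz'.j_mem_acl hj hcH h)
    rcases hc with hc | hc
    · exact hjc (hj.j_mem_acl_of_mem_SigmaSet hc ∅)
    · refine h1 c hc hjc (hD c hc hjc _ (fun k hk => hS _ (Fin.val_lt_last hk)) h2 hz0 _ hcz' ?_)
      simp [hlast]
  · exact fun k hk h' => h k hk (acl_mono (Set.union_subset_union_left _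
      (hF ▸ Set.subset_union_left)) h')

end

section

open MvPolynomial

variable {n : ℕ}

lemma exists_ne_zero_of_isAlgSetOver {ι : Type*} {L : Set ℂ} {Z : Set (ι → ℂ)}
    (hZ : IsAlgSetOver L Z) (hne : Z ≠ Set.univ) :
    ∃ q : MvPolynomial ι ℂ, q ≠ 0 ∧ (∀ m, q.coeff m ∈ L) ∧ ∀ x ∈ Z, eval x q = 0 := by
  obtain ⟨P, hP, rfl⟩ := hZ
  by_contra! h
  refine hne (Set.eq_univ_of_forall fun x q hq => ?_)
  by_cases h0 : q = 0
  · rw [h0, map_zero]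
  · obtain ⟨y, hy, hy0⟩ := h q h0 (hP q hq)
    exact absurd (hy q hq) hy0

theorem trdegF_eq_of_aindOn {K : Subfield ℂ} {κ : Set ℂ} (hK : K ≤ acl κ)
    {Z : Set (Fin (n + 1) → ℂ)} (hZ : IsAlgSetOver (K : Set ℂ) Z) (hne : Z ≠ Set.univ)
    {u : ℕ → ℂ} (hu : AIndOn κ u (Set.Iio n)) (hmem : (fun k : Fin (n + 1) => u k) ∈ Z) :
    trdegF K (fun k : Fin (n + 1) => u k) = n := by
  refine IsGreatest.csSup_eq ⟨⟨{Fin.last n}ᶜ, by simp [Finset.card_compl], ?_⟩, ?_⟩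
  · refine (hu.algebraicIndependent hK).comp
      (fun i : ({Fin.last n}ᶜ : Finset (Fin (n + 1))) => (⟨i.1, ?_⟩ : Set.Iio n)) ?_
    · have := i.2
      simp only [Finset.mem_compl, Finset.mem_singleton] at this
      exact Fin.val_lt_last this
    · intro a b hab
      exact Subtype.ext (Fin.ext (congrArg Subtype.val hab))
  · rintro k ⟨t, rfl, ht⟩
    by_contra! hlt
    obtain rfl : t = Finset.univ := by
      refine Finset.eq_univ_of_card t (le_antisymm (Finset.card_le_univ t) ?_)
      rw [Fintype.card_fin]
      exact hlt
    obtain ⟨q, hq0, hq, hqZ⟩ := exists_ne_zero_of_isAlgSetOver hZ hne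
    obtain ⟨g, rfl⟩ := exists_lift hq
    have hi := ht.comp (fun i : Fin (n + 1) => (⟨i, Finset.mem_univ i⟩ : (Finset.univ : Finset _)))
      (fun a b hab => congrArg Subtype.val hab)
    refine hq0 ?_
    have h0 := hqZ _ hmem
    rw [eval_map] at h0
    rw [algebraicIndependent_iff.1 hi g h0, map_zero]

end

section

open MvPolynomial

variable {ι : Type*} {V W : Set (ι → ℂ)}

lemma isAlgSet_zeroLocus (I : Ideal (MvPolynomial ι ℂ)) : IsAlgSet (zeroLocus ℂ I) :=
  ⟨I, by ext x; simp [mem_zeroLocus_iff, aeval_eq_eval]⟩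

lemma IsAlgSet.zeroLocus_vanishingIdeal (hV : IsAlgSet V) :
    zeroLocus ℂ (vanishingIdeal ℂ V) = V := by
  obtain ⟨P, rfl⟩ := hV
  refine Set.Subset.antisymm (fun x hx p hp => ?_) (zeroLocus_vanishingIdeal_le _)
  have := mem_zeroLocus_iff.1 hx p (mem_vanishingIdeal_iff.2 fun y hy => ?_)
  · simpa [aeval_eq_eval] using this
  · simpa [aeval_eq_eval] using hy p hp

lemma IsAlgSet.zcl_eq (hV : IsAlgSet V) : zcl V = V :=
  Set.Subset.antisymm (Set.sInter_subset_of_mem ⟨hV, subset_rfl⟩)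
    (Set.subset_sInter fun _ h => h.2)

lemma IsIrr.isPrime_vanishingIdeal (hV : IsIrr V) : (vanishingIdeal ℂ V).IsPrime := by
  refine Ideal.isPrime_iff.2 ⟨fun h => ?_, fun {f g} hfg => ?_⟩
  · obtain ⟨x, hx⟩ := hV.1
    have : (1 : MvPolynomial ι ℂ) ∈ vanishingIdeal ℂ V := h ▸ trivial
    simpa using mem_vanishingIdeal_iff.1 this x hx
  · have key (f : MvPolynomial ι ℂ) : IsAlgSet {x | eval x f = 0} := ⟨{f}, by simp⟩
    refine (hV.2 _ _ (key f) (key g) fun x hx => ?_).imp ?_ ?_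
    · have := mem_vanishingIdeal_iff.1 hfg x hx
      simpa [aeval_eq_eval] using this
    all_goals
      intro h
      refine mem_vanishingIdeal_iff.2 fun x hx => ?_
      have := h hx
      simpa [aeval_eq_eval] using this

lemma isIrr_zeroLocus [Finite ι] (P : Ideal (MvPolynomial ι ℂ)) [hP : P.IsPrime] :
    IsIrr (zeroLocus ℂ P) := by
  have hvi := IsPrime.vanishingIdeal_zeroLocus (K := ℂ) P
  refine ⟨?_, fun V W hV hW h => ?_⟩
  · by_contra! h0
    rw [h0, vanishingIdeal_empty] at hvi
    exact hP.ne_top hvi.symm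
  · have hle : vanishingIdeal ℂ V * vanishingIdeal ℂ W ≤ P := by
      rw [← hvi]
      refine Ideal.mul_le.2 fun f hf g hg => mem_vanishingIdeal_iff.2 fun x hx => ?_
      rw [map_mul]
      rcases h hx with h | h
      · rw [mem_vanishingIdeal_iff.1 hf x h, zero_mul]
      · rw [mem_vanishingIdeal_iff.1 hg x h, mul_zero]
    refine (hP.mul_le.1 hle).imp ?_ ?_ <;> intro h
    · rw [← hV.zeroLocus_vanishingIdeal]; exact zeroLocus_anti_mono h
    · rw [← hW.zeroLocus_vanishingIdeal]; exact zeroLocus_anti_mono h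

/-- The geometric dimension of the zero locus is the Krull dimension of its coordinate ring. -/
theorem adim_zeroLocus [Finite ι] {I : Ideal (MvPolynomial ι ℂ)} {n : ℕ}
    (hI : ringKrullDim (MvPolynomial ι ℂ ⧸ I) = n) : adim (zeroLocus ℂ I) = n := by
  rw [ringKrullDim_quotient] at hI
  unfold adim
  rw [(isAlgSet_zeroLocus I).zcl_eq]
  refine IsGreatest.csSup_eq ⟨?_, ?_⟩
  · obtain ⟨l, hl⟩ := Order.le_krullDim_iff.1 hI.ge
    subst hl
    refine ⟨fun i => zeroLocus ℂ (l (Fin.rev i)).1.asIdeal, ?_, fun i => ?_⟩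
    · intro a b hab
      have hlt := l.strictMono (Fin.rev_lt_rev.2 hab)
      have hle : (l (Fin.rev b)).1.asIdeal ≤ (l (Fin.rev a)).1.asIdeal := hlt.le
      refine lt_of_le_of_ne (zeroLocus_anti_mono hle) fun h => hlt.ne ?_
      have h' := congrArg (vanishingIdeal ℂ) h
      rw [IsPrime.vanishingIdeal_zeroLocus, IsPrime.vanishingIdeal_zeroLocus] at h'
      exact Subtype.ext (PrimeSpectrum.ext h'.symm)
    · exact ⟨isAlgSet_zeroLocus _, isIrr_zeroLocus _, zeroLocus_anti_mono (l (Fin.rev i)).2⟩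
  · rintro k ⟨c, hc, hcc⟩
    let l : LTSeries (PrimeSpectrum.zeroLocus (R := MvPolynomial ι ℂ) I) :=
      { length := k
        toFun := fun i => ⟨⟨vanishingIdeal ℂ (c (Fin.rev i)), (hcc _).2.1.isPrime_vanishingIdeal⟩,
          le_zeroLocus_iff_le_vanishingIdeal.1 (hcc _).2.2⟩
        step := fun i => by
          have hlt := hc (Fin.rev_lt_rev.2 i.castSucc_lt_succ)
          have hle := vanishingIdeal_anti_mono (k := ℂ) hlt.le
          refine lt_of_le_of_ne hle fun h => hlt.ne ?_
          have h' := congrArg (fun I => zeroLocus ℂ I) h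
          simp only [(hcc _).1.zeroLocus_vanishingIdeal] at h'
          exact h'.symm }
    have := Order.LTSeries.length_le_krullDim l
    rw [hI] at this
    exact_mod_cast this

/-- All points of affine space have the same height, the dimension. -/
lemma height_vanishingIdeal_singleton [Finite ι] (x : ι → ℂ) :
    ((vanishingIdeal ℂ {x}).height : WithBot ℕ∞) = ringKrullDim (MvPolynomial ι ℂ) := by
  have htrans (y : ι → ℂ) : (vanishingIdeal ℂ {y}).height = (vanishingIdeal ℂ {x}).height := by
    obtain ⟨e, he⟩ : ∃ e : MvPolynomial ι ℂ ≃ₐ[ℂ] MvPolynomial ι ℂ,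
        ∀ f, aeval x (e f) = aeval y f := by
      refine ⟨AlgEquiv.ofAlgHom (aeval fun i => X i + C (y i - x i))
        (aeval fun i => X i - C (y i - x i)) (by ext i; simp) (by ext i; simp), fun f => ?_⟩
      have : ((aeval x).comp (aeval fun i => X i + C (y i - x i)) :
          MvPolynomial ι ℂ →ₐ[ℂ] ℂ) = aeval y := by ext i; simp
      exact congrArg (fun φ => φ f) this
    rw [← RingEquiv.height_comap e.toRingEquiv (vanishingIdeal ℂ {x})]
    congr 1
    ext f
    rw [mem_vanishingIdeal_singleton_iff, Ideal.mem_comap, mem_vanishingIdeal_singleton_iff, ← he]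
    rfl
  refine le_antisymm (Ideal.height_le_ringKrullDim_of_ne_top
    (Ideal.IsPrime.ne_top inferInstance)) ?_
  refine (ringKrullDim_le_iff_isMaximal_height_le _).2 fun m hm => ?_
  obtain ⟨y, rfl⟩ := isMaximal_iff_eq_vanishingIdeal_singleton.1 hm
  rw [htrans]

theorem ringKrullDim_quotient_span_singleton [Finite ι] {n : ℕ} (hn : Nat.card ι = n + 1)
    {p : MvPolynomial ι ℂ} (hp : p ≠ 0) {x : ι → ℂ} (hx : eval x p = 0) :
    ringKrullDim (MvPolynomial ι ℂ ⧸ Ideal.span {p}) = n := by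
  have h := Module.ringKrullDim_quotient_add_one_of_mem_nonZeroDivisors
    (mem_nonZeroDivisors_of_ne_zero hp) (height_vanishingIdeal_singleton x)
    ((mem_vanishingIdeal_singleton_iff x p).2 (by simpa [aeval_eq_eval] using hx))
  rw [MvPolynomial.ringKrullDim_of_isNoetherianRing, ringKrullDim_eq_zero_of_field, zero_add, hn]
    at h
  exact ENat.WithBot.add_one_cancel.1 (mod_cast h)

end

section

open MvPolynomial

lemma mem_HHn {j : ℂ → ℂ} {z : ℂ} : ∀ {n : ℕ}, (∀ i < n, jIt j i z ∈ HH) → z ∈ HHn j n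
  | 0, _ => trivial
  | n + 1, h => ⟨mem_HHn fun i hi => h i (hi.trans n.lt_succ_self), h n n.lt_succ_self⟩

end

open MvPolynomial

/-- Assuming MSCD: for an irreducible hypersurface
`Z = {p = 0} ⊂ ℂ^{n+1}` with `∂p/∂X ≠ 0` and `∂p/∂Yₙ ≠ 0`, and any finitely generated
field `K` over which `Z` is defined, there is `z ∈ ℍₙ` such that
`(z, j(z), j₂(z), …, jₙ(z)) ∈ Z` is generic in `Z` over `K`
(`tr.deg_K K(z, j(z),…,jₙ(z)) = n = dim Z`). -/
theorem generic_iterates_of_MSCD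
    (j : ℂ → ℂ) (hj : IsModularJ j) (hMSCD : MSCD j)
    (n : ℕ) (hn : 0 < n)
    (p : MvPolynomial (Fin (n + 1)) ℂ) (hirr : Irreducible p)
    (hdX : MvPolynomial.pderiv (0 : Fin (n + 1)) p ≠ 0)
    (hdYn : MvPolynomial.pderiv (Fin.last n) p ≠ 0)
    (Z : Set (Fin (n + 1) → ℂ)) (hZ : Z = {x | MvPolynomial.eval x p = 0})
    (K : Subfield ℂ) (hK : FGField K) (hZdef : IsAlgSetOver (K : Set ℂ) Z) :
    ∃ z ∈ HHn j n,
      (fun k : Fin (n + 1) => jIt j (k : ℕ) z) ∈ Z ∧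
      trdegF K (fun k : Fin (n + 1) => jIt j (k : ℕ) z) = n ∧
      adim Z = n := by
  obtain ⟨s, rfl⟩ := hK
  obtain ⟨m₀, hm₀⟩ := ne_zero_iff.1 hirr.ne_zero
  obtain ⟨u, hu⟩ : ∃ u, u = (p.coeff m₀)⁻¹ := ⟨_, rfl⟩
  have hu0 : u ≠ 0 := hu ▸ inv_ne_zero hm₀
  have hC0 : (C u : MvPolynomial (Fin (n + 1)) ℂ) ≠ 0 := (C_ne_zero).2 hu0
  obtain ⟨q, hq⟩ : ∃ q, q = C u * p := ⟨_, rfl⟩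
  have hqirr : Irreducible q := by
    rw [hq, irreducible_isUnit_mul (hu0.isUnit.map C)]
    exact hirr
  have hpd (i) : pderiv i q = C u * pderiv i p := by rw [hq, pderiv_C_mul]
  obtain ⟨z, hzH, hz0, hzi⟩ := hMSCD.exists_independent_solution hj hn hqirr
    (fun h => mul_ne_zero hC0 hdX (hpd 0 ▸ pderiv_eq_zero_of_degreeOf h))
    (hpd (Fin.last n) ▸ mul_ne_zero hC0 hdYn)
    (m₀ := m₀) (by rw [hq, coeff_C_mul, hu, inv_mul_cancel₀ hm₀])
    (κ := s ∪ q.coeffs ∪ {0})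
    ((s.finite_toSet.union q.coeffs.finite_toSet).union (Set.finite_singleton 0))
    (fun m => by
      by_cases h : q.coeff m = 0
      · exact Or.inr h
      · exact Or.inl (Or.inr (coeff_mem_coeffs m h)))
  have hzp : eval (fun k : Fin (n + 1) => jIt j k z) p = 0 := by
    rw [hq, map_mul, eval_C] at hz0
    exact (mul_eq_zero.1 hz0).resolve_left hu0
  have hne : Z ≠ Set.univ := by
    rintro rfl
    refine hirr.ne_zero (MvPolynomial.funext fun x => ?_)
    rw [map_zero]
    exact hZ.le (Set.mem_univ x)
  have hmem : (fun k : Fin (n + 1) => jIt j k z) ∈ Z := hZ ▸ hzp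
  refine ⟨z, mem_HHn hzH, hmem, ?_, ?_⟩
  · refine trdegF_eq_of_aindOn (u := fun i => jIt j i z) (Subfield.closure_le.2 ?_) hZdef
      hne hzi hmem
    exact fun x hx => mem_acl_of_mem (Or.inl (Or.inl hx))
  · have hZl : Z = zeroLocus ℂ (Ideal.span {p}) := by
      rw [hZ, zeroLocus_span]
      simp [aeval_eq_eval]
    rw [hZl]
    exact adim_zeroLocus (ringKrullDim_quotient_span_singleton (by simp) hirr.ne_zero hzp)

end ModularJPaper
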